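/- arXiv:2411.15485 — 4 statements merged into one kernel-verified Lean document; each statement's English description precedes it below -/
import Mathlib

section
/- There exists a constant β₀ ≥ 0 such that for every β ≥ β₀ there exist constants C > 0 and n₀ ≥ 1 with sup_{n ≥ n₀} ∫_ℝ |e^{−β(t+δ)}·R_{Π_n}(n(t+δ)) − e^{−βt}·R_{Π_n}(nt)|² dt ≤ C·δ for every δ ≥ 0. -/
open MeasureTheory Real Set Filter Topology

noncomputable def tailNu (ν : Measure ℝ) (y : ℝ) : ℝ := (ν (Set.Ici y)).toReal

noncomputable def itailNu (ν : Measure ℝ) (x : ℝ) : ℝ := ∫ y in Set.Ioi x, tailNu ν y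

noncomputable def phi (b c : ℝ) (ν : Measure ℝ) (l : ℝ) : ℝ :=
  b * l + c * l ^ 2 + ∫ y in Set.Ioi (0 : ℝ), (Real.exp (-l * y) - 1 + l * y) ∂ν

noncomputable def expDens (c y : ℝ) : ℝ := (1 / c) * Real.exp (-y / c)

noncomputable def gam (b c : ℝ) (ν : Measure ℝ) (η : ℕ → ℝ) (n : ℕ) : ℝ :=
  (1 / c) * max 0 (1 - b / (n : ℝ) - (1 / (n : ℝ)) * ∫ y in Set.Ioi (0 : ℝ), tailNu ν (η n + y))

noncomputable def piDens (c θn : ℝ) (Λn : Measure ℝ) (y : ℝ) : ℝ :=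
  (1 - θn) * expDens c y + θn * ∫ u in Set.Icc (0 : ℝ) y, expDens c (y - u) ∂Λn

noncomputable def piTail (c θn : ℝ) (Λn : Measure ℝ) (x : ℝ) : ℝ :=
  ∫ y in Set.Ioi x, piDens c θn Λn y

noncomputable def piTailL1 (c θn : ℝ) (Λn : Measure ℝ) : ℝ :=
  ∫ y in Set.Ioi (0 : ℝ), piTail c θn Λn y

noncomputable def convPos (f g : ℝ → ℝ) (x : ℝ) : ℝ := ∫ y in (0 : ℝ)..x, f (x - y) * g y

noncomputable def convIter (f : ℝ → ℝ) : ℕ → ℝ → ℝ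
  | 0 => f
  | k + 1 => convPos f (convIter f k)

/-- Resolvent of the second kind of `f`: the sum `Σ_{k≥1} f^{*k}`, set to `0` on `(−∞,0)`. -/
noncomputable def resolventSnd (f : ℝ → ℝ) (t : ℝ) : ℝ :=
  if t < 0 then 0 else ∑' k : ℕ, convIter f k t

noncomputable def RPi (b c : ℝ) (ν : Measure ℝ) (η θ : ℕ → ℝ) (Λ : ℕ → Measure ℝ)
    (n : ℕ) : ℝ → ℝ :=
  resolventSnd (fun t => gam b c ν η n * piTail c (θ n) (Λ n) t)

noncomputable def Rtwo (b c : ℝ) (ν : Measure ℝ) (η θ : ℕ → ℝ) (Λ : ℕ → Measure ℝ)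
    (n : ℕ) (t y : ℝ) : ℝ :=
  if t < 0 ∨ y < 0 then 0
  else (if t < y then 1 else 0) + ∫ s in (t - y)..t, RPi b c ν η θ Λ n s


theorem plancherel_aux (f : ℝ → ℂ) (hf : Integrable f) (hf2 : MemLp f 2) :
    ∫ t, ‖f t‖ ^ 2 = ∫ w, ‖FourierTransform.fourier f w‖ ^ 2 := by
  set g : Lp (α := ℝ) ℂ 2 := hf2.toLp f with hg
  have hcont : Continuous (FourierTransform.fourier f) :=
    VectorFourier.fourierIntegral_continuous Real.continuous_fourierChar
      (by exact continuous_inner) hf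
  have key : ∀ᵐ w, FourierTransform.fourier f w = (FourierTransform.fourier g : Lp (α := ℝ) ℂ 2) w := by
    apply ae_eq_of_integral_contDiff_smul_eq hcont.locallyIntegrable
    · exact (Lp.memLp _).locallyIntegrable (by norm_num)
    intro φ hφ hφs
    have hφ' : ContDiff ℝ (⊤ : ℕ∞) (fun x => (φ x : ℂ)) := Complex.ofRealCLM.contDiff.comp hφ
    have hφs' : HasCompactSupport (fun x => (φ x : ℂ)) := hφs.comp_left (g := fun x : ℝ => (x:ℂ)) (by simp)
    let Φ : SchwartzMap ℝ ℂ := hφs'.toSchwartzMap hφ'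
    have h1 := congrArg (fun T => T Φ) (Lp.fourier_toTemperedDistribution_eq g)
    simp only [TemperedDistribution.fourier_apply, Lp.toTemperedDistribution_apply] at h1
    have h2 := VectorFourier.integral_fourierIntegral_smul_eq_flip (L := innerₗ ℝ) (μ := volume) (ν := volume) (f := (Φ : ℝ → ℂ)) (g := f) Real.continuous_fourierChar (by exact continuous_inner) Φ.integrable hf
    rw [flip_innerₗ] at h2
    have h3 : ∫ x, (FourierTransform.fourier Φ : SchwartzMap ℝ ℂ) x • g x = ∫ x, (FourierTransform.fourier Φ : SchwartzMap ℝ ℂ) x • f x := by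
      apply integral_congr_ae
      filter_upwards [hf2.coeFn_toLp] with x hx
      rw [hg, hx]
    have h4 : ∫ x, φ x • FourierTransform.fourier f x = ∫ x, Φ x • FourierTransform.fourier f x := rfl
    have h5 : ∫ x, φ x • (FourierTransform.fourier g : Lp (α := ℝ) ℂ 2) x = ∫ x, Φ x • (FourierTransform.fourier g : Lp (α := ℝ) ℂ 2) x := rfl
    rw [h4, h5, ← h1, h3]
    exact h2.symm
  have n1 : ‖g‖ ^ 2 = ∫ t, ‖f t‖ ^ 2 := by
    rw [← @inner_self_eq_norm_sq ℂ, MeasureTheory.L2.inner_def, ← integral_re (L2.integrable_inner _ _)]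
    apply integral_congr_ae
    filter_upwards [hf2.coeFn_toLp] with x hx
    rw [hg, hx, inner_self_eq_norm_sq]
  have n2 : ‖(FourierTransform.fourier g : Lp (α := ℝ) ℂ 2)‖ ^ 2 = ∫ w, ‖FourierTransform.fourier f w‖ ^ 2 := by
    rw [← @inner_self_eq_norm_sq ℂ, MeasureTheory.L2.inner_def, ← integral_re (L2.integrable_inner _ _)]
    apply integral_congr_ae
    filter_upwards [key] with x hx
    rw [hx, inner_self_eq_norm_sq]
  rw [← n1, ← n2, Lp.norm_fourier_eq]

theorem fourier_shift_aux (f : ℝ → ℂ) (hf : Integrable f) (δ w : ℝ) :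
    FourierTransform.fourier (fun t => f (t + δ) - f t) w
      = (Complex.exp (((2 * π * δ * w : ℝ) : ℂ) * Complex.I) - 1) * FourierTransform.fourier f w := by
  have e1 : Integrable (fun v : ℝ => Complex.exp (↑(-2 * π * v * w) * Complex.I) • f v) := by
    have := (Real.fourierIntegral_convergent_iff (μ := volume) (f := f) w).2 hf
    refine this.congr (Eventually.of_forall fun v => ?_)
    simp only [Real.fourierChar_apply, Circle.smul_def]
    congr 2
    push_cast
    simp
    ring
  have e2 : Integrable (fun v : ℝ => Complex.exp (↑(-2 * π * v * w) * Complex.I) • f (v + δ)) := by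
    have := (Real.fourierIntegral_convergent_iff (μ := volume) (f := fun t => f (t + δ)) w).2 (hf.comp_add_right δ)
    refine this.congr (Eventually.of_forall fun v => ?_)
    simp only [Real.fourierChar_apply, Circle.smul_def]
    congr 2
    push_cast
    simp
    ring
  rw [Real.fourier_real_eq_integral_exp_smul, Real.fourier_real_eq_integral_exp_smul]
  simp_rw [smul_sub]
  rw [integral_sub e2 e1, sub_mul, one_mul]
  congr 1
  rw [← integral_const_mul]
  conv_rhs => rw [← integral_add_right_eq_self _ δ]
  refine integral_congr_ae (Eventually.of_forall fun v => ?_)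
  simp only [smul_eq_mul]
  rw [← mul_assoc, ← Complex.exp_add, Complex.ofReal_mul]
  congr 2
  push_cast
  ring

theorem shift_bound_aux (f : ℝ → ℂ) (hf : Integrable f) (hf2 : MemLp f 2) (K : ℝ)
    (hb : ∀ w : ℝ, w ≠ 0 → ‖FourierTransform.fourier f w‖ ≤ K / |w|) (δ : ℝ) (hδ : 0 ≤ δ) :
    ∫ t, ‖f (t + δ) - f t‖ ^ 2 ≤ 10 * π ^ 2 * K ^ 2 * δ := by
  rcases hδ.eq_or_lt with rfl | hδ
  · simp
  have i1 : Integrable (fun t => f (t + δ) - f t) := (hf.comp_add_right δ).sub hf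
  have m1 : MemLp (fun t => f (t + δ) - f t) 2 :=
    (hf2.comp_measurePreserving (measurePreserving_add_right volume δ)).sub hf2
  rw [plancherel_aux _ i1 m1]
  have ib : Integrable (fun w : ℝ => 20 * π ^ 2 * δ ^ 2 * K ^ 2 * (1 + (2 * π * δ * w) ^ 2)⁻¹) := by
    apply Integrable.const_mul
    exact integrable_inv_one_add_sq.comp_mul_left' (by positivity)
  have vb : ∫ w : ℝ, 20 * π ^ 2 * δ ^ 2 * K ^ 2 * (1 + (2 * π * δ * w) ^ 2)⁻¹ = 10 * π ^ 2 * K ^ 2 * δ := by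
    rw [integral_const_mul, Measure.integral_comp_mul_left (fun x : ℝ => (1 + x ^ 2)⁻¹), integral_univ_inv_one_add_sq,
      abs_of_pos (by positivity)]
    simp only [smul_eq_mul]
    field_simp
    ring
  rw [← vb]
  apply integral_mono_of_nonneg (Eventually.of_forall fun w => by positivity) ib
  have : ∀ᵐ w : ℝ, w ≠ 0 := by simp [ae_iff]
  filter_upwards [this] with w hw
  rw [fourier_shift_aux f hf, norm_mul, mul_pow]
  set x := 2 * π * δ * w with hx
  have hx0 : x ≠ 0 := by positivity
  have n1 : ‖Complex.exp ((x : ℂ) * Complex.I) - 1‖ ≤ |x| := by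
    have := Real.norm_exp_I_mul_ofReal_sub_one_le (x := x)
    rw [mul_comm] at this
    simpa using this
  have n2 : ‖Complex.exp ((x : ℂ) * Complex.I) - 1‖ ≤ 2 := by
    refine (norm_sub_le _ _).trans ?_
    rw [Complex.norm_exp_ofReal_mul_I]; norm_num
  have q1 : ‖Complex.exp ((x : ℂ) * Complex.I) - 1‖ ^ 2 ≤ x ^ 2 := by
    rw [← sq_abs x]; gcongr
  have q2 : ‖Complex.exp ((x : ℂ) * Complex.I) - 1‖ ^ 2 ≤ 4 := by
    calc _ ≤ (2 : ℝ) ^ 2 := by gcongr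
      _ = 4 := by norm_num
  have q3 : ‖Complex.exp ((x : ℂ) * Complex.I) - 1‖ ^ 2 ≤ 5 * x ^ 2 * (1 + x ^ 2)⁻¹ := by
    rw [← div_eq_mul_inv, le_div_iff₀ (by positivity)]
    nlinarith [sq_nonneg x]
  calc _ ≤ (5 * x ^ 2 * (1 + x ^ 2)⁻¹) * (K / |w|) ^ 2 := by
        gcongr
        exact hb w hw
    _ = _ := by
        rw [div_pow, sq_abs]
        have : x ^ 2 = 4 * π ^ 2 * δ ^ 2 * w ^ 2 := by rw [hx]; ring
        rw [show 5 * x ^ 2 * (1 + x ^ 2)⁻¹ * (K ^ 2 / w ^ 2) = (5 * x ^ 2 * (K ^ 2 / w ^ 2)) * (1 + x ^ 2)⁻¹ by ring]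
        congr 1
        rw [this]; field_simp; ring

theorem convIter_laplace (F : ℝ → ℝ) (z : ℂ)
    (hint : IntegrableOn (fun t : ℝ => Complex.exp (-z * t) * (F t : ℂ)) (Ioi 0)) (k : ℕ) :
    IntegrableOn (fun t : ℝ => Complex.exp (-z * t) * (convIter F k t : ℂ)) (Ioi 0) ∧
    ∫ t in Ioi (0:ℝ), Complex.exp (-z * t) * (convIter F k t : ℂ)
      = (∫ t in Ioi (0:ℝ), Complex.exp (-z * t) * (F t : ℂ)) ^ (k + 1) := by
  induction k with
  | zero => exact ⟨by simpa [convIter] using hint, by simp [convIter]⟩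
  | succ k ih =>
    have key : ∀ x : ℝ, Complex.exp (-z * x) * (convIter F (k + 1) x : ℂ)
        = ∫ t in (0:ℝ)..x, (ContinuousLinearMap.mul ℝ ℂ) (Complex.exp (-z * t) * (convIter F k t : ℂ))
            ((fun t : ℝ => Complex.exp (-z * t) * (F t : ℂ)) (x - t)) := by
      intro x
      rw [convIter, convPos, ← intervalIntegral.integral_ofReal, ← intervalIntegral.integral_const_mul]
      apply intervalIntegral.integral_congr
      intro t _
      simp only [ContinuousLinearMap.mul_apply']
      rw [show (-z * x : ℂ) = -z * t + -z * ((x - t : ℝ) : ℂ) by push_cast; ring, Complex.exp_add]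
      push_cast
      ring
    constructor
    · have := (integrable_posConvolution (μ := volume) (ν := volume) ih.1 hint (ContinuousLinearMap.mul ℝ ℂ)).integrableOn (s := Ioi 0)
      refine this.congr_fun ?_ measurableSet_Ioi
      intro x hx
      simp only [posConvolution]
      rw [indicator_of_mem hx, key]
    · simp_rw [key]
      rw [integral_posConvolution ih.1 hint, ih.2]
      simp [pow_succ]

theorem resolvent_aux (F : ℝ → ℝ) (hF0 : ∀ t, 0 ≤ t → 0 ≤ F t) (B : ℝ) (hFB : ∀ t, 0 ≤ t → F t ≤ B)
    (l : ℝ) (hl : 0 < l)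
    (hint : IntegrableOn (fun t : ℝ => Real.exp (-l * t) * F t) (Ioi 0))
    (hm : ∫ t in Ioi (0:ℝ), Real.exp (-l * t) * F t < 1) :
    IntegrableOn (fun t : ℝ => Real.exp (-l * t) * resolventSnd F t) (Ioi 0) ∧
    (∃ B' : ℝ, ∀ t, 0 ≤ t → |Real.exp (-l * t) * resolventSnd F t| ≤ B') ∧
    ∀ z : ℂ, z.re = l → 
      ∫ t in Ioi (0:ℝ), Complex.exp (-z * t) * (resolventSnd F t : ℂ)
       = (∫ t in Ioi (0:ℝ), Complex.exp (-z * t) * (F t : ℂ)) /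
          (1 - ∫ t in Ioi (0:ℝ), Complex.exp (-z * t) * (F t : ℂ)) := by
  set m := ∫ t in Ioi (0:ℝ), Real.exp (-l * t) * F t with hmdef
  have hB : 0 ≤ B := (hF0 0 le_rfl).trans (hFB 0 le_rfl)
  have hm0 : 0 ≤ m := setIntegral_nonneg measurableSet_Ioi fun t ht => mul_nonneg (Real.exp_pos _).le (hF0 t (le_of_lt ht))
  have hnexp : ∀ (z : ℂ), z.re = l → ∀ t : ℝ, ‖Complex.exp (-z * t)‖ = Real.exp (-l * t) := by
    intro z hz t
    rw [Complex.norm_exp]; simp [hz]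
  have hintz : ∀ z : ℂ, z.re = l → IntegrableOn (fun t : ℝ => Complex.exp (-z * t) * (F t : ℂ)) (Ioi 0) := by
    intro z hz
    have h1 : IntegrableOn (fun t : ℝ => ((Real.exp (-l * t) * F t : ℝ) : ℂ)) (Ioi 0) := hint.ofReal
    have h2 : IntegrableOn (fun t : ℝ => Complex.exp (-(z - l) * t) * ((Real.exp (-l * t) * F t : ℝ) : ℂ)) (Ioi 0) := by
      refine h1.bdd_mul (c := 1) (by fun_prop) (Eventually.of_forall fun t => ?_)
      rw [Complex.norm_exp]; simp [hz]
    refine h2.congr_fun (fun t _ => ?_) measurableSet_Ioi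
    simp only
    push_cast
    rw [← mul_assoc, ← Complex.exp_add]
    congr 2
    ring
  have hlz : ((l : ℂ)).re = l := by simp
  have hreal : ∀ k, IntegrableOn (fun t : ℝ => Real.exp (-l * t) * convIter F k t) (Ioi 0) ∧
      ∫ t in Ioi (0:ℝ), Real.exp (-l * t) * convIter F k t = m ^ (k + 1) := by
    intro k
    obtain ⟨h1, h2⟩ := convIter_laplace F l (hintz l hlz) k
    have e : ∀ g : ℝ → ℝ, (fun t : ℝ => Complex.exp (-(l:ℂ) * t) * (g t : ℂ)) = fun t : ℝ => ((Real.exp (-l * t) * g t : ℝ) : ℂ) := by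
      intro g; ext t; push_cast; rfl
    rw [e] at h1 h2
    rw [e, integral_complex_ofReal, integral_complex_ofReal] at h2
    refine ⟨?_, by exact_mod_cast h2⟩
    exact h1.re
  have hbd : ∀ k t, 0 ≤ t → 0 ≤ convIter F k t ∧ Real.exp (-l * t) * convIter F k t ≤ B * m ^ k := by
    intro k
    induction k with
    | zero =>
      intro t ht
      refine ⟨hF0 t ht, ?_⟩
      simp only [convIter, pow_zero, mul_one]
      have : Real.exp (-l * t) ≤ 1 := Real.exp_le_one_iff.2 (by nlinarith)
      calc _ ≤ 1 * F t := by gcongr; exact hF0 t ht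
        _ ≤ B := by simpa using hFB t ht
    | succ k ih =>
      intro t ht
      constructor
      · rw [convIter, convPos]
        apply intervalIntegral.integral_nonneg ht
        intro u hu
        exact mul_nonneg (hF0 _ (by linarith [hu.2])) (ih u hu.1).1
      · rw [convIter, convPos, ← intervalIntegral.integral_const_mul, intervalIntegral.integral_of_le ht,
          pow_succ, ← pow_succ, ← (hreal k).2, ← integral_const_mul]
        have hsub : Ioc 0 t ⊆ Ioi (0:ℝ) := fun x hx => hx.1
        calc _ ≤ ∫ y in Ioc 0 t, B * (Real.exp (-l * y) * convIter F k y) := by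
              apply integral_mono_of_nonneg
              · filter_upwards [ae_restrict_mem measurableSet_Ioc] with u hu
                exact mul_nonneg (Real.exp_pos _).le (mul_nonneg (hF0 _ (by linarith [hu.2])) (ih u hu.1.le).1)
              · exact ((hreal k).1.mono_set hsub).const_mul B
              · filter_upwards [ae_restrict_mem measurableSet_Ioc] with u hu
                have h1 := hFB (t - u) (by linarith [hu.2])
                have h0 := hF0 (t - u) (by linarith [hu.2])
                have h2 : Real.exp (-l * t) ≤ Real.exp (-l * u) := Real.exp_le_exp.2 (by nlinarith [hu.2])
                have h3 := (ih u hu.1.le).1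
                calc _ ≤ Real.exp (-l * u) * (B * convIter F k u) := by gcongr
                  _ = _ := by ring
          _ ≤ _ := by
              apply setIntegral_mono_set ((hreal k).1.const_mul B) _ hsub.eventuallyLE
              filter_upwards [ae_restrict_mem measurableSet_Ioi] with u hu
              exact mul_nonneg hB (mul_nonneg (Real.exp_pos _).le (ih u (le_of_lt hu)).1)
  have hgeo : Summable fun k => B * m ^ k := (summable_geometric_of_lt_one hm0 hm).mul_left B
  have hnn : ∀ k t, 0 ≤ t → 0 ≤ Real.exp (-l * t) * convIter F k t := fun k t ht =>
    mul_nonneg (Real.exp_pos _).le (hbd k t ht).1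
  have hsum : ∀ t, 0 ≤ t → Summable fun k => Real.exp (-l * t) * convIter F k t := fun t ht =>
    Summable.of_nonneg_of_le (fun k => hnn k t ht) (fun k => (hbd k t ht).2) hgeo
  have hR : ∀ t, 0 ≤ t → Real.exp (-l * t) * resolventSnd F t = ∑' k, Real.exp (-l * t) * convIter F k t := by
    intro t ht
    rw [resolventSnd, if_neg (not_lt.2 ht), tsum_mul_left]
  have hRz : ∀ (z : ℂ) (t : ℝ), 0 ≤ t → Complex.exp (-z * t) * (resolventSnd F t : ℂ) = ∑' k, Complex.exp (-z * t) * (convIter F k t : ℂ) := by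
    intro z t ht
    rw [resolventSnd, if_neg (not_lt.2 ht), tsum_mul_left, Complex.ofReal_tsum]
  have hnorm : ∀ z : ℂ, z.re = l → ∀ k, ∫ t in Ioi (0:ℝ), ‖Complex.exp (-z * t) * (convIter F k t : ℂ)‖ = m ^ (k + 1) := by
    intro z hz k
    rw [← (hreal k).2]
    refine setIntegral_congr_fun measurableSet_Ioi fun t ht => ?_
    rw [norm_mul, hnexp z hz, Complex.norm_real, Real.norm_of_nonneg (hbd k t (le_of_lt ht)).1]
  have hgm : Summable fun k => m ^ (k + 1) := by
    simpa [pow_succ] using (summable_geometric_of_lt_one hm0 hm).mul_right m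
  refine ⟨?_, ⟨∑' k, B * m ^ k, fun t ht => ?_⟩, fun z hz => ?_⟩
  · refine integrable_of_tendsto (G := fun n t => ∑ k ∈ Finset.range n, Real.exp (-l * t) * convIter F k t) ?_ ?_ ?_
    · filter_upwards [ae_restrict_mem measurableSet_Ioi] with t ht
      rw [hR t (le_of_lt ht)]
      exact (hsum t (le_of_lt ht)).hasSum.tendsto_sum_nat
    · intro n
      exact (integrable_finsetSum _ fun k _ => (hreal k).1).aestronglyMeasurable
    · refine ne_top_of_le_ne_top (b := ENNReal.ofReal (∑' k, m ^ (k + 1))) ENNReal.ofReal_ne_top ?_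
      refine liminf_le_of_frequently_le' (Frequently.of_forall fun n => ?_)
      rw [← ofReal_integral_norm_eq_lintegral_enorm (integrable_finsetSum _ fun k _ => (hreal k).1)]
      apply ENNReal.ofReal_le_ofReal
      calc _ = ∫ t in Ioi (0:ℝ), ∑ k ∈ Finset.range n, Real.exp (-l * t) * convIter F k t := by
            refine setIntegral_congr_fun measurableSet_Ioi fun t ht => ?_
            exact Real.norm_of_nonneg (Finset.sum_nonneg fun k _ => hnn k t (le_of_lt ht))
        _ = ∑ k ∈ Finset.range n, m ^ (k + 1) := by
            rw [integral_finsetSum _ fun k _ => (hreal k).1]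
            simp_rw [fun k => (hreal k).2]
        _ ≤ _ := hgm.sum_le_tsum _ fun k _ => by positivity
  · rw [hR t ht, abs_of_nonneg (tsum_nonneg fun k => hnn k t ht)]
    exact (hsum t ht).tsum_le_tsum (fun k => (hbd k t ht).2) hgeo
  · have h := hasSum_integral_of_summable_integral_norm (μ := volume.restrict (Ioi (0:ℝ)))
      (F := fun (k : ℕ) (t : ℝ) => Complex.exp (-z * t) * (convIter F k t : ℂ))
      (fun k => (convIter_laplace F z (hintz z hz) k).1) (by simpa only [hnorm z hz] using hgm)
    rw [setIntegral_congr_fun measurableSet_Ioi (fun t ht => hRz z t (le_of_lt ht))]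
    rw [← h.tsum_eq]
    simp_rw [fun k => (convIter_laplace F z (hintz z hz) k).2]
    have hlt : ‖∫ t in Ioi (0:ℝ), Complex.exp (-z * t) * (F t : ℂ)‖ < 1 := by
      refine (norm_integral_le_integral_norm _).trans_lt ?_
      have := hnorm z hz 0
      simp only [convIter] at this
      rw [this]; simpa using hm
    simp_rw [pow_succ]
    rw [tsum_mul_right, tsum_geometric_of_norm_lt_one hlt]
    rw [div_eq_mul_inv, mul_comm]

theorem expDens_tail (c : ℝ) (hc : 0 < c) (a u : ℝ) :
    IntegrableOn (fun y => expDens c (y - u)) (Ioi a) ∧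
    ∫ y in Ioi a, expDens c (y - u) = Real.exp (-(a - u) / c) := by
  have e : (fun y => expDens c (y - u)) = fun y => (1 / c * Real.exp (u / c)) * Real.exp (-(1 / c) * y) := by
    ext y
    rw [expDens, mul_assoc, ← Real.exp_add]
    congr 2
    field_simp
    ring
  have h1 : IntegrableOn (fun y => Real.exp (-(1 / c) * y)) (Ioi a) :=
    integrableOn_exp_mul_Ioi (by simpa using hc) a
  rw [e]
  refine ⟨h1.const_mul _, ?_⟩
  rw [integral_const_mul, integral_exp_mul_Ioi (by simpa using hc)]
  rw [show -(a - u) / c = u / c + -(1 / c) * a by field_simp; ring, Real.exp_add]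
  field_simp

theorem piTail_formula (c θ : ℝ) (hc : 0 < c) (Λ : Measure ℝ) [IsProbabilityMeasure Λ]
    (hs : Λ (Iic 0) = 0) (x : ℝ) (_hx : 0 ≤ x) :
    piTail c θ Λ x = (1 - θ) * Real.exp (-x / c) + θ * ∫ u, Real.exp (-(max x u - u) / c) ∂Λ := by
  have hpos : ∀ᵐ u ∂Λ, 0 < u := by
    rw [ae_iff]; simpa [Iic] using hs
  let k : ℝ → ℝ → ℝ := fun y u => if 0 ≤ u ∧ u ≤ y then expDens c (y - u) else 0
  have kint : ∀ y, ∫ u in Icc 0 y, expDens c (y - u) ∂Λ = ∫ u, k y u ∂Λ := by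
    intro y
    rw [← integral_indicator measurableSet_Icc]
    refine integral_congr_ae (Eventually.of_forall fun u => ?_)
    simp only [indicator, mem_Icc, k]
  have kmeas : Measurable (Function.uncurry k) := by
    unfold k Function.uncurry expDens
    refine Measurable.ite ?_ (by fun_prop) (by fun_prop)
    exact (measurableSet_le measurable_const measurable_snd).inter (measurableSet_le measurable_snd measurable_fst)
  have kind : ∀ u, 0 < u → (Ioi x).indicator (fun y => k y u) =ᵐ[volume] (Ioi (max x u)).indicator (fun y => expDens c (y - u)) := by
    intro u hu
    have : ∀ᵐ y : ℝ, y ≠ u := by simp [ae_iff]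
    filter_upwards [this] with y hy
    simp only [indicator, mem_Ioi, k, max_lt_iff]
    have : u ≤ y ↔ u < y := ⟨fun h => lt_of_le_of_ne h (Ne.symm hy), le_of_lt⟩
    simp only [this, hu.le, true_and]
    split_ifs <;> tauto
  have kI : ∀ u, 0 < u → IntegrableOn (fun y => k y u) (Ioi x) := by
    intro u hu
    rw [← integrable_indicator_iff measurableSet_Ioi, integrable_congr (kind u hu), integrable_indicator_iff measurableSet_Ioi]
    exact (expDens_tail c hc _ _).1
  have kV : ∀ u, 0 < u → ∫ y in Ioi x, k y u = Real.exp (-(max x u - u) / c) := by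
    intro u hu
    rw [← integral_indicator measurableSet_Ioi, integral_congr_ae (kind u hu), integral_indicator measurableSet_Ioi]
    exact (expDens_tail c hc _ _).2
  have knn : ∀ y u, 0 ≤ k y u := by
    intro y u
    simp only [k, expDens]
    split_ifs <;> positivity
  have sI : Integrable (fun u => Real.exp (-(max x u - u) / c)) Λ := by
    refine Integrable.of_bound (by fun_prop) 1 (Eventually.of_forall fun u => ?_)
    rw [Real.norm_of_nonneg (Real.exp_pos _).le]
    apply Real.exp_le_one_iff.2
    rw [neg_div]
    have := le_max_right x u
    have : 0 ≤ (max x u - u) / c := div_nonneg (by linarith) hc.le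
    linarith
  have pI : Integrable (Function.uncurry k) ((volume.restrict (Ioi x)).prod Λ) := by
    rw [integrable_prod_iff' kmeas.aestronglyMeasurable]
    constructor
    · filter_upwards [hpos] with u hu using kI u hu
    · refine sI.congr ?_
      filter_upwards [hpos] with u hu
      rw [← kV u hu]
      simp only [Function.uncurry, Real.norm_of_nonneg (knn _ _)]
  have hE := expDens_tail c hc x 0
  simp only [sub_zero] at hE
  have pL : Integrable (fun y => ∫ u, k y u ∂Λ) (volume.restrict (Ioi x)) := pI.integral_prod_left
  rw [piTail]
  simp only [piDens, kint]
  rw [integral_add (hE.1.const_mul _) (pL.const_mul _), integral_const_mul, integral_const_mul, hE.2,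
    integral_integral_swap pI]
  congr 2
  apply integral_congr_ae
  filter_upwards [hpos] with u hu using kV u hu

theorem laplace_s (c : ℝ) (hc : 0 < c) (z : ℂ) (hz : 0 < z.re) (u : ℝ) (hu : 0 ≤ u) :
    ∫ x in Ioi (0:ℝ), Complex.exp (-z * x) * (Real.exp (-(max x u - u) / c) : ℂ)
     = (c + (1 - Complex.exp (-z * u)) / z) / (1 + c * z) := by
  have hz0 : z ≠ 0 := fun h => by simp [h] at hz
  have hcz : (1 + c * z : ℂ) ≠ 0 := by
    intro h
    have := congrArg Complex.re h
    simp at this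
    nlinarith
  have hc0 : (c : ℂ) ≠ 0 := by exact_mod_cast hc.ne'
  have e2 : ∀ x ∈ Ioi u, Complex.exp (-z * x) * (Real.exp (-(max x u - u) / c) : ℂ) = Complex.exp (u / c) * Complex.exp (-(z + 1 / c) * x) := by
    intro x hx
    rw [max_eq_left (le_of_lt hx), Complex.ofReal_exp, ← Complex.exp_add, ← Complex.exp_add]
    congr 1
    push_cast
    field_simp
    ring
  have e1 : ∀ x ∈ Ioc 0 u, Complex.exp (-z * x) * (Real.exp (-(max x u - u) / c) : ℂ) = Complex.exp (-z * x) := by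
    intro x hx
    rw [max_eq_right hx.2]; simp
  have hre : (-(z + 1 / c) : ℂ).re < 0 := by
    have : ((1:ℂ) / c).re = 1 / c := by
      rw [show (1:ℂ) / c = ((1 / c : ℝ) : ℂ) by push_cast; rfl, Complex.ofReal_re]
    rw [Complex.neg_re, Complex.add_re, this]
    have : 0 < 1 / c := by positivity
    linarith
  have i2 : IntegrableOn (fun x : ℝ => Complex.exp (u / c) * Complex.exp (-(z + 1 / c) * x)) (Ioi u) :=
    (integrableOn_exp_mul_complex_Ioi hre u).const_mul _
  rw [← Ioc_union_Ioi_eq_Ioi hu, setIntegral_union (Ioc_disjoint_Ioi le_rfl) measurableSet_Ioi,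
    setIntegral_congr_fun measurableSet_Ioi e2, setIntegral_congr_fun measurableSet_Ioc e1,
    ← intervalIntegral.integral_of_le hu, integral_exp_mul_complex (neg_ne_zero.2 hz0), integral_const_mul,
    integral_exp_mul_complex_Ioi hre]
  · have h3 : Complex.exp (u / c) * (-Complex.exp (-(z + 1 / c) * u) / (-(z + 1 / c))) = Complex.exp (-z * u) / (z + 1 / c) := by
      rw [neg_div_neg_eq, ← mul_div_assoc, ← Complex.exp_add]
      congr 2
      field_simp
      ring
    rw [h3]
    have : (z + 1 / c : ℂ) = (1 + c * z) / c := by field_simp; ring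
    rw [this]
    simp only [Complex.ofReal_zero, mul_zero, Complex.exp_zero]
    generalize Complex.exp (-z * u) = E
    rw [div_div_eq_mul_div, div_neg, ← neg_div, div_add_div _ _ hz0 hcz, div_eq_div_iff (mul_ne_zero hz0 hcz) hcz]
    field_simp
    ring
  · refine IntegrableOn.congr_fun (f := fun x : ℝ => Complex.exp (-z * x)) ?_ (fun x hx => (e1 x hx).symm) measurableSet_Ioc
    exact (by fun_prop : Continuous fun x : ℝ => Complex.exp (-z * x)).integrableOn_Ioc
  · exact i2.congr_fun (fun x hx => (e2 x hx).symm) measurableSet_Ioi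

theorem piTail_laplace (c θ : ℝ) (hc : 0 < c) (Λ : Measure ℝ) [IsProbabilityMeasure Λ]
    (hs : Λ (Iic 0) = 0) (z : ℂ) (hz : 0 < z.re) :
    IntegrableOn (fun t : ℝ => Complex.exp (-z * t) * (piTail c θ Λ t : ℂ)) (Ioi 0) ∧
    ∫ t in Ioi (0:ℝ), Complex.exp (-z * t) * (piTail c θ Λ t : ℂ)
      = (c + θ * ∫ u, (1 - Complex.exp (-z * (u:ℝ))) / z ∂Λ) / (1 + c * z) := by
  have hpos : ∀ᵐ u ∂Λ, 0 < u := by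
    rw [ae_iff]; simpa [Iic] using hs
  have hcz : (1 + c * z : ℂ) ≠ 0 := by
    intro h
    have := congrArg Complex.re h
    simp at this
    nlinarith
  have hez : IntegrableOn (fun x : ℝ => Complex.exp (-z * x)) (Ioi 0) :=
    integrableOn_exp_mul_complex_Ioi (by simpa using hz) 0
  have sle : ∀ x u : ℝ, ‖(Real.exp (-(max x u - u) / c) : ℂ)‖ ≤ 1 := by
    intro x u
    rw [Complex.norm_real, Real.norm_of_nonneg (Real.exp_pos _).le]
    apply Real.exp_le_one_iff.2
    rw [neg_div]
    have := le_max_right x u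
    have : 0 ≤ (max x u - u) / c := div_nonneg (by linarith) hc.le
    linarith
  have pI : Integrable (Function.uncurry fun (x u : ℝ) => Complex.exp (-z * x) * (Real.exp (-(max x u - u) / c) : ℂ))
      ((volume.restrict (Ioi 0)).prod Λ) := by
    have h1 : Integrable (fun p : ℝ × ℝ => Complex.exp (-z * p.1) * (1 : ℂ)) ((volume.restrict (Ioi 0)).prod Λ) :=
      Integrable.mul_prod hez (integrable_const (1:ℂ))
    refine h1.mono (by unfold Function.uncurry; fun_prop) (Eventually.of_forall fun p => ?_)
    simp only [Function.uncurry]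
    rw [norm_mul, norm_mul, norm_one]
    gcongr
    exact sle _ _
  have e0 : ∀ x ∈ Ioi (0:ℝ), Complex.exp (-z * x) * (Real.exp (-(max x 0 - 0) / c) : ℂ) = Complex.exp (-z * x) * (Real.exp (-x / c) : ℂ) := by
    intro x hx
    rw [max_eq_left (le_of_lt hx), sub_zero]
  have v0 := laplace_s c hc z hz 0 le_rfl
  rw [setIntegral_congr_fun measurableSet_Ioi e0] at v0
  have i0 : IntegrableOn (fun x : ℝ => Complex.exp (-z * x) * (Real.exp (-x / c) : ℂ)) (Ioi 0) := by
    refine Integrable.mono hez (by fun_prop) ?_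
    filter_upwards [ae_restrict_mem measurableSet_Ioi] with x hx
    rw [norm_mul]
    refine mul_le_of_le_one_right (norm_nonneg _) ?_
    have := sle x 0
    rwa [max_eq_left (le_of_lt hx), sub_zero] at this
  have e : ∀ x ∈ Ioi (0:ℝ), (1 - θ : ℂ) * (Complex.exp (-z * x) * (Real.exp (-x / c) : ℂ)) + 
      θ * ∫ u, Complex.exp (-z * x) * (Real.exp (-(max x u - u) / c) : ℂ) ∂Λ
      = Complex.exp (-z * x) * (piTail c θ Λ x : ℂ) := by
    intro x hx
    rw [piTail_formula c θ hc Λ hs x (le_of_lt hx), integral_const_mul, integral_complex_ofReal]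
    push_cast
    ring
  have iS := i0.const_mul (1 - θ : ℂ)
  have iT := (pI.integral_prod_left).const_mul (θ : ℂ)
  refine ⟨IntegrableOn.congr_fun (iS.add iT) e measurableSet_Ioi, ?_⟩
  rw [← setIntegral_congr_fun measurableSet_Ioi e]
  refine (integral_add iS iT).trans ?_
  rw [integral_const_mul, integral_const_mul, v0]
  simp only [Function.uncurry]
  rw [integral_integral_swap pI]
  have : ∫ u, (∫ x in Ioi (0:ℝ), Complex.exp (-z * x) * (Real.exp (-(max x u - u) / c) : ℂ)) ∂Λ
     = ∫ u : ℝ, (c + (1 - Complex.exp (-z * u)) / z) / (1 + c * z) ∂Λ := by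
    apply integral_congr_ae
    filter_upwards [hpos] with u hu using laplace_s c hc z hz u hu.le
  rw [this, integral_div, integral_add]
  · simp
    field_simp
    ring
  · exact integrable_const _
  · refine Integrable.of_bound (by fun_prop) (2 / ‖z‖) ?_
    filter_upwards [hpos] with u hu
    rw [norm_div]
    gcongr
    refine (norm_sub_le _ _).trans ?_
    have : ‖Complex.exp (-z * u)‖ ≤ 1 := by
      rw [Complex.norm_exp]
      apply Real.exp_le_one_iff.2
      simp
      positivity
    simp only [norm_one]
    linarith

theorem q_im (z : ℂ) (hz : 0 < z.re) (u : ℝ) (hu : 0 ≤ u) :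
    ((1 - Complex.exp (-z * u)) / z).im * z.im ≤ 0 := by
  have hn : 0 < Complex.normSq z := Complex.normSq_pos.2 (fun h => by simp [h] at hz)
  have hre : (Complex.exp (-z * u)).re = Real.exp (-(z.re * u)) * Real.cos (z.im * u) := by
    rw [Complex.exp_re]; simp
  have him : (Complex.exp (-z * u)).im = -(Real.exp (-(z.re * u)) * Real.sin (z.im * u)) := by
    rw [Complex.exp_im]; simp
  rw [Complex.div_im, ← sub_div, div_mul_eq_mul_div]
  apply div_nonpos_of_nonpos_of_nonneg _ hn.le
  rw [Complex.sub_re, Complex.sub_im, hre, him]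
  simp only [Complex.one_re, Complex.one_im]
  set a := z.re
  set b := z.im
  have hE := Real.exp_pos (-(a * u))
  have h1 : Real.exp (-(a * u)) * Real.exp (a * u) = 1 := by rw [← Real.exp_add]; simp
  have h2 := Real.add_one_le_exp (a * u)
  have h3 : b * Real.sin (b * u) ≤ b ^ 2 * u := by
    calc _ ≤ |b * Real.sin (b * u)| := le_abs_self _
      _ = |b| * |Real.sin (b * u)| := abs_mul _ _
      _ ≤ |b| * |b * u| := mul_le_mul_of_nonneg_left Real.abs_sin_le_abs (abs_nonneg b)
      _ = b ^ 2 * u := by rw [abs_mul, abs_of_nonneg hu, ← mul_assoc, ← sq, sq_abs]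
  have h4 : b ^ 2 * Real.cos (b * u) ≤ b ^ 2 := by nlinarith [sq_nonneg b, Real.cos_le_one (b * u)]
  have h5 : a * (b * Real.sin (b * u)) + b ^ 2 * Real.cos (b * u) ≤ b ^ 2 * Real.exp (a * u) := by
    nlinarith [mul_le_mul_of_nonneg_left h3 hz.le, mul_le_mul_of_nonneg_left h2 (sq_nonneg b)]
  have h6 := mul_le_mul_of_nonneg_left h5 hE.le
  have h7 : Real.exp (-(a * u)) * (b ^ 2 * Real.exp (a * u)) = b ^ 2 := by
    rw [mul_left_comm, h1, mul_one]
  nlinarith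

theorem q_norm (z : ℂ) (hz : 0 < z.re) (u : ℝ) (hu : 0 ≤ u) :
    ‖(1 - Complex.exp (-z * u)) / z‖ ≤ u := by
  have hz0 : z ≠ 0 := fun h => by simp [h] at hz
  have h : (1 - Complex.exp (-z * u)) / z = ∫ s in (0:ℝ)..u, Complex.exp (-z * s) := by
    rw [integral_exp_mul_complex (neg_ne_zero.2 hz0)]
    simp only [Complex.ofReal_zero, mul_zero, Complex.exp_zero]
    rw [div_neg, ← neg_div, neg_sub]
  rw [h]
  have := intervalIntegral.norm_integral_le_of_norm_le_const (a := 0) (b := u) (C := 1)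
    (f := fun s : ℝ => Complex.exp (-z * s)) (fun s hs => by
      rw [uIoc_of_le hu] at hs
      rw [Complex.norm_exp]
      apply Real.exp_le_one_iff.2
      simp
      exact mul_nonneg hz.le hs.1.le)
  simpa [abs_of_nonneg hu] using this

theorem G_props (Λ : Measure ℝ) [IsProbabilityMeasure Λ]
    (hs : Λ (Iic 0) = 0) (hi : Integrable (fun u : ℝ => u) Λ) (z : ℂ) (hz : 0 < z.re) :
    ‖∫ u, (1 - Complex.exp (-z * (u:ℝ))) / z ∂Λ‖ ≤ ∫ u, u ∂Λ ∧
    (∫ u, (1 - Complex.exp (-z * (u:ℝ))) / z ∂Λ).im * z.im ≤ 0 := by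
  have hpos : ∀ᵐ u ∂Λ, 0 < u := by
    rw [ae_iff]; simpa [Iic] using hs
  have iq : Integrable (fun u : ℝ => (1 - Complex.exp (-z * (u:ℝ))) / z) Λ := by
    refine hi.mono (by fun_prop) ?_
    filter_upwards [hpos] with u hu
    exact (q_norm z hz u hu.le).trans (le_abs_self _)
  constructor
  · apply norm_integral_le_of_norm_le hi
    filter_upwards [hpos] with u hu using q_norm z hz u hu.le
  · have : (∫ u, (1 - Complex.exp (-z * (u:ℝ))) / z ∂Λ).im = ∫ u, ((1 - Complex.exp (-z * (u:ℝ))) / z).im ∂Λ := by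
      exact (integral_im iq).symm
    rw [this, ← integral_mul_const]
    apply integral_nonpos_of_ae
    filter_upwards [hpos] with u hu using q_im z hz u hu.le

theorem mean_aux (ν : Measure ℝ) (hν0 : ν (Set.Iic 0) = 0)
    (hνint : ∫⁻ y in Set.Ioi (0 : ℝ), ENNReal.ofReal (min y (y ^ 2)) ∂ν ≠ ⊤)
    (η N : ℝ) (hη : 0 ≤ η) (hN : 0 < N) (Λ : Measure ℝ) [IsProbabilityMeasure Λ]
    (hs : Λ (Iic 0) = 0) (hT : tailNu ν η ≠ 0)
    (htail : ∀ y : ℝ, 0 ≤ y → (Λ (Set.Ici y)).toReal = tailNu ν (η + y / N) / tailNu ν η) :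
    Integrable (fun u : ℝ => u) Λ ∧
    ∫ y in Set.Ioi (0 : ℝ), tailNu ν (η + y) = tailNu ν η / N * ∫ u, u ∂Λ := by
  have hpos : ∀ᵐ u ∂Λ, 0 < u := by
    rw [ae_iff]; simpa [Iic] using hs
  have hfin : ν (Ici η) ≠ ⊤ := by
    intro h
    apply hT
    simp [tailNu, h]
  have hT0 : 0 < tailNu ν η := lt_of_le_of_ne ENNReal.toReal_nonneg (Ne.symm hT)
  have hfin' : ∀ y, 0 ≤ y → ν (Ici (η + y / N)) ≠ ⊤ := fun y hy =>
    ne_top_of_le_ne_top hfin (measure_mono (Ici_subset_Ici.2 (by have : 0 ≤ y / N := by positivity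
                                                                 linarith)))
  have hνpos : ∀ᵐ x ∂ν, 0 < x := by
    rw [ae_iff]; simpa [Iic] using hν0
  have hf1 : ∫⁻ x, ENNReal.ofReal (max 0 (x - η)) ∂ν ≠ ⊤ := by
    refine ne_top_of_le_ne_top (b := ν (Ici η) + ∫⁻ y in Set.Ioi (0 : ℝ), ENNReal.ofReal (min y (y ^ 2)) ∂ν)
      (ENNReal.add_ne_top.2 ⟨hfin, hνint⟩) ?_
    have e : ∫⁻ y in Set.Ioi (0 : ℝ), ENNReal.ofReal (min y (y ^ 2)) ∂ν = ∫⁻ y, ENNReal.ofReal (min y (y ^ 2)) ∂ν := by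
      rw [Measure.restrict_eq_self_of_ae_mem]
      exact hνpos
    rw [e, ← lintegral_indicator_one measurableSet_Ici, ← lintegral_add_left (by fun_prop (disch := exact measurableSet_Ici))]
    apply lintegral_mono_ae
    filter_upwards [hνpos] with x hx
    by_cases hxη : η ≤ x
    · rw [indicator_of_mem (show x ∈ Ici η from hxη), Pi.one_apply, ← ENNReal.ofReal_one,
        ← ENNReal.ofReal_add zero_le_one (le_min hx.le (sq_nonneg x))]
      apply ENNReal.ofReal_le_ofReal
      apply max_le
      · have : 0 ≤ min x (x ^ 2) := le_min hx.le (sq_nonneg x)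
        linarith
      · rcases le_total x 1 with h | h
        · have : 0 ≤ min x (x ^ 2) := le_min hx.le (sq_nonneg x)
          linarith
        · rw [min_eq_left (by nlinarith)]
          linarith
    · rw [max_eq_left (by linarith)]
      simp
  have hf2 : ∫⁻ x, ENNReal.ofReal (N * max 0 (x - η)) ∂ν ≠ ⊤ := by
    simp_rw [ENNReal.ofReal_mul hN.le]
    rw [lintegral_const_mul _ (by fun_prop)]
    exact ENNReal.mul_ne_top ENNReal.ofReal_ne_top hf1
  rw [lintegral_eq_lintegral_meas_le ν (Eventually.of_forall fun x => by positivity) (by fun_prop)] at hf2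
  have hset : ∀ y ∈ Ioi (0:ℝ), ν {a | y ≤ N * max 0 (a - η)} = ν (Ici (η + y / N)) := by
    intro y hy
    congr 1
    ext a
    simp only [mem_setOf_eq, mem_Ici]
    have hy' : 0 < y := hy
    constructor
    · intro h
      have h1 : 0 < max 0 (a - η) := by
        by_contra h'
        nlinarith
      have h2 : max 0 (a - η) = a - η := by
        rcases max_choice 0 (a - η) with h3 | h3
        · rw [h3] at h1; exact absurd h1 (lt_irrefl _)
        · exact h3
      rw [h2] at h
      have : y / N ≤ a - η := by rw [div_le_iff₀ hN]; linarith
      linarith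
    · intro h
      have : y / N ≤ max 0 (a - η) := (by linarith : y / N ≤ a - η).trans (le_max_right _ _)
      rw [div_le_iff₀ hN] at this
      linarith
  rw [setLIntegral_congr_fun measurableSet_Ioi hset] at hf2
  have hI : Integrable (fun u : ℝ => u) Λ := by
    refine ⟨by fun_prop, ?_⟩
    rw [hasFiniteIntegral_iff_ofReal (by filter_upwards [hpos] with u hu using hu.le)]
    rw [lintegral_eq_lintegral_meas_le Λ (by filter_upwards [hpos] with u hu using hu.le) (by fun_prop)]
    calc _ = ∫⁻ y in Ioi (0:ℝ), ENNReal.ofReal (1 / tailNu ν η) * ν (Ici (η + y / N)) := by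
          refine setLIntegral_congr_fun measurableSet_Ioi fun y hy => ?_
          have hy' : (0:ℝ) ≤ y := le_of_lt hy
          change Λ (Ici y) = _
          rw [← ENNReal.ofReal_toReal (measure_ne_top Λ (Ici y)), htail y hy',
            ← ENNReal.ofReal_toReal (hfin' y hy'), ← ENNReal.ofReal_mul (by positivity)]
          congr 1
          rw [tailNu, tailNu]; ring
      _ = ENNReal.ofReal (1 / tailNu ν η) * ∫⁻ y in Ioi (0:ℝ), ν (Ici (η + y / N)) := by
          rw [lintegral_const_mul' _ _ ENNReal.ofReal_ne_top]
      _ < ⊤ := ENNReal.mul_lt_top ENNReal.ofReal_lt_top hf2.lt_top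
  refine ⟨hI, ?_⟩
  rw [hI.integral_eq_integral_meas_le (by filter_upwards [hpos] with u hu using hu.le)]
  have e2 : ∀ y ∈ Ioi (0:ℝ), Λ.real {a | y ≤ a} = (fun s => tailNu ν (η + s) / tailNu ν η) (N⁻¹ * y) := by
    intro y hy
    change (Λ (Ici y)).toReal = _
    rw [htail y (le_of_lt hy)]
    simp only
    rw [inv_mul_eq_div]
  rw [setIntegral_congr_fun measurableSet_Ioi e2, integral_comp_mul_left_Ioi (fun s => tailNu ν (η + s) / tailNu ν η) 0 (inv_pos.2 hN)]
  rw [mul_zero, integral_div]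
  simp only [inv_inv, smul_eq_mul]
  field_simp

theorem core_D (c θ γ l : ℝ) (hc : 0 < c) (hθ0 : 0 ≤ θ) (hγ : 0 ≤ γ) (hl : 0 < l)
    (Λ : Measure ℝ) [IsProbabilityMeasure Λ]
    (hs : Λ (Iic 0) = 0) (hi : Integrable (fun u : ℝ => u) Λ)
    (hle : γ * (c + θ * ∫ u, u ∂Λ) ≤ 1) (z : ℂ) (hz : z.re = l) :
    ∃ A D : ℂ, ∫ t in Ioi (0:ℝ), Complex.exp (-z * t) * ((γ * piTail c θ Λ t : ℝ) : ℂ) = A / (1 + c * z)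
      ∧ D = 1 + c * z - A ∧ 1 + (c : ℂ) * z ≠ 0 ∧ ‖A‖ ≤ 1 ∧ 0 < D.re ∧ c * |z.im| ≤ ‖D‖ := by
  have hz0 : 0 < z.re := hz ▸ hl
  obtain ⟨h1, h2⟩ := piTail_laplace c θ hc Λ hs z hz0
  obtain ⟨g1, g2⟩ := G_props Λ hs hi z hz0
  set G := ∫ u, (1 - Complex.exp (-z * (u:ℝ))) / z ∂Λ with hG
  have hA : ‖(γ:ℂ) * (c + θ * G)‖ ≤ 1 := by
    refine le_trans ?_ hle
    rw [norm_mul, Complex.norm_real, Real.norm_of_nonneg hγ]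
    refine mul_le_mul_of_nonneg_left ?_ hγ
    refine (norm_add_le _ _).trans ?_
    rw [norm_mul, Complex.norm_real, Complex.norm_real, Real.norm_of_nonneg hc.le,
      Real.norm_of_nonneg hθ0]
    have := mul_le_mul_of_nonneg_left g1 hθ0
    linarith
  refine ⟨(γ:ℂ) * (c + θ * G), 1 + c * z - (γ:ℂ) * (c + θ * G), ?_, rfl, ?_, hA, ?_, ?_⟩
  · rw [mul_div_assoc, ← h2, ← integral_const_mul]
    congr 1; ext t; push_cast; ring
  · intro h
    have := congrArg Complex.re h
    simp at this
    nlinarith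
  · have := (Complex.re_le_norm ((γ:ℂ) * (c + θ * G))).trans hA
    rw [Complex.sub_re]
    have e : (1 + (c:ℂ) * z).re = 1 + c * z.re := by simp
    rw [e]
    nlinarith
  · have e : (1 + c * z - (γ:ℂ) * (c + θ * G)).im = c * z.im - γ * θ * G.im := by
      simp; ring
    have h3 := Complex.abs_im_le_norm (1 + c * z - (γ:ℂ) * (c + θ * G))
    refine le_trans ?_ h3
    rw [e]
    have h4 : c * z.im ^ 2 ≤ (c * z.im - γ * θ * G.im) * z.im := by
      nlinarith [mul_nonneg hγ hθ0]
    rcases eq_or_ne z.im 0 with h0 | h0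
    · rw [h0, abs_zero, mul_zero]; exact abs_nonneg _
    · have hp : 0 < |z.im| := abs_pos.2 h0
      refine le_of_mul_le_mul_right ?_ hp
      rw [← abs_mul, mul_assoc, ← sq, sq_abs]
      exact h4.trans (le_abs_self _)

theorem core (c θ γ N β : ℝ) (hc : 0 < c) (hθ0 : 0 ≤ θ) (hθ1 : θ < 1) (hγ : 0 ≤ γ)
    (hN : 0 < N) (hβ : 0 < β)
    (Λ : Measure ℝ) [IsProbabilityMeasure Λ]
    (hs : Λ (Iic 0) = 0) (hi : Integrable (fun u : ℝ => u) Λ)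
    (hle : γ * (c + θ * ∫ u, u ∂Λ) ≤ 1) (δ : ℝ) (hδ : 0 ≤ δ) (R : ℝ → ℝ)
    (hR : R = resolventSnd (fun t => γ * piTail c θ Λ t)) :
    ∫ t : ℝ, |Real.exp (-β * (t + δ)) * R (N * (t + δ)) - Real.exp (-β * t) * R (N * t)| ^ 2
      ≤ 10 * π ^ 2 * (1 / (2 * π * c)) ^ 2 * δ := by
  set F : ℝ → ℝ := fun t => γ * piTail c θ Λ t with hF
  set l := β / N with hl
  have hl0 : 0 < l := div_pos hβ hN
  have hNl : l * N = β := by rw [hl]; field_simp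
  -- bounds on the tail
  have hpt : ∀ t, 0 ≤ t → 0 ≤ piTail c θ Λ t ∧ piTail c θ Λ t ≤ 1 := by
    intro t ht
    rw [piTail_formula c θ hc Λ hs t ht]
    have e0 : ∀ u : ℝ, Real.exp (-(max t u - u) / c) ≤ 1 := by
      intro u
      apply Real.exp_le_one_iff.2
      apply div_nonpos_of_nonpos_of_nonneg _ hc.le
      linarith [le_max_right t u]
    have a0 : 0 ≤ ∫ u, Real.exp (-(max t u - u) / c) ∂Λ :=
      integral_nonneg fun u => (Real.exp_pos _).le
    have a1 : ∫ u, Real.exp (-(max t u - u) / c) ∂Λ ≤ 1 := by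
      have := norm_integral_le_of_norm_le_const (μ := Λ) (C := 1)
        (f := fun u : ℝ => Real.exp (-(max t u - u) / c))
        (Eventually.of_forall fun u => by
          rw [Real.norm_of_nonneg (Real.exp_pos _).le]; exact e0 u)
      simp only [probReal_univ, mul_one] at this
      exact (le_abs_self _).trans this
    have b0 := Real.exp_pos (-t / c)
    have b1 : Real.exp (-t / c) ≤ 1 := by
      apply Real.exp_le_one_iff.2
      apply div_nonpos_of_nonpos_of_nonneg _ hc.le
      linarith
    constructor
    · have := mul_nonneg hθ0 a0
      have := mul_nonneg (sub_nonneg.2 hθ1.le) b0.le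
      linarith
    · have := mul_le_mul_of_nonneg_left a1 hθ0
      have := mul_le_mul_of_nonneg_left b1 (sub_nonneg.2 hθ1.le)
      linarith
  have hF0 : ∀ t, 0 ≤ t → 0 ≤ F t := fun t ht => mul_nonneg hγ (hpt t ht).1
  have hFB : ∀ t, 0 ≤ t → F t ≤ γ := fun t ht => by
    have := mul_le_mul_of_nonneg_left (hpt t ht).2 hγ
    simpa [hF] using this
  have hlz : ((l : ℂ)).re = l := by simp
  have ecast : (fun t : ℝ => Complex.exp (-(l:ℂ) * t) * (F t : ℂ)) =
      fun t : ℝ => ((Real.exp (-l * t) * F t : ℝ) : ℂ) := by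
    ext t; push_cast; rfl
  have hint : IntegrableOn (fun t => Real.exp (-l * t) * F t) (Ioi 0) := by
    have h1 := ((piTail_laplace c θ hc Λ hs l (hlz ▸ hl0)).1).const_mul (γ:ℂ)
    have h2 : IntegrableOn (fun t : ℝ => ((Real.exp (-l * t) * F t : ℝ) : ℂ)) (Ioi 0) := by
      rw [← ecast]
      refine h1.congr (Eventually.of_forall fun t => ?_)
      simp only [hF]; push_cast; ring
    exact h2.re
  have hm : ∫ t in Ioi 0, Real.exp (-l * t) * F t < 1 := by
    obtain ⟨A, D, e1, e2, e3, -, e5, -⟩ := core_D c θ γ l hc hθ0 hγ hl0 Λ hs hi hle l hlz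
    change ∫ t in Ioi (0:ℝ), Complex.exp (-(l:ℂ) * t) * (F t : ℂ) = _ at e1
    rw [ecast, integral_complex_ofReal] at e1
    set m := ∫ t in Ioi 0, Real.exp (-l * t) * F t
    rw [eq_div_iff e3] at e1
    have e6 : D = (((1 - m) * (1 + c * l) : ℝ) : ℂ) := by
      rw [e2, ← e1]; push_cast; ring
    rw [e6, Complex.ofReal_re] at e5
    have := (pos_iff_pos_of_mul_pos e5).2 (show (0:ℝ) < 1 + c * l by positivity)
    linarith
  obtain ⟨r1, ⟨B', r2⟩, r3⟩ := resolvent_aux F hF0 γ hFB l hl0 hint hm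
  rw [← hR] at r1 r2 r3
  have hRneg : ∀ t, t < 0 → R t = 0 := by
    intro t ht
    rw [hR]; simp [resolventSnd, ht]
  have hresc : ∀ t : ℝ, Real.exp (-β * t) = Real.exp (-l * (N * t)) := by
    intro t; rw [← hNl]; congr 1; ring
  set f : ℝ → ℂ := fun t => ((Real.exp (-β * t) * R (N * t) : ℝ) : ℂ) with hf
  have hi1 : IntegrableOn (fun t : ℝ => Real.exp (-β * t) * R (N * t)) (Ioi 0) := by
    have := (integrableOn_Ioi_comp_mul_left_iff (fun s => Real.exp (-l * s) * R s) 0 hN).2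
      (by rw [mul_zero]; exact r1)
    refine this.congr (Eventually.of_forall fun t => ?_)
    simp only [hresc]
  have hfi1 : IntegrableOn f (Ioi 0) := hi1.ofReal
  have hfz : ∀ t, t < 0 → f t = 0 := by
    intro t ht
    simp [hf, hRneg (N * t) (mul_neg_of_pos_of_neg hN ht)]
  have hae : (Ioi (0:ℝ)).indicator f =ᵐ[volume] f := by
    filter_upwards [compl_mem_ae_iff.2 (measure_singleton (0:ℝ))] with t ht
    rcases lt_trichotomy t 0 with h | h | h
    · rw [hfz t h, indicator_of_notMem]; simp [h.le]
    · exact absurd h ht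
    · rw [indicator_of_mem]; exact h
  have hfi : Integrable f :=
    (integrable_indicator_iff measurableSet_Ioi).2 hfi1 |>.congr hae
  have hfb : ∀ t, ‖f t‖ ≤ B' := by
    have hB0 : 0 ≤ B' := (abs_nonneg _).trans (r2 0 le_rfl)
    intro t
    rcases lt_or_ge t 0 with h | h
    · rw [hfz t h]; simpa using hB0
    · simp only [hf, Complex.norm_real, hresc]
      exact r2 _ (mul_nonneg hN.le h)
  have hf2 : MemLp f 2 := by
    rw [memLp_two_iff_integrable_sq_norm hfi.aestronglyMeasurable]
    have := hfi.norm.bdd_mul hfi.norm.aestronglyMeasurable (c := B')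
      (Eventually.of_forall fun t => by simpa using hfb t)
    refine this.congr (Eventually.of_forall fun t => ?_)
    simp only [sq]
  have hb : ∀ w : ℝ, w ≠ 0 → ‖FourierTransform.fourier f w‖ ≤ (1 / (2 * π * c)) / |w| := by
    intro w hw
    set z : ℂ := ((l : ℝ) : ℂ) + ((2 * π * w / N : ℝ) : ℂ) * Complex.I with hz
    have hzre : z.re = l := by simp [hz]
    have hzim : z.im = 2 * π * w / N := by simp [hz]
    have e1 : FourierTransform.fourier f w =
        (N⁻¹ : ℝ) • ∫ s in Ioi (0:ℝ), Complex.exp (-z * s) * (R s : ℂ) := by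
      rw [Real.fourier_real_eq_integral_exp_smul]
      have h1 : ∫ v : ℝ, Complex.exp (↑(-2 * π * v * w) * Complex.I) • f v =
          ∫ v in Ioi (0:ℝ), Complex.exp (↑(-2 * π * v * w) * Complex.I) • f v := by
        rw [← integral_indicator measurableSet_Ioi]
        apply integral_congr_ae
        filter_upwards [hae] with t ht
        by_cases h : t ∈ Ioi (0:ℝ)
        · rw [indicator_of_mem h]
        · rw [indicator_of_notMem h] at ht ⊢
          rw [← ht, smul_zero]
      have h2 := integral_comp_mul_left_Ioi (fun s : ℝ => Complex.exp (-z * s) * (R s : ℂ)) 0 hN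
      rw [mul_zero] at h2
      rw [h1, ← h2]
      congr 1; ext v
      simp only [hf, smul_eq_mul]
      push_cast
      rw [← mul_assoc, ← Complex.exp_add]
      congr 2
      have hN' : (N:ℂ) ≠ 0 := by exact_mod_cast hN.ne'
      rw [hz, ← hNl]
      push_cast
      field_simp
      ring
    obtain ⟨A, D, d1, d2, d3, d4, d5, d6⟩ := core_D c θ γ l hc hθ0 hγ hl0 Λ hs hi hle z hzre
    have hD : D ≠ 0 := fun h => by simp [h] at d5
    have d1' : ∫ t in Ioi (0:ℝ), Complex.exp (-z * t) * (F t : ℂ) = A / (1 + c * z) := d1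
    have e2 : ∫ s in Ioi (0:ℝ), Complex.exp (-z * s) * (R s : ℂ) = A / D := by
      rw [r3 z hzre, d1', one_sub_div d3, ← d2, div_div_div_cancel_right₀ d3]
    rw [e1, e2, norm_smul, norm_div, Real.norm_of_nonneg (inv_pos.2 hN).le]
    rw [hzim] at d6
    have hw' : 0 < |w| := abs_pos.2 hw
    have e3 : |2 * π * w / N| = 2 * π * |w| / N := by
      rw [abs_div, abs_mul, abs_of_pos hN, abs_of_pos Real.two_pi_pos]
    rw [e3] at d6
    have hpos : 0 < c * (2 * π * |w| / N) := by positivity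
    calc N⁻¹ * (‖A‖ / ‖D‖) ≤ N⁻¹ * (1 / (c * (2 * π * |w| / N))) := by
          refine mul_le_mul_of_nonneg_left ?_ (inv_pos.2 hN).le
          exact div_le_div₀ zero_le_one d4 hpos d6
      _ = _ := by field_simp
  have := shift_bound_aux f hfi hf2 _ hb δ hδ
  refine le_trans (le_of_eq ?_) this
  congr 1; ext t
  simp only [hf]
  rw [← Complex.ofReal_sub, Complex.norm_real, Real.norm_eq_abs]

/-- Lemma 4.10: uniform `L²`-shift estimate for `e^{−βt} R_{Π_n}(nt)`. -/
theorem stmt14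
    (b c : ℝ) (hb : 0 ≤ b) (hc : 0 < c)
    (ν : Measure ℝ) (hν0 : ν (Set.Iic 0) = 0)
    (hνint : ∫⁻ y in Set.Ioi (0 : ℝ), ENNReal.ofReal (min y (y ^ 2)) ∂ν ≠ ⊤)
    (η θ : ℕ → ℝ) (hη : ∀ n : ℕ, 0 ≤ η n) (hθ : ∀ n : ℕ, 0 ≤ θ n ∧ θ n < 1)
    (hseq : (ν (Set.Ici (0 : ℝ)) ≠ ⊤ ∧ (∀ n : ℕ, 1 ≤ n → η n = 0) ∧
        (∀ n : ℕ, 1 ≤ n → θ n = c * tailNu ν 0 / (n : ℝ) ^ 2)) ∨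
      (ν (Set.Ici (0 : ℝ)) = ⊤ ∧
        Filter.Tendsto (fun n : ℕ => (n : ℝ) * θ n) Filter.atTop (nhds 0) ∧
        Filter.Tendsto (fun n : ℕ => (n : ℝ) ^ 2 * θ n) Filter.atTop Filter.atTop ∧
        (∀ n : ℕ, 1 ≤ n → tailNu ν (η n) = (n : ℝ) ^ 2 * θ n / c)))
    (Λ : ℕ → Measure ℝ)
    (hΛprob : ∀ n : ℕ, 1 ≤ n → IsProbabilityMeasure (Λ n))
    (hΛsupp : ∀ n : ℕ, 1 ≤ n → Λ n (Set.Iic 0) = 0)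
    (hΛtail : ∀ n : ℕ, 1 ≤ n → ∀ y : ℝ, 0 ≤ y →
      ((Λ n) (Set.Ici y)).toReal = tailNu ν (η n + y / (n : ℝ)) / tailNu ν (η n))
    :
    ∃ β₀ : ℝ, 0 ≤ β₀ ∧ ∀ β : ℝ, β₀ ≤ β → ∃ C : ℝ, 0 < C ∧ ∃ n₀ : ℕ, 1 ≤ n₀ ∧
      ∀ δ : ℝ, 0 ≤ δ → ∀ n : ℕ, n₀ ≤ n →
        (∫ t : ℝ,
          |Real.exp (-β * (t + δ)) * RPi b c ν η θ Λ n ((n : ℝ) * (t + δ)) -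
            Real.exp (-β * t) * RPi b c ν η θ Λ n ((n : ℝ) * t)| ^ 2) ≤ C * δ := by
  refine ⟨1, zero_le_one, fun β hβ => ⟨10 * π ^ 2 * (1 / (2 * π * c)) ^ 2, by positivity, 1, le_rfl,
    fun δ hδ n hn => ?_⟩⟩
  have := hΛprob n hn
  have hs := hΛsupp n hn
  have hN : (0:ℝ) < n := by exact_mod_cast hn
  have hone : Λ n (Ici 0) = 1 := by
    refine (prob_compl_eq_zero_iff measurableSet_Ici).1 (measure_mono_null ?_ hs)
    intro x hx
    simp at hx ⊢
    exact hx.le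
  have hT : tailNu ν (η n) ≠ 0 := by
    intro h
    have := hΛtail n hn 0 le_rfl
    rw [h, hone] at this
    simp at this
  have hTval : tailNu ν (η n) = (n : ℝ) ^ 2 * θ n / c := by
    rcases hseq with ⟨-, h1, h2⟩ | ⟨-, -, -, h⟩
    · rw [h1 n hn, h2 n hn]; field_simp
    · exact h n hn
  obtain ⟨hi, hI⟩ := mean_aux ν hν0 hνint (η n) n (hη n) hN (Λ n) hs hT (hΛtail n hn)
  have hI0 : 0 ≤ ∫ y in Set.Ioi (0 : ℝ), tailNu ν (η n + y) :=
    integral_nonneg fun y => ENNReal.toReal_nonneg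
  have hγ : 0 ≤ gam b c ν η n := mul_nonneg (by positivity) (le_max_left _ _)
  have hle : gam b c ν η n * (c + θ n * ∫ u, u ∂(Λ n)) ≤ 1 := by
    have hM : θ n * ∫ u, u ∂(Λ n) = c * ((1 / n) * ∫ y in Set.Ioi (0 : ℝ), tailNu ν (η n + y)) := by
      rw [hI, hTval]; field_simp
    rw [hM, gam]
    set J := (1 / (n:ℝ)) * ∫ y in Set.Ioi (0 : ℝ), tailNu ν (η n + y) with hJ
    have hJ0 : 0 ≤ J := by positivity
    have e : 1 / c * max 0 (1 - b / n - J) * (c + c * J) = max 0 (1 - b / n - J) * (1 + J) := by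
      field_simp
    rw [e]
    have hbn : 0 ≤ b / n := by positivity
    rcases max_cases 0 (1 - b / n - J) with ⟨h, _⟩ | ⟨h, _⟩
    · rw [h]; simp
    · rw [h]; nlinarith [mul_nonneg hbn hJ0]
  exact core c (θ n) (gam b c ν η n) n β hc (hθ n).1 (hθ n).2 hγ hN (by linarith) (Λ n) hs hi hle δ hδ
    (RPi b c ν η θ Λ n) rfl
end

section
/- For each p ≥ 2 there exists a constant C > 0, independent of n and t, such that for all n ≥ 1 and t ≥ 0: n²·θ_n·∫₀^∞ (t ∧ (y/n))^p Λ_n(dy) ≤ C·(1+t)^{p−1}, and n²·θ_n·∫₀^∞ (t ∧ (y/n))^p·(∫_{[0,y]} e_c(y−u) Λ_n(du)) dy ≤ C·(θ_n/n^{p−2} + (1+t)^{p−1}). -/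
open MeasureTheory Real Set Filter Topology

theorem aux_layer (μ : Measure ℝ) (t k p : ℝ) (ht : 0 ≤ t) (hk : 0 < k) (hp : 0 < p) :
    ∫⁻ y in Set.Ioi (0 : ℝ), ENNReal.ofReal (min t (y / k) ^ p) ∂μ
      = ∫⁻ s in Set.Ioi (0 : ℝ), (if s ^ (p⁻¹) ≤ t then μ (Set.Ici (k * s ^ (p⁻¹))) else 0) := by
  rw [lintegral_eq_lintegral_meas_le]
  · apply setLIntegral_congr_fun measurableSet_Ioi
    intro s hs
    have hs : 0 < s := hs
    have hsp : 0 < s ^ (p⁻¹) := Real.rpow_pos_of_pos hs _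
    have key : ∀ y : ℝ, 0 < y → (s ≤ min t (y / k) ^ p ↔ (s ^ (p⁻¹) ≤ t ∧ k * s ^ (p⁻¹) ≤ y)) := by
      intro y hy
      have h0 : 0 ≤ min t (y / k) := le_min ht (by positivity)
      rw [← Real.rpow_inv_le_iff_of_pos hs.le h0 hp, le_min_iff, le_div_iff₀ hk, mul_comm k]
    have hm : MeasurableSet {a : ℝ | s ≤ min t (a / k) ^ p} := by
      apply measurableSet_le measurable_const
      fun_prop
    simp only []
    rw [Measure.restrict_apply hm]
    split_ifs with h
    · congr 1
      ext y
      simp only [mem_inter_iff, mem_ofPred_eq, mem_Ioi, mem_Ici]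
      constructor
      · rintro ⟨h1, h2⟩
        exact ((key y h2).1 h1).2
      · intro h1
        have hy : 0 < y := lt_of_lt_of_le (by positivity) h1
        exact ⟨(key y hy).2 ⟨h, h1⟩, hy⟩
    · convert measure_empty (μ := μ)
      ext y
      simp only [mem_inter_iff, mem_ofPred_eq, mem_Ioi, mem_empty_iff_false, iff_false]
      rintro ⟨h1, h2⟩
      exact h ((key y h2).1 h1).1
  · filter_upwards [ae_restrict_mem measurableSet_Ioi] with y hy
    have hy : 0 < y := hy
    have h0 : 0 ≤ min t (y / k) := le_min ht (by positivity)
    exact Real.rpow_nonneg h0 _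
  · fun_prop

theorem aux_dom (μ₁ μ₂ : Measure ℝ) (t k p : ℝ) (ht : 0 ≤ t) (hk : 0 < k) (hp : 0 < p)
    (h : ∀ s : ℝ, 0 < s → μ₁ (Set.Ici (k * s)) ≤ μ₂ (Set.Ici s)) :
    ∫⁻ y in Set.Ioi (0 : ℝ), ENNReal.ofReal (min t (y / k) ^ p) ∂μ₁
      ≤ ∫⁻ y in Set.Ioi (0 : ℝ), ENNReal.ofReal (min t y ^ p) ∂μ₂ := by
  have h2 := aux_layer μ₂ t 1 p ht one_pos hp
  simp only [div_one, one_mul] at h2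
  rw [aux_layer μ₁ t k p ht hk hp, h2]
  apply setLIntegral_mono' measurableSet_Ioi
  intro s hs
  split_ifs
  · exact h _ (Real.rpow_pos_of_pos hs _)
  · exact le_rfl

theorem aux_pt (t y p : ℝ) (ht : 0 ≤ t) (hy : 0 < y) (hp : 2 ≤ p) :
    min t y ^ p ≤ min y (y ^ 2) * (1 + t) ^ (p - 1) := by
  have h1t : 1 ≤ (1 + t) ^ (p - 1) := Real.one_le_rpow (by linarith) (by linarith)
  have hm : 0 ≤ min t y := le_min ht hy.le
  rcases le_total y 1 with h | h
  · have : min y (y ^ 2) = y ^ 2 := min_eq_right (by nlinarith)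
    rw [this]
    calc min t y ^ p ≤ y ^ p := Real.rpow_le_rpow hm (min_le_right _ _) (by linarith)
      _ ≤ y ^ (2 : ℝ) := Real.rpow_le_rpow_of_exponent_ge hy h hp
      _ = y ^ 2 * 1 := by simp
      _ ≤ _ := by gcongr
  · have : min y (y ^ 2) = y := min_eq_left (by nlinarith)
    rw [this]
    have e : min t y ^ p = min t y * min t y ^ (p - 1) := by
      rw [← Real.rpow_one_add' hm (by linarith)]; congr 1; ring
    rw [e]
    have : min t y ≤ 1 + t := (min_le_left _ _).trans (by linarith)
    exact mul_le_mul (min_le_right _ _) (Real.rpow_le_rpow hm this (by linarith))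
      (Real.rpow_nonneg hm _) hy.le

theorem aux_nu (ν : Measure ℝ) (t p : ℝ) (ht : 0 ≤ t) (hp : 2 ≤ p) :
    ∫⁻ y in Set.Ioi (0 : ℝ), ENNReal.ofReal (min t y ^ p) ∂ν
      ≤ (∫⁻ y in Set.Ioi (0 : ℝ), ENNReal.ofReal (min y (y ^ 2)) ∂ν)
        * ENNReal.ofReal ((1 + t) ^ (p - 1)) := by
  rw [← lintegral_mul_const _ (by fun_prop)]
  apply setLIntegral_mono' measurableSet_Ioi
  intro y hy
  have hy : 0 < y := hy
  rw [← ENNReal.ofReal_mul (by positivity)]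
  exact ENNReal.ofReal_le_ofReal (aux_pt t y p ht hy hp)

theorem aux_split (t u v k p : ℝ) (ht : 0 ≤ t) (hu : 0 ≤ u) (hv : 0 ≤ v) (hk : 0 < k) (hp : 2 ≤ p) :
    min t ((u + v) / k) ^ p ≤ 2 ^ p * (min t (u / k) ^ p + v ^ p * (k ^ p)⁻¹) := by
  have ha : 0 ≤ u / k := by positivity
  have hb : 0 ≤ v / k := by positivity
  have e : v ^ p * (k ^ p)⁻¹ = (v / k) ^ p := by rw [Real.div_rpow hv hk.le]; rfl
  rw [e, add_div]
  generalize u / k = a at *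
  generalize v / k = b at *
  have h0 : 0 ≤ min t (a + b) := le_min ht (by linarith)
  have hma : 0 ≤ min t a := le_min ht ha
  have hpa : 0 ≤ min t a ^ p := Real.rpow_nonneg hma _
  have hpb : 0 ≤ b ^ p := Real.rpow_nonneg hb _
  rcases le_total (min t a) b with h | h
  · calc min t (a + b) ^ p ≤ (2 * b) ^ p := by
          apply Real.rpow_le_rpow h0 _ (by linarith)
          rcases min_le_iff.1 h with h | h
          · exact (min_le_left _ _).trans (by linarith)
          · exact (min_le_right _ _).trans (by linarith)
      _ = 2 ^ p * b ^ p := Real.mul_rpow (by norm_num) hb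
      _ ≤ _ := by gcongr; linarith
  · calc min t (a + b) ^ p ≤ (2 * min t a) ^ p := by
          apply Real.rpow_le_rpow h0 _ (by linarith)
          have := le_min_iff.1 h
          rcases le_total t a with h' | h'
          · rw [min_eq_left h']; exact (min_le_left _ _).trans (by linarith)
          · rw [min_eq_right h']; exact (min_le_right _ _).trans (by linarith)
      _ = 2 ^ p * min t a ^ p := Real.mul_rpow (by norm_num) hma
      _ ≤ _ := by gcongr; linarith

theorem expDens_nonneg' (c v : ℝ) (hc : 0 < c) : 0 ≤ expDens c v := by
  unfold expDens; positivity

theorem measurable_expDens' (c : ℝ) : Measurable (expDens c) := by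
  unfold expDens; fun_prop

theorem aux_A (c p : ℝ) (hc : 0 < c) (hp : 0 ≤ p) :
    ∫⁻ v in Set.Ici (0 : ℝ), ENNReal.ofReal (expDens c v) * ENNReal.ofReal (v ^ p) ≠ ⊤ := by
  have h := integrableOn_rpow_mul_exp_neg_mul_rpow (s := p) (p := 1) (b := 1 / c)
    (by linarith) one_pos (by positivity)
  have h2 := (h.const_mul (1 / c)).lintegral_lt_top
  rw [← restrict_Ioi_eq_restrict_Ici]
  refine ne_of_lt (lt_of_le_of_lt (le_of_eq ?_) h2)
  apply setLIntegral_congr_fun measurableSet_Ioi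
  intro v hv
  simp only []
  rw [← ENNReal.ofReal_mul (expDens_nonneg' c v hc)]
  congr 1
  unfold expDens
  rw [Real.rpow_one]
  have : -v / c = -(1 / c) * v := by ring
  rw [this]; ring

theorem aux_conv (μ : Measure ℝ) [SFinite μ] (hμ : μ (Set.Iic 0) = 0) (c t k p : ℝ) (hc : 0 < c) (ht : 0 ≤ t)
    (hk : 0 < k) (hp : 2 ≤ p) :
    ENNReal.ofReal (∫ y in Set.Ioi (0 : ℝ),
            min t (y / k) ^ p * ∫ u in Set.Icc (0 : ℝ) y, expDens c (y - u) ∂μ)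
      ≤ ENNReal.ofReal (2 ^ p) *
        ((∫⁻ v in Set.Ici (0 : ℝ), ENNReal.ofReal (expDens c v) * ENNReal.ofReal (v ^ (0 : ℝ))) *
          (∫⁻ y in Set.Ioi (0 : ℝ), ENNReal.ofReal (min t (y / k) ^ p) ∂μ)
        + (∫⁻ v in Set.Ici (0 : ℝ), ENNReal.ofReal (expDens c v) * ENNReal.ofReal (v ^ p)) *
          ENNReal.ofReal ((k ^ p)⁻¹) * μ Set.univ) := by
  have hme := measurable_expDens' c
  set K : ℝ → ℝ → ENNReal := fun u v => (Set.Ici (0 : ℝ)).indicator (fun v =>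
    ENNReal.ofReal (expDens c v) * ENNReal.ofReal (v ^ (0 : ℝ)) * ENNReal.ofReal (min t (u / k) ^ p) +
    ENNReal.ofReal (expDens c v) * ENNReal.ofReal (v ^ p) * ENNReal.ofReal ((k ^ p)⁻¹)) v with hK
  have hKm : Measurable (Function.uncurry K) := by
    have : Function.uncurry K = (Prod.snd ⁻¹' (Set.Ici (0 : ℝ))).indicator (fun q : ℝ × ℝ =>
       ENNReal.ofReal (expDens c q.2) * ENNReal.ofReal (q.2 ^ (0 : ℝ)) * ENNReal.ofReal (min t (q.1 / k) ^ p) +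
       ENNReal.ofReal (expDens c q.2) * ENNReal.ofReal (q.2 ^ p) * ENNReal.ofReal ((k ^ p)⁻¹)) := by
      ext q; rfl
    rw [this]
    apply Measurable.indicator
    · fun_prop
    · exact measurable_snd measurableSet_Ici
  have hres : μ.restrict (Set.Ioi 0) = μ := by
    apply Measure.restrict_eq_self_of_ae_mem
    rw [ae_iff]
    convert hμ using 2
    ext y; simp
  calc ENNReal.ofReal (∫ y in Set.Ioi (0 : ℝ),
            min t (y / k) ^ p * ∫ u in Set.Icc (0 : ℝ) y, expDens c (y - u) ∂μ)
      ≤ ∫⁻ y in Set.Ioi (0 : ℝ),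
            ‖min t (y / k) ^ p * ∫ u in Set.Icc (0 : ℝ) y, expDens c (y - u) ∂μ‖ₑ := by
        refine (ENNReal.ofReal_le_ofReal (le_abs_self _)).trans ?_
        rw [← Real.enorm_eq_ofReal_abs]
        exact enorm_integral_le_lintegral_enorm _
    _ ≤ ∫⁻ y in Set.Ioi (0 : ℝ), ENNReal.ofReal (2 ^ p) * ∫⁻ u in Set.Ioi (0 : ℝ), K u (y - u) ∂μ := by
        apply setLIntegral_mono' measurableSet_Ioi
        intro y hy
        have hy : 0 < y := hy
        have h0 : 0 ≤ min t (y / k) := le_min ht (by positivity)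
        have h0p := Real.rpow_nonneg h0 p
        rw [enorm_mul, Real.enorm_eq_ofReal h0p]
        calc ENNReal.ofReal (min t (y / k) ^ p) * ‖∫ u in Set.Icc (0 : ℝ) y, expDens c (y - u) ∂μ‖ₑ
          _ ≤ ENNReal.ofReal (min t (y / k) ^ p) * ∫⁻ u in Set.Icc (0 : ℝ) y, ‖expDens c (y - u)‖ₑ ∂μ := by
            gcongr
            exact enorm_integral_le_lintegral_enorm _
          _ = ∫⁻ u in Set.Icc (0 : ℝ) y, ENNReal.ofReal (min t (y / k) ^ p) * ‖expDens c (y - u)‖ₑ ∂μ := by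
            rw [lintegral_const_mul]
            fun_prop
          _ ≤ ∫⁻ u in Set.Icc (0 : ℝ) y, ENNReal.ofReal (2 ^ p) * K u (y - u) ∂μ := by
            apply setLIntegral_mono' measurableSet_Icc
            rintro u ⟨hu0, huy⟩
            have hv : 0 ≤ y - u := by linarith
            have hee := expDens_nonneg' c (y - u) hc
            have hmu : 0 ≤ min t (u / k) := le_min ht (by positivity)
            have hmup := Real.rpow_nonneg hmu p
            have hvp := Real.rpow_nonneg hv p
            rw [hK]
            simp only []
            rw [Set.indicator_of_mem (Set.mem_Ici.2 hv), Real.enorm_eq_ofReal hee, Real.rpow_zero,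
              ← ENNReal.ofReal_mul h0p, ← ENNReal.ofReal_mul hee, ← ENNReal.ofReal_mul hee,
              ← ENNReal.ofReal_mul (by positivity), ← ENNReal.ofReal_mul (by positivity),
              ← ENNReal.ofReal_add (by positivity) (by positivity), ← ENNReal.ofReal_mul (by positivity)]
            apply ENNReal.ofReal_le_ofReal
            have := aux_split t u (y - u) k p ht hu0 hv hk hp
            rw [add_sub_cancel] at this
            calc _ ≤ _ := mul_le_mul_of_nonneg_right this hee
              _ = _ := by ring
          _ ≤ ∫⁻ u, ENNReal.ofReal (2 ^ p) * K u (y - u) ∂μ := setLIntegral_le_lintegral _ _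
          _ = ENNReal.ofReal (2 ^ p) * ∫⁻ u in Set.Ioi (0 : ℝ), K u (y - u) ∂μ := by
            rw [hres, lintegral_const_mul]
            exact hKm.comp (measurable_id.prodMk (measurable_const.sub measurable_id))
    _ ≤ ∫⁻ y, ENNReal.ofReal (2 ^ p) * ∫⁻ u in Set.Ioi (0 : ℝ), K u (y - u) ∂μ :=
        setLIntegral_le_lintegral _ _
    _ = ENNReal.ofReal (2 ^ p) * ∫⁻ y, ∫⁻ u in Set.Ioi (0 : ℝ), K u (y - u) ∂μ := by
        rw [lintegral_const_mul' _ _ ENNReal.ofReal_ne_top]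
    _ = ENNReal.ofReal (2 ^ p) * ∫⁻ u in Set.Ioi (0 : ℝ), (∫⁻ y, K u (y - u)) ∂μ := by
        rw [lintegral_lintegral_swap]
        exact (hKm.comp (measurable_snd.prodMk (measurable_fst.sub measurable_snd))).aemeasurable
    _ = ENNReal.ofReal (2 ^ p) * ∫⁻ u in Set.Ioi (0 : ℝ), (∫⁻ v, K u v) ∂μ := by
        congr 1
        apply lintegral_congr
        intro u
        exact lintegral_sub_right_eq_self (fun v => K u v) u
    _ = _ := by
        congr 1
        have hin : ∀ u, ∫⁻ v, K u v =
          (∫⁻ v in Set.Ici (0 : ℝ), ENNReal.ofReal (expDens c v) * ENNReal.ofReal (v ^ (0 : ℝ))) *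
            ENNReal.ofReal (min t (u / k) ^ p) +
          (∫⁻ v in Set.Ici (0 : ℝ), ENNReal.ofReal (expDens c v) * ENNReal.ofReal (v ^ p)) *
          ENNReal.ofReal ((k ^ p)⁻¹) := by
          intro u
          rw [hK]
          simp only []
          rw [lintegral_indicator measurableSet_Ici, lintegral_add_left (by fun_prop),
            lintegral_mul_const _ (by fun_prop), lintegral_mul_const _ (by fun_prop)]
        simp_rw [hin]
        rw [lintegral_add_right _ (by fun_prop), lintegral_const_mul _ (by fun_prop),
          lintegral_const, hres]

/-- Proposition 4.12: moment bounds for the measures `Λ_n` and `e_c * Λ_n`. -/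
theorem stmt15
    (b c : ℝ) (hb : 0 ≤ b) (hc : 0 < c)
    (ν : Measure ℝ) (hν0 : ν (Set.Iic 0) = 0)
    (hνint : ∫⁻ y in Set.Ioi (0 : ℝ), ENNReal.ofReal (min y (y ^ 2)) ∂ν ≠ ⊤)
    (η θ : ℕ → ℝ) (hη : ∀ n : ℕ, 0 ≤ η n) (hθ : ∀ n : ℕ, 0 ≤ θ n ∧ θ n < 1)
    (hseq : (ν (Set.Ici (0 : ℝ)) ≠ ⊤ ∧ (∀ n : ℕ, 1 ≤ n → η n = 0) ∧
        (∀ n : ℕ, 1 ≤ n → θ n = c * tailNu ν 0 / (n : ℝ) ^ 2)) ∨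
      (ν (Set.Ici (0 : ℝ)) = ⊤ ∧
        Filter.Tendsto (fun n : ℕ => (n : ℝ) * θ n) Filter.atTop (nhds 0) ∧
        Filter.Tendsto (fun n : ℕ => (n : ℝ) ^ 2 * θ n) Filter.atTop Filter.atTop ∧
        (∀ n : ℕ, 1 ≤ n → tailNu ν (η n) = (n : ℝ) ^ 2 * θ n / c)))
    (Λ : ℕ → Measure ℝ)
    (hΛprob : ∀ n : ℕ, 1 ≤ n → IsProbabilityMeasure (Λ n))
    (hΛsupp : ∀ n : ℕ, 1 ≤ n → Λ n (Set.Iic 0) = 0)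
    (hΛtail : ∀ n : ℕ, 1 ≤ n → ∀ y : ℝ, 0 ≤ y →
      ((Λ n) (Set.Ici y)).toReal = tailNu ν (η n + y / (n : ℝ)) / tailNu ν (η n))
    :
    ∀ p : ℝ, 2 ≤ p → ∃ C : ℝ, 0 < C ∧ ∀ n : ℕ, 1 ≤ n → ∀ t : ℝ, 0 ≤ t →
      ((n : ℝ) ^ 2 * θ n * (∫ y in Set.Ioi (0 : ℝ), min t (y / (n : ℝ)) ^ p ∂(Λ n))
          ≤ C * (1 + t) ^ (p - 1)) ∧
      ((n : ℝ) ^ 2 * θ n *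
          (∫ y in Set.Ioi (0 : ℝ),
            min t (y / (n : ℝ)) ^ p * ∫ u in Set.Icc (0 : ℝ) y, expDens c (y - u) ∂(Λ n))
          ≤ C * (θ n / (n : ℝ) ^ (p - 2) + (1 + t) ^ (p - 1))) := by
  intro p hp
  have hA := aux_A c p hc (by linarith)
  have hB := aux_A c 0 hc le_rfl
  set A' := ∫⁻ v in Set.Ici (0 : ℝ), ENNReal.ofReal (expDens c v) * ENNReal.ofReal (v ^ p) with hA'
  set B' := ∫⁻ v in Set.Ici (0 : ℝ), ENNReal.ofReal (expDens c v) * ENNReal.ofReal (v ^ (0 : ℝ)) with hB'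
  set M' := ∫⁻ y in Set.Ioi (0 : ℝ), ENNReal.ofReal (min y (y ^ 2)) ∂ν with hM'
  obtain ⟨A, hA0, hAe⟩ : ∃ A : ℝ, 0 ≤ A ∧ A' = ENNReal.ofReal A :=
    ⟨A'.toReal, ENNReal.toReal_nonneg, (ENNReal.ofReal_toReal hA).symm⟩
  obtain ⟨B, hB0, hBe⟩ : ∃ A : ℝ, 0 ≤ A ∧ B' = ENNReal.ofReal A :=
    ⟨B'.toReal, ENNReal.toReal_nonneg, (ENNReal.ofReal_toReal hB).symm⟩
  obtain ⟨M, hM0, hMe⟩ : ∃ A : ℝ, 0 ≤ A ∧ M' = ENNReal.ofReal A :=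
    ⟨M'.toReal, ENNReal.toReal_nonneg, (ENNReal.ofReal_toReal hνint).symm⟩
  have h2p : (0 : ℝ) < 2 ^ p := by positivity
  refine ⟨2 ^ p * (B * (c * M)) + 2 ^ p * A + c * M + 1, by positivity, ?_⟩
  intro n hn t ht
  have hn0 : (0 : ℝ) < n := by exact_mod_cast hn
  have := hΛprob n hn
  have hT1 : (0 : ℝ) ≤ (1 + t) ^ (p - 1) := Real.rpow_nonneg (by linarith) _
  have hθn := (hθ n).1
  have huniv : Λ n (Set.Ici 0) = 1 := by
    rw [← prob_compl_eq_zero_iff measurableSet_Ici]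
    exact measure_mono_null (fun y hy => by simp at hy ⊢; exact hy.le) (hΛsupp n hn)
  have hne : tailNu ν (η n) ≠ 0 := by
    intro h
    have := hΛtail n hn 0 le_rfl
    rw [huniv, h] at this
    simp at this
  have hNe : (n : ℝ) ^ 2 * θ n = c * tailNu ν (η n) := by
    rcases hseq with ⟨-, h1, h2⟩ | ⟨-, -, -, h⟩
    · rw [h1 n hn, h2 n hn]; field_simp
    · rw [h n hn]; field_simp
  set N := (n : ℝ) ^ 2 * θ n with hN
  have hN0 : 0 ≤ N := by positivity
  have hdom := aux_dom (ENNReal.ofReal N • Λ n) (ENNReal.ofReal c • ν) t n p ht hn0 (by linarith) (by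
    intro s hs
    simp only [Measure.smul_apply, smul_eq_mul]
    rw [← ENNReal.ofReal_toReal (measure_ne_top (Λ n) (Set.Ici (n * s))),
      hΛtail n hn _ (by positivity), ← ENNReal.ofReal_mul hN0, hNe,
      mul_div_cancel_left₀ s hn0.ne',
      show c * tailNu ν (η n) * (tailNu ν (η n + s) / tailNu ν (η n)) = c * tailNu ν (η n + s) by
        field_simp, ENNReal.ofReal_mul hc.le]
    gcongr
    refine ENNReal.ofReal_toReal_le.trans (measure_mono ?_)
    apply Set.Ici_subset_Ici.2
    have := hη n
    linarith)
  simp only [Measure.restrict_smul, lintegral_smul_measure, smul_eq_mul] at hdom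
  set L := ∫⁻ y in Set.Ioi (0 : ℝ), ENNReal.ofReal (min t (y / n) ^ p) ∂(Λ n) with hL
  have hNL : ENNReal.ofReal N * L ≤ ENNReal.ofReal (c * M * (1 + t) ^ (p - 1)) := by
    refine hdom.trans ?_
    rw [mul_assoc, ENNReal.ofReal_mul hc.le, ENNReal.ofReal_mul hM0, ← hMe]
    gcongr
    exact aux_nu ν t p ht hp
  have hX : 0 ≤ 2 ^ p * (B * (c * M)) + 2 ^ p * A := by positivity
  constructor
  · have h1 : N * (∫ y in Set.Ioi (0 : ℝ), min t (y / (n : ℝ)) ^ p ∂(Λ n))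
        ≤ c * M * (1 + t) ^ (p - 1) := by
      rw [← ENNReal.ofReal_le_ofReal_iff (by positivity), ENNReal.ofReal_mul hN0]
      refine le_trans ?_ hNL
      gcongr
      refine (ENNReal.ofReal_le_ofReal (le_abs_self _)).trans ?_
      rw [← Real.enorm_eq_ofReal_abs]
      refine (enorm_integral_le_lintegral_enorm _).trans ?_
      apply setLIntegral_mono' measurableSet_Ioi
      intro y hy
      have hy : 0 < y := hy
      have h0 : 0 ≤ min t (y / n) := le_min ht (by positivity)
      rw [Real.enorm_eq_ofReal (Real.rpow_nonneg h0 p)]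
    refine h1.trans ?_
    gcongr
    linarith
  · have hr : 0 ≤ θ n / (n : ℝ) ^ (p - 2) := by positivity
    have hr2 : N * ((n : ℝ) ^ p)⁻¹ = θ n / (n : ℝ) ^ (p - 2) := by
      rw [Real.rpow_sub hn0, hN]
      have : (n : ℝ) ^ (2 : ℝ) = (n : ℝ) ^ 2 := by simp
      rw [this]
      have : (n : ℝ) ^ p ≠ 0 := by positivity
      field_simp
    have h2 : N * (∫ y in Set.Ioi (0 : ℝ),
            min t (y / (n : ℝ)) ^ p * ∫ u in Set.Icc (0 : ℝ) y, expDens c (y - u) ∂(Λ n))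
        ≤ 2 ^ p * (B * (c * M * (1 + t) ^ (p - 1)) + A * (N * ((n : ℝ) ^ p)⁻¹)) := by
      rw [← ENNReal.ofReal_le_ofReal_iff (by positivity), ENNReal.ofReal_mul hN0]
      have h3 := aux_conv (Λ n) (hΛsupp n hn) c t n p hc ht hn0 hp
      rw [← hA', ← hB', ← hL, measure_univ, mul_one, hAe, hBe] at h3
      calc _ ≤ _ := mul_le_mul_right h3 (ENNReal.ofReal N)
        _ = ENNReal.ofReal (2 ^ p) * (ENNReal.ofReal B * (ENNReal.ofReal N * L) +
            ENNReal.ofReal A * (ENNReal.ofReal N * ENNReal.ofReal (((n : ℝ) ^ p)⁻¹))) := by ring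
        _ ≤ ENNReal.ofReal (2 ^ p) * (ENNReal.ofReal B * ENNReal.ofReal (c * M * (1 + t) ^ (p - 1)) +
            ENNReal.ofReal A * (ENNReal.ofReal N * ENNReal.ofReal (((n : ℝ) ^ p)⁻¹))) := by gcongr
        _ = _ := by
          rw [← ENNReal.ofReal_mul hN0, ← ENNReal.ofReal_mul hA0, ← ENNReal.ofReal_mul hB0,
            ← ENNReal.ofReal_add (by positivity) (by positivity), ← ENNReal.ofReal_mul h2p.le]
    rw [hr2] at h2
    refine h2.trans ?_
    generalize θ n / (n : ℝ) ^ (p - 2) = r at *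
    generalize (1 + t) ^ (p - 1) = T at *
    generalize (2 : ℝ) ^ p = P at *
    have e1 : 0 ≤ (P * (B * (c * M)) + c * M + 1) * r := by positivity
    have e2 : 0 ≤ (P * A + c * M + 1) * T := by positivity
    nlinarith
end

section
/- There exists a constant C > 0 such that for every locally bounded measurable function f : [0,∞) → ℝ and every t ≥ 0: 0 ≤ ((𝓡∘f) * W′)(t) ≤ C·exp(‖f‖_{L^∞([0,t])}·t)·(1+t)²·∫₀^t |f(s)|² ds, where ((𝓡∘f) * W′)(t) = ∫₀^t (𝓡∘f)(s)·W′(t−s) ds. -/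
open MeasureTheory Real Set Filter Topology

/-- The nonlinear operator `𝓡`. -/
noncomputable def Rop (c : ℝ) (ν : Measure ℝ) (f : ℝ → ℝ) (t : ℝ) : ℝ :=
  c * f t ^ 2 + ∫ y in Set.Ioi (0 : ℝ),
    (Real.exp (-(∫ r in (max (t - y) 0)..t, f r)) - 1 + ∫ r in (max (t - y) 0)..t, f r) ∂ν


lemma lap_top (m : Measure ℝ) (hm : m (Set.Iio 0) = 0)
    (h : ∀ l : ℝ, 0 < l → ∫⁻ x, ENNReal.ofReal (Real.exp (-l * x)) ∂m = ENNReal.ofReal (1 / l))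
    (l : ℝ) (hl : l ≤ 0) : ∫⁻ x, ENNReal.ofReal (Real.exp (-l * x)) ∂m = ⊤ := by
  refine ENNReal.eq_top_of_forall_nnreal_le ?_
  intro r
  have hr : (0 : ℝ) < 1 / ((r : ℝ) + 1) := by positivity
  have h1 := h _ hr
  have h2 : (r : ENNReal) ≤ ENNReal.ofReal (1 / (1 / ((r : ℝ) + 1))) := by
    rw [one_div_one_div, ← ENNReal.ofReal_coe_nnreal]
    exact ENNReal.ofReal_le_ofReal (by linarith)
  refine h2.trans (h1 ▸ lintegral_mono_ae ?_)
  have : ∀ᵐ x ∂m, ¬ x ∈ Set.Iio (0 : ℝ) := measure_eq_zero_iff_ae_notMem.1 hm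
  filter_upwards [this] with x hx
  have hx' : 0 ≤ x := by simpa using hx
  apply ENNReal.ofReal_le_ofReal
  apply Real.exp_le_exp.2
  nlinarith [mul_nonneg hr.le hx']

lemma lap_wd (m : Measure ℝ) (t : ℝ) :
    ∫⁻ x, ENNReal.ofReal (Real.exp (t * x)) ∂(m.withDensity fun x => ENNReal.ofReal (Real.exp (-x)))
      = ∫⁻ x, ENNReal.ofReal (Real.exp (-(1 - t) * x)) ∂m := by
  rw [lintegral_withDensity_eq_lintegral_mul _ (by fun_prop) (by fun_prop)]
  apply lintegral_congr
  intro x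
  simp only [Pi.mul_apply]
  rw [← ENNReal.ofReal_mul (Real.exp_nonneg _), ← Real.exp_add]
  congr 2
  ring

lemma lap_unique (m₁ m₂ : Measure ℝ) (hm₁ : m₁ (Set.Iio 0) = 0) (hm₂ : m₂ (Set.Iio 0) = 0)
    (h₁ : ∀ l : ℝ, 0 < l → ∫⁻ x, ENNReal.ofReal (Real.exp (-l * x)) ∂m₁ = ENNReal.ofReal (1 / l))
    (h₂ : ∀ l : ℝ, 0 < l → ∫⁻ x, ENNReal.ofReal (Real.exp (-l * x)) ∂m₂ = ENNReal.ofReal (1 / l)) :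
    m₁ = m₂ := by
  have key : ∀ t : ℝ, ∫⁻ x, ENNReal.ofReal (Real.exp (-t * x)) ∂m₁
      = ∫⁻ x, ENNReal.ofReal (Real.exp (-t * x)) ∂m₂ := by
    intro t
    rcases lt_or_ge 0 t with ht | ht
    · rw [h₁ t ht, h₂ t ht]
    · rw [lap_top m₁ hm₁ h₁ t ht, lap_top m₂ hm₂ h₂ t ht]
  set n₁ := m₁.withDensity fun x => ENNReal.ofReal (Real.exp (-x)) with hn₁
  set n₂ := m₂.withDensity fun x => ENNReal.ofReal (Real.exp (-x)) with hn₂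
  have fin : ∀ m : Measure ℝ, (∀ l : ℝ, 0 < l → ∫⁻ x, ENNReal.ofReal (Real.exp (-l * x)) ∂m = ENNReal.ofReal (1 / l)) →
      IsFiniteMeasure (m.withDensity fun x => ENNReal.ofReal (Real.exp (-x))) := by
    intro m h
    apply isFiniteMeasure_withDensity
    have := h 1 one_pos
    simp only [neg_mul, one_mul] at this
    rw [this]; simp
  have : IsFiniteMeasure n₁ := fin m₁ h₁
  have : IsFiniteMeasure n₂ := fin m₂ h₂
  have hmgf : ProbabilityTheory.mgf id n₁ = ProbabilityTheory.mgf id n₂ := by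
    ext t
    simp only [ProbabilityTheory.mgf, id]
    rw [integral_eq_lintegral_of_nonneg_ae (ae_of_all _ fun _ => Real.exp_nonneg _) (by fun_prop),
      integral_eq_lintegral_of_nonneg_ae (ae_of_all _ fun _ => Real.exp_nonneg _) (by fun_prop),
      hn₁, hn₂, lap_wd, lap_wd, key]
  have hne : ∀ m : Measure ℝ, (∀ l : ℝ, 0 < l → ∫⁻ x, ENNReal.ofReal (Real.exp (-l * x)) ∂m = ENNReal.ofReal (1 / l)) →
      (m.withDensity fun x => ENNReal.ofReal (Real.exp (-x))) ≠ 0 := by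
    intro m h h0
    have h3 := lap_wd m 0
    rw [h0, h _ (by norm_num)] at h3
    simp at h3
  have hint : (0 : ℝ) ∈ interior (ProbabilityTheory.integrableExpSet id n₁) := by
    rw [mem_interior]
    refine ⟨Set.Iio 1, ?_, isOpen_Iio, by simp⟩
    intro t ht
    have ht' : 0 < 1 - t := by simpa using ht
    simp only [ProbabilityTheory.integrableExpSet, Set.mem_ofPred_eq, id]
    refine ⟨by fun_prop, ?_⟩
    rw [hasFiniteIntegral_iff_ofReal (ae_of_all _ fun _ => Real.exp_nonneg _), hn₁, lap_wd, h₁ _ ht']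
    simp
  have heq := ProbabilityTheory.eqOn_complexMGF_of_mgf' hmgf
    (iff_of_false (hne m₁ h₁) (hne m₂ h₂))
  have hn : n₁ = n₂ := by
    apply Measure.ext_of_charFun
    ext t
    rw [← ProbabilityTheory.complexMGF_id_mul_I, ← ProbabilityTheory.complexMGF_id_mul_I]
    apply heq
    simpa using hint
  have back : ∀ m : Measure ℝ, (m.withDensity fun x => ENNReal.ofReal (Real.exp (-x))).withDensity
      (fun x => (ENNReal.ofReal (Real.exp (-x)))⁻¹) = m := by
    intro m
    apply withDensity_inv_same (by fun_prop)
    · exact ae_of_all _ fun x => by simp [Real.exp_pos]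
    · exact ae_of_all _ fun x => by simp
  rw [← back m₁, ← back m₂, ← hn₁, ← hn₂, hn]

lemma sfin_nu (ν : Measure ℝ) (hν0 : ν (Set.Iic 0) = 0)
    (hνint : ∫⁻ y in Set.Ioi (0 : ℝ), ENNReal.ofReal (min y (y ^ 2)) ∂ν ≠ ⊤) :
    ν.restrict (Set.Ioi 0) = ν ∧ SFinite ν := by
  have h : ν.restrict (Set.Ioi 0) = ν := by
    apply Measure.restrict_eq_self_of_ae_mem
    have : ∀ᵐ x ∂ν, ¬ x ∈ Set.Iic (0 : ℝ) := measure_eq_zero_iff_ae_notMem.1 hν0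
    filter_upwards [this] with x hx
    simpa using hx
  refine ⟨h, ?_⟩
  have h2 : (ν.withDensity (fun y => ENNReal.ofReal (min y (y ^ 2)))).withDensity
      (fun y => (ENNReal.ofReal (min y (y ^ 2)))⁻¹) = ν := by
    apply withDensity_inv_same (by fun_prop)
    · have : ∀ᵐ x ∂ν, ¬ x ∈ Set.Iic (0 : ℝ) := measure_eq_zero_iff_ae_notMem.1 hν0
      filter_upwards [this] with x hx
      have hx' : 0 < x := by simpa using hx
      simp only [ne_eq, ENNReal.ofReal_eq_zero, not_le]
      positivity
    · exact ae_of_all _ fun x => by simp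
  have : IsFiniteMeasure (ν.withDensity (fun y => ENNReal.ofReal (min y (y ^ 2)))) := by
    apply isFiniteMeasure_withDensity
    rwa [h] at hνint
  rw [← h2]
  infer_instance

lemma cs_int (f : ℝ → ℝ) (a s : ℝ) (has : a ≤ s) (h1 : IntervalIntegrable f volume a s)
    (h2 : IntervalIntegrable (fun r => f r ^ 2) volume a s) :
    (∫ r in a..s, f r) ^ 2 ≤ (s - a) * ∫ r in a..s, f r ^ 2 := by
  rcases has.eq_or_lt with rfl | h
  · simp
  set J := ∫ r in a..s, f r
  have hL : 0 < s - a := by linarith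
  have : 0 ≤ ∫ r in a..s, ((s - a) * f r - J) ^ 2 :=
    intervalIntegral.integral_nonneg has fun _ _ => sq_nonneg _
  have e : (∫ r in a..s, ((s - a) * f r - J) ^ 2)
      = (s - a) ^ 2 * (∫ r in a..s, f r ^ 2) - 2 * (s - a) * J * J + (s - a) * J ^ 2 := by
    have : (fun r => ((s - a) * f r - J) ^ 2)
      = fun r => (s - a) ^ 2 * f r ^ 2 - 2 * (s - a) * J * f r + J ^ 2 := by
      ext r; ring
    rw [this, intervalIntegral.integral_add ((h2.const_mul _).sub (h1.const_mul _)) (by simp),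
      intervalIntegral.integral_sub (h2.const_mul _) (h1.const_mul _)]
    simp [J]
  rw [e] at this
  have h3 : 0 ≤ (s - a) * ((s - a) * (∫ r in a..s, f r ^ 2) - J ^ 2) := by nlinarith
  have := nonneg_of_mul_nonneg_right h3 hL
  linarith

lemma exp_bd (x : ℝ) : |Real.exp (-x) - 1 + x| ≤ x ^ 2 * Real.exp |x| := by
  have h := Complex.norm_exp_sub_sum_le_norm_mul_exp ((-x : ℝ) : ℂ) 2
  have e : Complex.exp ((-x : ℝ) : ℂ) - ∑ m ∈ Finset.range 2, ((-x : ℝ) : ℂ) ^ m / (m.factorial : ℂ)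
      = ((Real.exp (-x) - 1 + x : ℝ) : ℂ) := by
    simp [Finset.sum_range_succ]
    ring
  rw [e, Complex.norm_real, Complex.norm_real] at h
  simpa using h

lemma lint_exp (l z : ℝ) (hl : 0 < l) :
    ∫⁻ x in Set.Ioi z, ENNReal.ofReal (Real.exp (-l * x)) = ENNReal.ofReal (Real.exp (-l * z) / l) := by
  rw [← ofReal_integral_eq_lintegral_ofReal (integrableOn_exp_mul_Ioi (by linarith) z)
    (ae_of_all _ fun _ => Real.exp_nonneg _), integral_exp_mul_Ioi (by linarith)]
  congr 1
  field_simp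

lemma lint_exp_lin (l y : ℝ) (hl : 0 < l) (hy : 0 < y) :
    ∫⁻ x in Set.Ioi (0 : ℝ), ENNReal.ofReal (Real.exp (-l * x)) * ENNReal.ofReal (y - x)
      = ENNReal.ofReal ((Real.exp (-l * y) - 1 + l * y) / l ^ 2) := by
  have h1 : ∫⁻ x in Set.Ioi (0 : ℝ), ENNReal.ofReal (Real.exp (-l * x)) * ENNReal.ofReal (y - x)
      = ∫⁻ x in Set.Ioc (0 : ℝ) y, ENNReal.ofReal (Real.exp (-l * x) * (y - x)) := by
    rw [← lintegral_indicator measurableSet_Ioi, ← lintegral_indicator measurableSet_Ioc]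
    apply lintegral_congr
    intro x
    rw [Set.indicator_apply, Set.indicator_apply, ENNReal.ofReal_mul (Real.exp_nonneg _)]
    by_cases h0 : 0 < x
    · by_cases h2 : x ≤ y
      · simp [h0, h2]
      · have : y - x ≤ 0 := by linarith
        simp [h0, h2, ENNReal.ofReal_of_nonpos this]
    · simp [h0]
  have hc : Continuous fun x : ℝ => Real.exp (-l * x) * (y - x) := by fun_prop
  rw [h1, ← ofReal_integral_eq_lintegral_ofReal]
  · congr 1
    rw [← intervalIntegral.integral_of_le hy.le,
      intervalIntegral.integral_eq_sub_of_hasDerivAt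
        (f := fun x => Real.exp (-l * x) * (-(y - x) / l + 1 / l ^ 2)) _ (hc.intervalIntegrable _ _)]
    · simp
      field_simp
      ring
    · intro x _
      have hA : HasDerivAt (fun x : ℝ => Real.exp (-l * x)) (Real.exp (-l * x) * (-l)) x := by
        have := ((hasDerivAt_id x).const_mul (-l)).exp
        simpa using this
      have hB : HasDerivAt (fun x : ℝ => (-(y - x) / l + 1 / l ^ 2)) (1 / l) x := by
        have := ((((hasDerivAt_id x).const_sub y).neg).div_const l).add_const (1 / l ^ 2)
        simpa using this
      refine (hA.fun_mul hB).congr_deriv ?_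
      field_simp
      ring
  · exact hc.integrableOn_Ioc
  · filter_upwards [ae_restrict_mem measurableSet_Ioc] with x hx
    exact mul_nonneg (Real.exp_nonneg _) (by linarith [hx.2])

lemma exp_nn (u : ℝ) : 0 ≤ Real.exp (-u) - 1 + u := by
  linarith [Real.add_one_le_exp (-u)]

lemma exp_up (l y : ℝ) (hl : 0 < l) (hy : 0 < y) :
    Real.exp (-l * y) - 1 + l * y ≤ (l + l ^ 2) * min y (y ^ 2) := by
  have hu : 0 < l * y := by positivity
  have h1 : Real.exp (-l * y) ≤ 1 := by
    apply Real.exp_le_one_iff.2; linarith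
  have h2 : Real.exp (-l * y) * (1 + l * y) ≤ 1 := by
    have := Real.add_one_le_exp (l * y)
    calc _ ≤ Real.exp (-l * y) * Real.exp (l * y) :=
          mul_le_mul_of_nonneg_left (by linarith) (Real.exp_nonneg _)
      _ = 1 := by rw [← Real.exp_add]; simp
  have h3 : Real.exp (-l * y) ≤ 1 - l * y + (l * y) ^ 2 := by
    have : Real.exp (-l * y) * (1 + l * y) ≤ (1 - l * y + (l * y) ^ 2) * (1 + l * y) := by
      have : 0 < (l * y) ^ 3 := by positivity
      nlinarith
    exact le_of_mul_le_mul_right this (by linarith)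
  rcases min_cases y (y ^ 2) with ⟨h, _⟩ | ⟨h, _⟩ <;> rw [h]
  · nlinarith [mul_pos (pow_pos hl 2) hy]
  · nlinarith [mul_pos hl (pow_pos hy 2)]

lemma nu_int (ν : Measure ℝ) (hνint : ∫⁻ y in Set.Ioi (0 : ℝ), ENNReal.ofReal (min y (y ^ 2)) ∂ν ≠ ⊤)
    (l : ℝ) (hl : 0 < l) :
    IntegrableOn (fun y => Real.exp (-l * y) - 1 + l * y) (Set.Ioi 0) ν := by
  have hm : IntegrableOn (fun y : ℝ => min y (y ^ 2)) (Set.Ioi 0) ν := by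
    refine ⟨by fun_prop, ?_⟩
    rw [hasFiniteIntegral_iff_ofReal]
    · exact lt_top_iff_ne_top.2 hνint
    · filter_upwards [ae_restrict_mem measurableSet_Ioi] with x hx
      have : 0 < x := hx
      simp only [Pi.zero_apply]
      positivity
  refine (hm.const_mul (l + l ^ 2)).mono' (by fun_prop) ?_
  filter_upwards [ae_restrict_mem measurableSet_Ioi] with y hy
  rw [Real.norm_eq_abs, abs_of_nonneg]
  · exact exp_up l y hl hy
  · have := exp_nn (l * y)
    rwa [← neg_mul] at this

lemma phi_pos (b c : ℝ) (hb : 0 ≤ b) (hc : 0 < c) (ν : Measure ℝ) (l : ℝ) (hl : 0 < l) :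
    0 < phi b c ν l := by
  have : 0 ≤ ∫ y in Set.Ioi (0 : ℝ), (Real.exp (-l * y) - 1 + l * y) ∂ν := by
    apply integral_nonneg
    intro y
    have := exp_nn (l * y)
    rwa [← neg_mul] at this
  unfold phi
  positivity

lemma kappa_lap (b c : ℝ) (hb : 0 ≤ b) (hc : 0 < c) (ν : Measure ℝ) (hν0 : ν (Set.Iic 0) = 0)
    (hνint : ∫⁻ y in Set.Ioi (0 : ℝ), ENNReal.ofReal (min y (y ^ 2)) ∂ν ≠ ⊤)
    (l : ℝ) (hl : 0 < l) :
    ∫⁻ x, ENNReal.ofReal (Real.exp (-l * x)) ∂((volume.restrict (Set.Ioi (0 : ℝ))).withDensity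
      (fun x => ENNReal.ofReal b + ∫⁻ y, ENNReal.ofReal (y - x) ∂ν)
      + ENNReal.ofReal c • Measure.dirac (0 : ℝ)) = ENNReal.ofReal (phi b c ν l / l ^ 2) := by
  obtain ⟨hr, hs⟩ := sfin_nu ν hν0 hνint
  have hmeas : Measurable fun x : ℝ => ∫⁻ y, ENNReal.ofReal (y - x) ∂ν := by
    apply Measurable.lintegral_prod_right' (f := fun p : ℝ × ℝ => ENNReal.ofReal (p.2 - p.1))
    fun_prop
  rw [lintegral_add_measure, lintegral_smul_measure, lintegral_dirac,
    lintegral_withDensity_eq_lintegral_mul _ (by fun_prop) (by fun_prop)]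
  have e1 : ∀ x : ℝ, ((fun x => ENNReal.ofReal b + ∫⁻ y, ENNReal.ofReal (y - x) ∂ν) *
      fun x => ENNReal.ofReal (Real.exp (-l * x))) x
      = ENNReal.ofReal b * ENNReal.ofReal (Real.exp (-l * x)) +
        ∫⁻ y, ENNReal.ofReal (Real.exp (-l * x)) * ENNReal.ofReal (y - x) ∂ν := by
    intro x
    rw [lintegral_const_mul _ (by fun_prop), Pi.mul_apply, add_mul]
    congr 1
    rw [mul_comm]
  rw [lintegral_congr e1, lintegral_add_left (by fun_prop), lintegral_const_mul _ (by fun_prop),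
    lint_exp l 0 hl, lintegral_lintegral_swap (by fun_prop)]
  have e2 : ∫⁻ y, ∫⁻ x in Set.Ioi (0 : ℝ), ENNReal.ofReal (Real.exp (-l * x)) * ENNReal.ofReal (y - x) ∂volume ∂ν
      = ENNReal.ofReal ((∫ y in Set.Ioi (0 : ℝ), (Real.exp (-l * y) - 1 + l * y) ∂ν) / l ^ 2) := by
    rw [← integral_div, ofReal_integral_eq_lintegral_ofReal ((nu_int ν hνint l hl).div_const _), hr]
    · apply lintegral_congr_ae
      have : ∀ᵐ x ∂ν, ¬ x ∈ Set.Iic (0 : ℝ) := measure_eq_zero_iff_ae_notMem.1 hν0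
      filter_upwards [this] with y hy
      exact lint_exp_lin l y hl (by simpa using hy)
    · refine ae_of_all _ fun y => ?_
      have := exp_nn (l * y)
      rw [← neg_mul] at this
      simp only [Pi.zero_apply]
      positivity
  have hn : 0 ≤ ∫ y in Set.Ioi (0 : ℝ), (Real.exp (-l * y) - 1 + l * y) ∂ν := by
    apply integral_nonneg
    intro y
    have := exp_nn (l * y)
    rwa [← neg_mul] at this
  rw [e2, ← ENNReal.ofReal_mul hb, ← ENNReal.ofReal_add (by positivity) (by positivity), smul_eq_mul,
    ← ENNReal.ofReal_mul hc.le, ← ENNReal.ofReal_add (by positivity) (by positivity)]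
  congr 1
  unfold phi
  simp
  field_simp
  ring

lemma W_lip (b c : ℝ) (hb : 0 ≤ b) (hc : 0 < c)
    (ν : Measure ℝ) (hν0 : ν (Set.Iic 0) = 0)
    (hνint : ∫⁻ y in Set.Ioi (0 : ℝ), ENNReal.ofReal (min y (y ^ 2)) ∂ν ≠ ⊤)
    (W : ℝ → ℝ)
    (hWneg : ∀ x : ℝ, x < 0 → W x = 0)
    (hWnonneg : ∀ x : ℝ, 0 ≤ W x)
    (hWcont : ContinuousOn W (Set.Ici 0))
    (hWmono : StrictMonoOn W (Set.Ici 0))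
    (hWlap : ∀ l : ℝ, 0 < l →
      (∫ x in Set.Ioi (0 : ℝ), Real.exp (-l * x) * W x) = 1 / phi b c ν l) :
    Monotone W ∧ ∀ x y : ℝ, x ≤ y → c * (W y - W x) ≤ y - x := by
  have hmono : Monotone W := by
    intro x y hxy
    rcases lt_or_ge x 0 with hx | hx
    · rw [hWneg x hx]; exact hWnonneg y
    · exact hWmono.monotoneOn hx (hx.trans hxy : (0 : ℝ) ≤ y) hxy
  refine ⟨hmono, ?_⟩
  obtain ⟨hr, hs⟩ := sfin_nu ν hν0 hνint
  let S : StieltjesFunction ℝ := ⟨W, hmono, by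
    intro x
    rcases lt_or_ge x 0 with hx | hx
    · have : W =ᶠ[𝓝 x] fun _ => (0 : ℝ) := by
        filter_upwards [Iio_mem_nhds hx] with y hy using hWneg y hy
      exact (continuousAt_const.congr this.symm).continuousWithinAt
    · exact (hWcont x hx).mono (Set.Ici_subset_Ici.2 hx)⟩
  have hSW : ∀ x, S x = W x := fun _ => rfl
  set ω := S.measure with hω
  have hbot : Tendsto S atBot (𝓝 0) := by
    apply tendsto_const_nhds.congr'
    filter_upwards [Iio_mem_atBot (0 : ℝ)] with x hx using (hWneg x hx).symm
  have hIic : ∀ x, ω (Set.Iic x) = ENNReal.ofReal (W x) := by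
    intro x
    rw [hω, S.measure_Iic hbot, sub_zero, hSW]
  have hIio : ω (Set.Iio 0) = 0 := by
    rw [hω, S.measure_Iio hbot]
    have : Function.leftLim S 0 = 0 := by
      apply leftLim_eq_of_tendsto
      apply tendsto_const_nhds.congr'
      filter_upwards [self_mem_nhdsWithin] with x hx using (hWneg x hx).symm
    simp [this]
  have hωae : ∀ᵐ x ∂ω, 0 ≤ x := by
    have : ∀ᵐ x ∂ω, ¬ x ∈ Set.Iio (0 : ℝ) := measure_eq_zero_iff_ae_notMem.1 hIio
    filter_upwards [this] with x hx
    simpa using hx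
  have hWm : Measurable W := hmono.measurable
  have hωlap : ∀ l : ℝ, 0 < l → ∫⁻ z, ENNReal.ofReal (Real.exp (-l * z)) ∂ω
      = ENNReal.ofReal (l / phi b c ν l) := by
    intro l hl
    have hφ := phi_pos b c hb hc ν l hl
    have hint : IntegrableOn (fun x => Real.exp (-l * x) * W x) (Set.Ioi 0) := by
      by_contra h
      have h2 := hWlap l hl
      rw [integral_undef h] at h2
      have : 0 < 1 / phi b c ν l := by positivity
      linarith
    have h1 : ∫⁻ x in Set.Ioi (0 : ℝ), ENNReal.ofReal (Real.exp (-l * x) * W x)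
        = ENNReal.ofReal (1 / phi b c ν l) := by
      rw [← hWlap l hl, ofReal_integral_eq_lintegral_ofReal hint]
      exact ae_of_all _ fun x => mul_nonneg (Real.exp_nonneg _) (hWnonneg x)
    have h2 : ∫⁻ x in Set.Ioi (0 : ℝ), ENNReal.ofReal (Real.exp (-l * x) * W x)
        = ∫⁻ x in Set.Ioi (0 : ℝ), ∫⁻ z, {p : ℝ × ℝ | p.2 ≤ p.1}.indicator
          (fun p => ENNReal.ofReal (Real.exp (-l * p.1))) (x, z) ∂ω := by
      apply lintegral_congr
      intro x
      have : ∀ z, {p : ℝ × ℝ | p.2 ≤ p.1}.indicator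
          (fun p => ENNReal.ofReal (Real.exp (-l * p.1))) (x, z)
          = (Set.Iic x).indicator (fun _ => ENNReal.ofReal (Real.exp (-l * x))) z := by
        intro z
        simp [Set.indicator_apply]
      rw [lintegral_congr this, lintegral_indicator_const measurableSet_Iic, hIic,
        ENNReal.ofReal_mul (Real.exp_nonneg _)]
    have hset : MeasurableSet {p : ℝ × ℝ | p.2 ≤ p.1} :=
      measurableSet_le measurable_snd measurable_fst
    rw [lintegral_lintegral_swap (by
      apply Measurable.aemeasurable
      exact (Measurable.indicator (by fun_prop) hset))] at h2
    have h3 : ∫⁻ z, (∫⁻ x in Set.Ioi (0 : ℝ), {p : ℝ × ℝ | p.2 ≤ p.1}.indicator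
          (fun p => ENNReal.ofReal (Real.exp (-l * p.1))) (x, z)) ∂ω
        = ∫⁻ z, ENNReal.ofReal (1 / l) * ENNReal.ofReal (Real.exp (-l * z)) ∂ω := by
      apply lintegral_congr_ae
      filter_upwards [hωae] with z hz
      have : ∀ x, {p : ℝ × ℝ | p.2 ≤ p.1}.indicator
          (fun p => ENNReal.ofReal (Real.exp (-l * p.1))) (x, z)
          = (Set.Ici z).indicator (fun x => ENNReal.ofReal (Real.exp (-l * x))) x := by
        intro x
        simp [Set.indicator_apply]
      rw [lintegral_congr this, lintegral_indicator measurableSet_Ici,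
        Measure.restrict_restrict measurableSet_Ici]
      have hae : (Set.Ici z ∩ Set.Ioi 0 : Set ℝ) =ᵐ[volume] Set.Ioi z := by
        have e1 : (Set.Ici z ∩ Set.Ioi 0 : Set ℝ) =ᵐ[volume] (Set.Ici z ∩ Set.Ici 0 : Set ℝ) :=
          (ae_eq_refl _).inter Ioi_ae_eq_Ici
        have e2 : (Set.Ici z ∩ Set.Ici 0 : Set ℝ) = Set.Ici z :=
          Set.inter_eq_left.2 (Set.Ici_subset_Ici.2 hz)
        rw [e2] at e1
        exact e1.trans Ioi_ae_eq_Ici.symm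
      rw [setLIntegral_congr hae, lint_exp l z hl, ← ENNReal.ofReal_mul (by positivity)]
      congr 1
      ring
    rw [h1, h3, lintegral_const_mul _ (by fun_prop)] at h2
    have h4 : ENNReal.ofReal l * ENNReal.ofReal (1 / phi b c ν l) = ENNReal.ofReal l *
      (ENNReal.ofReal (1 / l) * ∫⁻ z, ENNReal.ofReal (Real.exp (-l * z)) ∂ω) := by rw [h2]
    rw [← mul_assoc, ← ENNReal.ofReal_mul hl.le, ← ENNReal.ofReal_mul hl.le,
      mul_one_div_cancel hl.ne', ENNReal.ofReal_one, one_mul] at h4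
    rw [← h4]
    congr 1
    ring
  set κ := ((volume.restrict (Set.Ioi (0 : ℝ))).withDensity
      (fun x => ENNReal.ofReal b + ∫⁻ y, ENNReal.ofReal (y - x) ∂ν)
      + ENNReal.ofReal c • Measure.dirac (0 : ℝ)) with hκ
  have hκlap := kappa_lap b c hb hc ν hν0 hνint
  rw [← hκ] at hκlap
  have hκae : ∀ᵐ x ∂κ, 0 ≤ x := by
    have hz : κ (Set.Iio 0) = 0 := by
      rw [hκ, Measure.add_apply, Measure.smul_apply, withDensity_apply _ measurableSet_Iio,
        Measure.restrict_restrict measurableSet_Iio]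
      have : (Set.Iio 0 ∩ Set.Ioi 0 : Set ℝ) = ∅ := by
        ext x; simp; intro h; exact h.le
      simp [this]
    have : ∀ᵐ x ∂κ, ¬ x ∈ Set.Iio (0 : ℝ) := measure_eq_zero_iff_ae_notMem.1 hz
    filter_upwards [this] with x hx
    simpa using hx
  have hsκ : SFinite κ := by rw [hκ]; infer_instance
  have hconv : (ω.conv κ) = volume.restrict (Set.Ioi 0) := by
    apply lap_unique
    · rw [← lintegral_indicator_one measurableSet_Iio, Measure.lintegral_conv
        (measurable_one.indicator measurableSet_Iio), lintegral_eq_zero_iff' ]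
      · filter_upwards [hωae] with x hx
        rw [Pi.zero_apply, lintegral_eq_zero_iff]
        · filter_upwards [hκae] with y hy
          simp [add_nonneg hx hy]
        · exact (measurable_one.indicator measurableSet_Iio).comp (measurable_const_add x)
      · apply Measurable.aemeasurable
        apply Measurable.lintegral_prod_right'
          (f := fun p : ℝ × ℝ => (Set.Iio (0 : ℝ)).indicator (1 : ℝ → ENNReal) (p.1 + p.2))
        exact (measurable_one.indicator measurableSet_Iio).comp (measurable_fst.add measurable_snd)
    · rw [Measure.restrict_apply measurableSet_Iio]
      have : (Set.Iio 0 ∩ Set.Ioi 0 : Set ℝ) = ∅ := by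
        ext x; simp; intro h; exact h.le
      simp [this]
    · intro l hl
      rw [Measure.lintegral_conv (by fun_prop)]
      have : ∀ x y : ℝ, ENNReal.ofReal (Real.exp (-l * (x + y)))
          = ENNReal.ofReal (Real.exp (-l * x)) * ENNReal.ofReal (Real.exp (-l * y)) := by
        intro x y
        rw [← ENNReal.ofReal_mul (Real.exp_nonneg _), ← Real.exp_add]
        congr 2; ring
      simp_rw [this]
      simp_rw [lintegral_const_mul _ (show Measurable fun y : ℝ => ENNReal.ofReal (Real.exp (-l * y)) by fun_prop)]
      have hφ := phi_pos b c hb hc ν l hl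
      rw [lintegral_mul_const _ (by fun_prop), hωlap l hl, hκlap l hl,
        ← ENNReal.ofReal_mul (by positivity)]
      congr 1
      field_simp
    · intro l hl
      rw [lint_exp l 0 hl]; simp
  intro x y hxy
  have hA : MeasurableSet (Set.Ioc x y) := measurableSet_Ioc
  have h1 : ENNReal.ofReal c * ω (Set.Ioc x y) ≤ ω.conv κ (Set.Ioc x y) := by
    rw [← lintegral_indicator_one hA, ← lintegral_indicator_one (μ := ω.conv κ) hA,
      Measure.lintegral_conv (measurable_one.indicator hA),
      ← lintegral_const_mul _ (measurable_one.indicator hA)]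
    apply lintegral_mono
    intro z
    beta_reduce
    rw [hκ, lintegral_add_measure, lintegral_smul_measure, lintegral_dirac]
    simp
  rw [hconv, hω, S.measure_Ioc, hSW, hSW, ← ENNReal.ofReal_mul hc.le] at h1
  have h2 := h1.trans (Measure.restrict_apply_le _ _)
  rw [Real.volume_Ioc] at h2
  exact (ENNReal.ofReal_le_ofReal_iff (by linarith)).1 h2

lemma W'_bd (c : ℝ) (hc : 0 < c) (W W' : ℝ → ℝ)
    (hmono : Monotone W) (hlip : ∀ x y : ℝ, x ≤ y → c * (W y - W x) ≤ y - x)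
    (hW'zero : W' 0 = 1 / c)
    (hW'deriv : ∀ x : ℝ, 0 < x → HasDerivAt W (W' x) x) (x : ℝ) (hx : 0 ≤ x) :
    0 ≤ W' x ∧ W' x ≤ 1 / c := by
  rcases hx.eq_or_lt with rfl | hx
  · rw [hW'zero]; exact ⟨by positivity, le_rfl⟩
  · have h := hW'deriv x hx
    constructor
    · rw [← h.deriv]; exact hmono.deriv_nonneg
    · refine (le_abs_self _).trans (h.le_of_lip' (by positivity) (Eventually.of_forall ?_))
      intro y
      rw [Real.norm_eq_abs, Real.norm_eq_abs, one_div, inv_mul_eq_div, le_div_iff₀ hc]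
      rcases le_total x y with hxy | hxy
      · rw [abs_of_nonneg (sub_nonneg.2 (hmono hxy)), abs_of_nonneg (sub_nonneg.2 hxy)]
        linarith [hlip x y hxy]
      · rw [abs_of_nonpos (sub_nonpos.2 (hmono hxy)), abs_of_nonpos (sub_nonpos.2 hxy)]
        linarith [hlip y x hxy]

lemma inner_bd (f : ℝ → ℝ) (hf : Measurable f) (t M : ℝ) (hM : ∀ s ∈ Set.Icc (0 : ℝ) t, |f s| ≤ M)
    (hM0 : 0 ≤ M) (s : ℝ) (hs : s ∈ Set.Ioc 0 t) (y : ℝ) (hy : 0 < y) :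
    ‖Real.exp (-(∫ r in (max (s - y) 0)..s, f r)) - 1 + ∫ r in (max (s - y) 0)..s, f r‖ₑ
      ≤ ENNReal.ofReal (Real.exp (M * t)) * ENNReal.ofReal (min y t) *
        ∫⁻ r in Set.Ioc 0 t, {p : ℝ × ℝ | p.1 - y < p.2 ∧ p.2 ≤ p.1}.indicator
          (fun p => ENNReal.ofReal (f p.2 ^ 2)) (s, r) := by
  set a := max (s - y) 0 with ha
  have ha0 : 0 ≤ a := le_max_right _ _
  have has : a ≤ s := max_le (by linarith) hs.1.le
  have hsub : Set.Ioc a s ⊆ Set.Ioc 0 t := Set.Ioc_subset_Ioc ha0 hs.2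
  have hbd : ∀ r ∈ Set.Ioc a s, |f r| ≤ M := fun r hr =>
    hM r (Set.Ioc_subset_Icc_self (hsub hr))
  have i1 : IntegrableOn f (Set.Ioc a s) := by
    refine Measure.integrableOn_of_bounded (M := M) (by simp) hf.aestronglyMeasurable ?_
    filter_upwards [ae_restrict_mem measurableSet_Ioc] with r hr using hbd r hr
  have i2 : IntegrableOn (fun r => f r ^ 2) (Set.Ioc a s) := by
    refine Measure.integrableOn_of_bounded (M := M ^ 2) (by simp) (by fun_prop) ?_
    filter_upwards [ae_restrict_mem measurableSet_Ioc] with r hr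
    rw [norm_pow]
    exact pow_le_pow_left₀ (norm_nonneg _) (hbd r hr) 2
  have j1 := (intervalIntegrable_iff_integrableOn_Ioc_of_le has).2 i1
  have j2 := (intervalIntegrable_iff_integrableOn_Ioc_of_le has).2 i2
  set J := ∫ r in a..s, f r with hJ
  have hcs := cs_int f a s has j1 j2
  rw [← hJ] at hcs
  have hsa : s - a ≤ min y t := by
    apply le_min
    · linarith [le_max_left (s - y) 0]
    · linarith [hs.2]
  have hJM : |J| ≤ M * t := by
    have : ‖∫ r in a..s, f r‖ ≤ M * |s - a| := by
      apply intervalIntegral.norm_integral_le_of_norm_le_const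
      intro r hr
      rw [Set.uIoc_of_le has] at hr
      exact hbd r hr
    rw [abs_of_nonneg (by linarith)] at this
    exact this.trans (mul_le_mul_of_nonneg_left (by linarith [hs.2]) hM0)
  set F := ∫ r in a..s, f r ^ 2 with hF
  have hF0 : 0 ≤ F := intervalIntegral.integral_nonneg has fun _ _ => sq_nonneg _
  have h1 : ‖Real.exp (-J) - 1 + J‖ ≤ Real.exp (M * t) * min y t * F := by
    refine (exp_bd J).trans ?_
    have e1 : Real.exp |J| ≤ Real.exp (M * t) := Real.exp_le_exp.2 hJM
    have e2 : J ^ 2 ≤ min y t * F := hcs.trans (mul_le_mul_of_nonneg_right hsa hF0)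
    calc J ^ 2 * Real.exp |J| ≤ (min y t * F) * Real.exp (M * t) :=
          mul_le_mul e2 e1 (Real.exp_nonneg _) ((sq_nonneg J).trans e2)
      _ = _ := by ring
  rw [← ofReal_norm_eq_enorm]
  refine (ENNReal.ofReal_le_ofReal h1).trans ?_
  have hmin : 0 ≤ min y t := le_trans (by linarith) hsa
  rw [ENNReal.ofReal_mul (by positivity), ENNReal.ofReal_mul (by positivity)]
  gcongr
  rw [hF, intervalIntegral.integral_of_le has, ofReal_integral_eq_lintegral_ofReal i2
    (ae_of_all _ fun _ => sq_nonneg _), ← lintegral_indicator measurableSet_Ioc,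
    ← lintegral_indicator measurableSet_Ioc]
  apply lintegral_mono
  intro r
  simp only [Set.indicator_apply]
  split_ifs with h2 h3 h4 h5
  · exact le_rfl
  · exact absurd ⟨lt_of_le_of_lt (le_max_left _ _) h2.1, h2.2⟩ h4
  · exact absurd (hsub h2) h3
  · simp
  · simp
  · simp

lemma total_bd (ν : Measure ℝ) (hν0 : ν (Set.Iic 0) = 0)
    (hνint : ∫⁻ y in Set.Ioi (0 : ℝ), ENNReal.ofReal (min y (y ^ 2)) ∂ν ≠ ⊤)
    (f : ℝ → ℝ) (hf : Measurable f) (t M : ℝ) (ht : 0 ≤ t)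
    (hM : ∀ s ∈ Set.Icc (0 : ℝ) t, |f s| ≤ M) (hM0 : 0 ≤ M) :
    ∫⁻ s in Set.Ioc 0 t, ∫⁻ y in Set.Ioi (0 : ℝ),
      ‖Real.exp (-(∫ r in (max (s - y) 0)..s, f r)) - 1 + ∫ r in (max (s - y) 0)..s, f r‖ₑ ∂ν
    ≤ ENNReal.ofReal (Real.exp (M * t)) * ENNReal.ofReal (1 + t) *
      (∫⁻ y in Set.Ioi (0 : ℝ), ENNReal.ofReal (min y (y ^ 2)) ∂ν) *
      ∫⁻ r in Set.Ioc 0 t, ENNReal.ofReal (f r ^ 2) := by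
  obtain ⟨hr, hsf⟩ := sfin_nu ν hν0 hνint
  set E := ENNReal.ofReal (Real.exp (M * t))
  set F := ∫⁻ r in Set.Ioc 0 t, ENNReal.ofReal (f r ^ 2) with hF
  let G : ℝ → ℝ → ℝ → ENNReal := fun s y r =>
    {p : ℝ × ℝ | p.1 - y < p.2 ∧ p.2 ≤ p.1}.indicator (fun p => ENNReal.ofReal (f p.2 ^ 2)) (s, r)
  have hG3 : Measurable fun q : (ℝ × ℝ) × ℝ => G q.1.1 q.1.2 q.2 := by
    have : (fun q : (ℝ × ℝ) × ℝ => G q.1.1 q.1.2 q.2)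
        = ({q : (ℝ × ℝ) × ℝ | q.1.1 - q.1.2 < q.2} ∩ {q : (ℝ × ℝ) × ℝ | q.2 ≤ q.1.1}).indicator
          (fun q => ENNReal.ofReal (f q.2 ^ 2)) := by
      ext q
      simp [G, Set.indicator_apply]
    rw [this]
    apply Measurable.indicator (by fun_prop)
    exact (measurableSet_lt (by fun_prop) (by fun_prop)).inter
      (measurableSet_le (by fun_prop) (by fun_prop))
  have hG2 : Measurable fun p : ℝ × ℝ => ∫⁻ r in Set.Ioc 0 t, G p.1 p.2 r :=
    Measurable.lintegral_prod_right' hG3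
  calc _ ≤ ∫⁻ s in Set.Ioc 0 t, ∫⁻ y in Set.Ioi (0 : ℝ),
        E * ENNReal.ofReal (min y t) * ∫⁻ r in Set.Ioc 0 t, G s y r ∂volume ∂ν := by
        apply lintegral_mono_ae
        filter_upwards [ae_restrict_mem measurableSet_Ioc] with s hs
        apply lintegral_mono_ae
        filter_upwards [ae_restrict_mem measurableSet_Ioi] with y hy
        exact inner_bd f hf t M hM hM0 s hs y hy
    _ = ∫⁻ y in Set.Ioi (0 : ℝ), (∫⁻ s in Set.Ioc 0 t,
        E * ENNReal.ofReal (min y t) * ∫⁻ r in Set.Ioc 0 t, G s y r) ∂ν := by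
        rw [lintegral_lintegral_swap]
        apply Measurable.aemeasurable
        exact Measurable.mul (by fun_prop) hG2
    _ ≤ ∫⁻ y in Set.Ioi (0 : ℝ), E * ENNReal.ofReal (1 + t) * F * ENNReal.ofReal (min y (y ^ 2)) ∂ν := by
        apply lintegral_mono_ae
        filter_upwards [ae_restrict_mem measurableSet_Ioi] with y hy
        have hy' : 0 < y := hy
        have hGy : Measurable (Function.uncurry fun s r => G s y r) :=
          hG3.comp ((measurable_fst.prodMk measurable_const).prodMk measurable_snd)
        rw [lintegral_const_mul' _ _ (by simp only [E]; exact ENNReal.mul_ne_top (by simp) (by simp)),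
          lintegral_lintegral_swap hGy.aemeasurable]
        have h1 : ∫⁻ r in Set.Ioc 0 t, ∫⁻ s in Set.Ioc 0 t, G s y r
            ≤ ∫⁻ r in Set.Ioc 0 t, ENNReal.ofReal (f r ^ 2) * ENNReal.ofReal (min y t) := by
          apply lintegral_mono
          intro r
          beta_reduce
          have : ∀ s, G s y r = (Set.Ico r (r + y)).indicator (fun _ => ENNReal.ofReal (f r ^ 2)) s := by
            intro s
            simp only [G, Set.indicator_apply, Set.mem_Ico]
            apply if_congr _ rfl rfl
            constructor
            · rintro ⟨h1, h2⟩
              exact ⟨h2, by simp only at h1; linarith⟩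
            · rintro ⟨h1, h2⟩
              exact ⟨by simp only; linarith, h1⟩
          rw [lintegral_congr this, lintegral_indicator_const measurableSet_Ico]
          gcongr
          rw [ENNReal.ofReal_min]
          apply le_min
          · refine (Measure.restrict_apply_le _ _).trans ?_
            rw [Real.volume_Ico]; simp
          · rw [Measure.restrict_apply measurableSet_Ico]
            refine (measure_mono Set.inter_subset_right).trans ?_
            rw [Real.volume_Ioc]; simp
        rw [lintegral_mul_const _ (by fun_prop), ← hF] at h1
        refine (mul_le_mul_right h1 _).trans ?_
        have hmin : 0 ≤ min y t := le_min hy'.le ht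
        have h2 : ENNReal.ofReal (min y t) * ENNReal.ofReal (min y t)
            ≤ ENNReal.ofReal (1 + t) * ENNReal.ofReal (min y (y ^ 2)) := by
          rw [← ENNReal.ofReal_mul hmin, ← ENNReal.ofReal_mul (by linarith)]
          apply ENNReal.ofReal_le_ofReal
          have a1 := min_le_left y t
          have a2 := min_le_right y t
          rcases min_cases y (y ^ 2) with ⟨h, _⟩ | ⟨h, _⟩ <;> rw [h]
          · nlinarith
          · nlinarith [mul_nonneg ht (sq_nonneg y)]
        calc E * ENNReal.ofReal (min y t) * (F * ENNReal.ofReal (min y t))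
            = E * F * (ENNReal.ofReal (min y t) * ENNReal.ofReal (min y t)) := by ring
          _ ≤ E * F * (ENNReal.ofReal (1 + t) * ENNReal.ofReal (min y (y ^ 2))) := by gcongr
          _ = _ := by ring
    _ = _ := by
        rw [lintegral_const_mul _ (by fun_prop)]
        ring

/-- Proposition 7.1: upper bound for `(𝓡∘f) * W′`. -/
theorem stmt16
    (b c : ℝ) (hb : 0 ≤ b) (hc : 0 < c)
    (ν : Measure ℝ) (hν0 : ν (Set.Iic 0) = 0)
    (hνint : ∫⁻ y in Set.Ioi (0 : ℝ), ENNReal.ofReal (min y (y ^ 2)) ∂ν ≠ ⊤)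
    (W W' : ℝ → ℝ)
    (hWneg : ∀ x : ℝ, x < 0 → W x = 0)
    (hWnonneg : ∀ x : ℝ, 0 ≤ W x)
    (hWcont : ContinuousOn W (Set.Ici 0))
    (hWmono : StrictMonoOn W (Set.Ici 0))
    (hWlap : ∀ l : ℝ, 0 < l →
      (∫ x in Set.Ioi (0 : ℝ), Real.exp (-l * x) * W x) = 1 / phi b c ν l)
    (hW'neg : ∀ x : ℝ, x < 0 → W' x = 0)
    (hW'zero : W' 0 = 1 / c)
    (hW'deriv : ∀ x : ℝ, 0 < x → HasDerivAt W (W' x) x)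
    (hW'cont : ContinuousOn W' (Set.Ici 0))
    :
    ∃ C : ℝ, 0 < C ∧ ∀ f : ℝ → ℝ, Measurable f →
      (∀ T : ℝ, 0 ≤ T → ∃ M : ℝ, ∀ s ∈ Set.Icc (0 : ℝ) T, |f s| ≤ M) →
      ∀ t : ℝ, 0 ≤ t →
        0 ≤ (∫ s in (0 : ℝ)..t, Rop c ν f s * W' (t - s)) ∧
        (∫ s in (0 : ℝ)..t, Rop c ν f s * W' (t - s)) ≤
          C * Real.exp ((⨆ s : Set.Icc (0 : ℝ) t, |f s|) * t) * (1 + t) ^ 2 *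
            ∫ s in (0 : ℝ)..t, |f s| ^ 2 := by
  classical
  obtain ⟨hmono, hlip⟩ := W_lip b c hb hc ν hν0 hνint W hWneg hWnonneg hWcont hWmono hWlap
  have hW'b := W'_bd c hc W W' hmono hlip hW'zero hW'deriv
  set K := (∫⁻ y in Set.Ioi (0 : ℝ), ENNReal.ofReal (min y (y ^ 2)) ∂ν).toReal with hK
  have hK0 : 0 ≤ K := ENNReal.toReal_nonneg
  have hKe : ∫⁻ y in Set.Ioi (0 : ℝ), ENNReal.ofReal (min y (y ^ 2)) ∂ν = ENNReal.ofReal K :=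
    (ENNReal.ofReal_toReal hνint).symm
  refine ⟨1 + K / c, by positivity, ?_⟩
  intro f hf hbd t ht
  have hR0 : ∀ s, 0 ≤ Rop c ν f s := by
    intro s
    unfold Rop
    refine add_nonneg (by positivity) (integral_nonneg fun y => ?_)
    exact exp_nn _
  refine ⟨intervalIntegral.integral_nonneg ht fun s hs =>
    mul_nonneg (hR0 s) (hW'b _ (by linarith [hs.2])).1, ?_⟩
  set M := ⨆ s : Set.Icc (0 : ℝ) t, |f s| with hMdef
  have hM : ∀ s ∈ Set.Icc (0 : ℝ) t, |f s| ≤ M := by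
    intro s hs
    obtain ⟨B, hB⟩ := hbd t ht
    have : BddAbove (Set.range fun s : Set.Icc (0 : ℝ) t => |f s|) :=
      ⟨B, by rintro _ ⟨s, rfl⟩; exact hB s s.2⟩
    exact le_ciSup this ⟨s, hs⟩
  have hM0 : 0 ≤ M := (abs_nonneg _).trans (hM 0 ⟨le_rfl, ht⟩)
  have htot := total_bd ν hν0 hνint f hf t M ht hM hM0
  have i2 : IntegrableOn (fun r => f r ^ 2) (Set.Ioc 0 t) := by
    refine Measure.integrableOn_of_bounded (M := M ^ 2) (by simp) (by fun_prop) ?_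
    filter_upwards [ae_restrict_mem measurableSet_Ioc] with r hr
    rw [norm_pow]
    exact pow_le_pow_left₀ (norm_nonneg _) (hM r (Set.Ioc_subset_Icc_self hr)) 2
  have hFe : ∫⁻ r in Set.Ioc 0 t, ENNReal.ofReal (f r ^ 2)
      = ENNReal.ofReal (∫ s in (0 : ℝ)..t, |f s| ^ 2) := by
    simp only [sq_abs]
    rw [intervalIntegral.integral_of_le ht, ofReal_integral_eq_lintegral_ofReal i2
      (ae_of_all _ fun _ => sq_nonneg _)]
  set F := ∫ s in (0 : ℝ)..t, |f s| ^ 2 with hF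
  have hF0 : 0 ≤ F := intervalIntegral.integral_nonneg ht fun _ _ => sq_nonneg _
  set E := Real.exp (M * t) with hE
  have hE1 : 1 ≤ E := Real.one_le_exp (mul_nonneg hM0 ht)
  have hmain : ENNReal.ofReal (∫ s in (0 : ℝ)..t, Rop c ν f s * W' (t - s))
      ≤ ENNReal.ofReal (1 / c * (c * F + E * (1 + t) * K * F)) := by
    rw [intervalIntegral.integral_of_le ht]
    refine (ENNReal.ofReal_le_ofReal (le_abs_self _)).trans ?_
    rw [← Real.norm_eq_abs, ofReal_norm_eq_enorm]
    refine (enorm_integral_le_lintegral_enorm _).trans ?_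
    calc _ ≤ ∫⁻ s in Set.Ioc 0 t, ENNReal.ofReal (1 / c) * (ENNReal.ofReal c * ENNReal.ofReal (f s ^ 2)
          + ∫⁻ y in Set.Ioi (0 : ℝ),
      ‖Real.exp (-(∫ r in (max (s - y) 0)..s, f r)) - 1 + ∫ r in (max (s - y) 0)..s, f r‖ₑ ∂ν) := by
          apply lintegral_mono_ae
          filter_upwards [ae_restrict_mem measurableSet_Ioc] with s hs
          rw [enorm_mul, mul_comm]
          have hw := hW'b (t - s) (by linarith [hs.2])
          gcongr
          · rw [Real.enorm_eq_ofReal hw.1]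
            exact ENNReal.ofReal_le_ofReal hw.2
          · unfold Rop
            refine (enorm_add_le _ _).trans ?_
            gcongr
            · rw [Real.enorm_eq_ofReal (by positivity), ENNReal.ofReal_mul hc.le]
            · exact enorm_integral_le_lintegral_enorm _
      _ = ENNReal.ofReal (1 / c) * (ENNReal.ofReal c * ENNReal.ofReal F + ∫⁻ s in Set.Ioc 0 t, ∫⁻ y in Set.Ioi (0 : ℝ),
      ‖Real.exp (-(∫ r in (max (s - y) 0)..s, f r)) - 1 + ∫ r in (max (s - y) 0)..s, f r‖ₑ ∂ν) := by
          rw [lintegral_const_mul' _ _ (by simp), lintegral_add_left (by fun_prop),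
            lintegral_const_mul _ (by fun_prop), hFe]
      _ ≤ _ := by
          rw [hKe, hFe] at htot
          rw [ENNReal.ofReal_mul (by positivity), ENNReal.ofReal_add (by positivity) (by positivity),
            ENNReal.ofReal_mul hc.le, ENNReal.ofReal_mul (by positivity),
            ENNReal.ofReal_mul (by positivity), ENNReal.ofReal_mul (by positivity)]
          gcongr
  have h2 := (ENNReal.ofReal_le_ofReal_iff (by positivity)).1 hmain
  refine h2.trans ?_
  have e1 : 1 / c * (c * F + E * (1 + t) * K * F) = F + K / c * (E * (1 + t)) * F := by
    field_simp
  rw [e1]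
  have hKc : 0 ≤ K / c := by positivity
  have a1 : (1 + t) ≤ (1 + t) ^ 2 := by nlinarith
  have a2 : E * (1 + t) ≤ E * (1 + t) ^ 2 := mul_le_mul_of_nonneg_left a1 (by linarith)
  have a3 : 1 ≤ E * (1 + t) ^ 2 := by nlinarith
  have a4 : K / c * (E * (1 + t)) ≤ K / c * (E * (1 + t) ^ 2) := mul_le_mul_of_nonneg_left a2 hKc
  calc F + K / c * (E * (1 + t)) * F = (1 + K / c * (E * (1 + t))) * F := by ring
    _ ≤ (E * (1 + t) ^ 2 + K / c * (E * (1 + t) ^ 2)) * F :=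
      mul_le_mul_of_nonneg_right (by linarith) hF0
    _ = _ := by ring
end

section
/- There exists a constant C > 0 such that for all locally bounded measurable functions f₁, f₂ : [0,∞) → ℝ and all t ≥ 0: |((𝓡∘f₁) * W′)(t) − ((𝓡∘f₂) * W′)(t)| ≤ C·exp((‖f₁‖_{L^∞([0,t])} + ‖f₂‖_{L^∞([0,t])})·(1+t))·(1+t)²·∫₀^t |f₁(s) − f₂(s)| ds. -/
open MeasureTheory Real Set Filter Topology

lemma laplace_ext_aux {P P' : Measure (Set.Ici (0:ℝ))} [IsFiniteMeasure P] [IsFiniteMeasure P']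
    (h : ∀ n : ℕ, ∫ x, Real.exp (-(x:ℝ)) ^ n ∂P = ∫ x, Real.exp (-(x:ℝ)) ^ n ∂P') : P = P' := by
  have : PolishSpace (Set.Ici (0:ℝ)) := isClosed_Ici.polishSpace
  let g : BoundedContinuousFunction (Set.Ici (0:ℝ)) ℝ :=
    BoundedContinuousFunction.ofNormedAddCommGroup (fun x => Real.exp (-(x:ℝ))) (by fun_prop) 1
      (fun x => by
        have := x.2
        simp only [Set.mem_Ici] at this
        simp [abs_of_pos (Real.exp_pos _), this])
  have hg : ∀ x, g x = Real.exp (-(x:ℝ)) := fun x => rfl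
  let A : StarSubalgebra ℝ (BoundedContinuousFunction (Set.Ici (0:ℝ)) ℝ) :=
    { (Polynomial.aeval (R := ℝ) g).range with
      star_mem' := by
        intro a ha
        have : star a = a := by ext x; simp
        rw [this]; exact ha }
  have hmem : ∀ a, a ∈ A ↔ ∃ p : Polynomial ℝ, Polynomial.aeval g p = a := fun a => Iff.rfl
  refine ext_of_forall_mem_subalgebra_integral_eq_of_polish (A := A) ?_ ?_
  · intro x y hxy
    refine ⟨g, ⟨BoundedContinuousFunction.toContinuousMapStarₐ ℝ g, ?_, rfl⟩, ?_⟩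
    · refine ⟨g, (hmem g).2 ⟨Polynomial.X, by simp⟩, rfl⟩
    · simp only [hg]
      intro h
      apply hxy
      have := Real.exp_injective h
      exact Subtype.ext (by linarith)
  · intro a ha
    obtain ⟨p, rfl⟩ := (hmem a).1 ha
    induction p using Polynomial.induction_on' with
    | add p q hp hq =>
      have hp := hp ((hmem _).2 ⟨p, rfl⟩)
      have hq := hq ((hmem _).2 ⟨q, rfl⟩)
      simp only [map_add, BoundedContinuousFunction.coe_add, Pi.add_apply]
      rw [integral_add (BoundedContinuousFunction.integrable _ _) (BoundedContinuousFunction.integrable _ _),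
        integral_add (BoundedContinuousFunction.integrable _ _) (BoundedContinuousFunction.integrable _ _), hp, hq]
    | monomial n r =>
      have : ∀ x, (Polynomial.aeval g (Polynomial.monomial n r)) x = r * Real.exp (-(x:ℝ)) ^ n := by
        intro x
        rw [Polynomial.aeval_monomial, ← hg, Algebra.algebraMap_eq_smul_one]
        simp
      simp only [this, integral_const_mul, h n]

/-- uniqueness for Laplace transforms -/
lemma laplace_ext {μ μ' : Measure ℝ} (hμ : μ (Set.Iio 0) = 0) (hμ' : μ' (Set.Iio 0) = 0)
    (hfin : ∀ l : ℝ, 0 < l → ∫⁻ x, ENNReal.ofReal (Real.exp (-l * x)) ∂μ ≠ ⊤)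
    (h : ∀ l : ℝ, 0 < l → ∫⁻ x, ENNReal.ofReal (Real.exp (-l * x)) ∂μ
      = ∫⁻ x, ENNReal.ofReal (Real.exp (-l * x)) ∂μ') : μ = μ' := by
  let e : ℝ → ENNReal := fun x => ENNReal.ofReal (Real.exp (-1 * x))
  have he : Measurable e := by fun_prop
  have key : ∀ μ : Measure ℝ, μ (Set.Iio 0) = 0 → 
      (μ.withDensity e) = ((μ.withDensity e).comap (Subtype.val : Set.Ici (0:ℝ) → ℝ)).map Subtype.val := by
    intro μ hμ
    rw [(MeasurableEmbedding.subtype_coe measurableSet_Ici).map_comap, Subtype.range_coe]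
    rw [Measure.restrict_eq_self_of_ae_mem]
    have : ∀ᵐ x ∂μ, x ∈ Set.Ici (0:ℝ) := by
      rw [ae_iff]; convert hμ using 2; ext; simp
    exact (withDensity_absolutelyContinuous _ _).ae_le this
  have hmain : (μ.withDensity e).comap (Subtype.val : Set.Ici (0:ℝ) → ℝ)
     = (μ'.withDensity e).comap (Subtype.val : Set.Ici (0:ℝ) → ℝ) := by
    have hf : ∀ μ : Measure ℝ, ∫⁻ x, ENNReal.ofReal (Real.exp (-1 * x)) ∂μ ≠ ⊤ →
        IsFiniteMeasure ((μ.withDensity e).comap (Subtype.val : Set.Ici (0:ℝ) → ℝ)) := by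
      intro μ hh
      refine ⟨?_⟩
      rw [(MeasurableEmbedding.subtype_coe measurableSet_Ici).comap_apply]
      have := isFiniteMeasure_withDensity hh
      exact measure_lt_top _ _
    have := hf μ (hfin 1 one_pos)
    have := hf μ' (h 1 one_pos ▸ hfin 1 one_pos)
    apply laplace_ext_aux
    intro n
    have hI : ∀ μ : Measure ℝ, μ (Set.Iio 0) = 0 → 
        ∫ x, Real.exp (-(x:ℝ)) ^ n ∂((μ.withDensity e).comap (Subtype.val : Set.Ici (0:ℝ) → ℝ))
        = (∫⁻ x, ENNReal.ofReal (Real.exp (-(n+1:ℝ) * x)) ∂μ).toReal := by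
      intro μ hμ
      rw [← (MeasurableEmbedding.subtype_coe measurableSet_Ici).integral_map (fun x => Real.exp (-x)^n),
        ← key μ hμ, integral_eq_lintegral_of_nonneg_ae (ae_of_all _ fun x => by positivity) (by fun_prop),
        lintegral_withDensity_eq_lintegral_mul _ he (by fun_prop)]
      congr 2
      ext x
      simp only [Pi.mul_apply, e]
      rw [← ENNReal.ofReal_mul (by positivity), ← Real.exp_nat_mul, ← Real.exp_add]
      congr 2; ring
    rw [hI μ hμ, hI μ' hμ', h _ (by positivity)]
  have h2 : μ.withDensity e = μ'.withDensity e := by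
    rw [key μ hμ, key μ' hμ', hmain]
  have h3 : ∀ μ : Measure ℝ, μ = (μ.withDensity e).withDensity (fun x => (e x)⁻¹) := by
    intro μ
    rw [withDensity_inv_same he]
    · exact ae_of_all _ fun x => by simp [e, Real.exp_pos]
    · exact ae_of_all _ fun x => by simp [e]
  rw [h3 μ, h3 μ', h2]

noncomputable def LapT (μ : Measure ℝ) (l : ℝ) : ENNReal := ∫⁻ x, ENNReal.ofReal (Real.exp (-l * x)) ∂μ

lemma LT_conv (μ ρ : Measure ℝ) [SFinite μ] [SFinite ρ] (l : ℝ) :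
    LapT (μ.conv ρ) l = LapT μ l * LapT ρ l := by
  unfold LapT
  rw [Measure.lintegral_conv (by fun_prop)]
  rw [← lintegral_mul_const _ (by fun_prop)]
  congr 1
  ext x
  rw [← lintegral_const_mul _ (by fun_prop)]
  congr 1
  ext y
  rw [← ENNReal.ofReal_mul (by positivity), ← Real.exp_add]
  congr 2; ring

lemma LT_Ioi (a l : ℝ) (hl : 0 < l) :
    ∫⁻ x in Set.Ioi a, ENNReal.ofReal (Real.exp (-l * x)) = ENNReal.ofReal (Real.exp (-l * a) / l) := by
  rw [← ofReal_integral_eq_lintegral_ofReal]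
  · rw [integral_exp_mul_Ioi (by linarith)]
    congr 1
    field_simp
  · exact integrableOn_exp_mul_Ioi (by linarith) a
  · exact ae_of_all _ fun x => by positivity

lemma LT_tail (y l : ℝ) (hl : 0 < l) (hy : 0 < y) :
    ∫⁻ z in Set.Ioi (0:ℝ), ENNReal.ofReal (y - z) * ENNReal.ofReal (Real.exp (-l * z))
     = ENNReal.ofReal ((Real.exp (-l * y) - 1 + l * y) / l ^ 2) := by
  rw [← Set.Ioc_union_Ioi_eq_Ioi hy.le, lintegral_union measurableSet_Ioi (Set.Ioc_disjoint_Ioi le_rfl)]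
  have h2 : ∫⁻ z in Set.Ioi y, ENNReal.ofReal (y - z) * ENNReal.ofReal (Real.exp (-l * z)) = 0 := by
    rw [setLIntegral_congr_fun (g := fun _ => 0) measurableSet_Ioi]
    · simp
    · intro z hz
      have : y - z ≤ 0 := by simp at hz; linarith
      simp [ENNReal.ofReal_of_nonpos this]
  rw [h2, add_zero]
  have h3 : ∀ z ∈ Set.Ioc 0 y, ENNReal.ofReal (y - z) * ENNReal.ofReal (Real.exp (-l * z))
      = ENNReal.ofReal ((y - z) * Real.exp (-l * z)) := by
    intro z hz
    rw [ENNReal.ofReal_mul (by linarith [hz.2])]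
  rw [setLIntegral_congr_fun measurableSet_Ioc h3, ← ofReal_integral_eq_lintegral_ofReal]
  · congr 1
    rw [← intervalIntegral.integral_of_le hy.le]
    rw [intervalIntegral.integral_eq_sub_of_hasDerivAt
      (f := fun z => -(y - z) * Real.exp (-l * z) / l + Real.exp (-l * z) / l ^ 2)]
    · simp; field_simp; ring
    · intro z _
      have h1 : HasDerivAt (fun z => Real.exp (-l * z)) (Real.exp (-l * z) * (-l * 1)) z :=
        ((hasDerivAt_id z).const_mul (-l)).exp
      have h4 : HasDerivAt (fun z : ℝ => -(y - z)) (-(0 - 1)) z :=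
        ((hasDerivAt_const z y).sub (hasDerivAt_id z)).neg
      have h5 := ((h4.mul h1).div_const l).add (h1.div_const (l ^ 2))
      have h6 : (-(0 - 1) * rexp (-l * z) + -(y - z) * (rexp (-l * z) * (-l * 1))) / l
          + rexp (-l * z) * (-l * 1) / l ^ 2 = (y - z) * rexp (-l * z) := by
        field_simp; ring
      rw [h6] at h5
      exact h5
    · exact Continuous.intervalIntegrable (by fun_prop) _ _
  · exact (Continuous.integrableOn_Icc (by fun_prop)).mono_set Set.Ioc_subset_Icc_self
  · filter_upwards [ae_restrict_mem measurableSet_Ioc] with z hz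
    have : 0 ≤ y - z := by linarith [hz.2]
    positivity

lemma sfinite_nu (ν : Measure ℝ)
    (hνint : ∫⁻ y in Set.Ioi (0 : ℝ), ENNReal.ofReal (min y (y ^ 2)) ∂ν ≠ ⊤) :
    SFinite (ν.restrict (Set.Ioi (0:ℝ))) := by
  have he : Measurable (fun y : ℝ => ENNReal.ofReal (min y (y ^ 2))) := by fun_prop
  have := isFiniteMeasure_withDensity hνint
  rw [← withDensity_inv_same (μ := ν.restrict (Set.Ioi (0:ℝ))) he]
  · infer_instance
  · filter_upwards [ae_restrict_mem measurableSet_Ioi] with y hy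
    simp only [Set.mem_Ioi] at hy
    have : 0 < min y (y^2) := by positivity
    exact (ENNReal.ofReal_pos.2 this).ne'
  · exact ae_of_all _ fun x => by simp

lemma E_nonneg (x : ℝ) : 0 ≤ Real.exp (-x) - 1 + x := by
  have := Real.add_one_le_exp (-x); linarith

lemma E_bound {x : ℝ} (hx : 0 ≤ x) : Real.exp (-x) - 1 + x ≤ min x (x ^ 2) := by
  apply le_min
  · have : Real.exp (-x) ≤ 1 := by simpa using hx
    linarith
  · rcases le_total x 1 with h | h
    · have := Real.abs_exp_sub_one_sub_id_le (x := -x) (by rw [abs_neg, abs_of_nonneg hx]; exact h)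
      have := (abs_le.1 this).2
      nlinarith
    · have : Real.exp (-x) ≤ 1 := by simpa using hx
      nlinarith

lemma phi_eq (b c : ℝ) (hb : 0 ≤ b) (hc : 0 < c) (ν : Measure ℝ)
    (hνint : ∫⁻ y in Set.Ioi (0 : ℝ), ENNReal.ofReal (min y (y ^ 2)) ∂ν ≠ ⊤) (l : ℝ) (hl : 0 < l) :
    0 < phi b c ν l ∧ ENNReal.ofReal (phi b c ν l / l ^ 2) = ENNReal.ofReal c + ENNReal.ofReal b * ENNReal.ofReal (1 / l)
      + ∫⁻ y in Set.Ioi (0:ℝ), ENNReal.ofReal ((Real.exp (-l * y) - 1 + l * y) / l ^ 2) ∂ν := by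
  have hE : ∀ y, 0 ≤ Real.exp (-l * y) - 1 + l * y := fun y => by
    simpa using E_nonneg (l * y)
  have h0 : 0 ≤ ∫ y in Set.Ioi (0 : ℝ), (Real.exp (-l * y) - 1 + l * y) ∂ν :=
    integral_nonneg fun y => hE y
  have hpos : 0 < phi b c ν l := by unfold phi; positivity
  refine ⟨hpos, ?_⟩
  have hint : IntegrableOn (fun y => (Real.exp (-l * y) - 1 + l * y) / l ^ 2) (Set.Ioi 0) ν := by
    have hm : IntegrableOn (fun y : ℝ => (l + l ^ 2) * min y (y ^ 2)) (Set.Ioi 0) ν := by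
      refine Integrable.const_mul ?_ _
      refine ⟨by fun_prop, ?_⟩
      rw [hasFiniteIntegral_iff_ofReal]
      · exact lt_top_iff_ne_top.2 hνint
      · filter_upwards [ae_restrict_mem measurableSet_Ioi] with y hy
        have : (0:ℝ) < y := hy
        change 0 ≤ min y (y ^ 2)
        positivity
    refine Integrable.div_const (Integrable.mono' hm (by fun_prop) ?_) _
    filter_upwards [ae_restrict_mem measurableSet_Ioi] with y hy
    have hy' : (0:ℝ) < y := hy
    rw [Real.norm_of_nonneg (hE y)]
    have hb := E_bound (x := l * y) (by positivity)
    rw [← neg_mul] at hb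
    obtain ⟨h1, h2⟩ := le_min_iff.1 hb
    rcases min_choice y (y ^ 2) with h | h <;> rw [h] <;> nlinarith [mul_pos hl hy', mul_pos hl hl, mul_pos (mul_pos hl hy') hy', mul_pos (mul_pos hl hl) hy']
  rw [← ofReal_integral_eq_lintegral_ofReal hint (ae_of_all _ fun y => div_nonneg (hE y) (by positivity)),
    ← ENNReal.ofReal_mul hb, ← ENNReal.ofReal_add hc.le (by positivity), ← ENNReal.ofReal_add (by positivity) 
      (integral_nonneg fun y => div_nonneg (hE y) (by positivity)), integral_div]
  congr 1
  unfold phi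
  field_simp; ring

lemma Wprime_bound
    (b c : ℝ) (hb : 0 ≤ b) (hc : 0 < c)
    (ν : Measure ℝ)
    (hνint : ∫⁻ y in Set.Ioi (0 : ℝ), ENNReal.ofReal (min y (y ^ 2)) ∂ν ≠ ⊤)
    (W W' : ℝ → ℝ)
    (hWnonneg : ∀ x : ℝ, 0 ≤ W x)
    (hWcont : ContinuousOn W (Set.Ici 0))
    (hWmono : StrictMonoOn W (Set.Ici 0))
    (hWlap : ∀ l : ℝ, 0 < l →
      (∫ x in Set.Ioi (0 : ℝ), Real.exp (-l * x) * W x) = 1 / phi b c ν l)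
    (hW'deriv : ∀ x : ℝ, 0 < x → HasDerivAt W (W' x) x)
    (hW'cont : ContinuousOn W' (Set.Ici 0)) :
    ∀ x, 0 ≤ x → 0 ≤ W' x ∧ W' x ≤ 1 / c := by
  have hsf := sfinite_nu ν hνint
  -- continuous extension
  set v : ℝ → ℝ := fun x => W' (max x 0) with hv
  have hvc : Continuous v := hW'cont.comp_continuous (by fun_prop) (fun x => Set.mem_Ici.2 (le_max_right _ _))
  have hvx : ∀ x, 0 ≤ x → v x = W' x := fun x hx => by simp [hv, hx]
  have hpos : ∀ x, 0 < x → 0 ≤ W' x := by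
    intro x hx
    have h1 := (hW'deriv x hx).hasDerivWithinAt (s := Set.Ioi 0)
    have h2 := h1.derivWithin (isOpen_Ioi.uniqueDiffWithinAt hx)
    rw [← h2]
    exact (hWmono.monotoneOn.mono Set.Ioi_subset_Ici_self).derivWithin_nonneg
  have closed_ext : ∀ (P : ℝ → Prop), IsClosed {y | P y} → (∀ x, 0 < x → P (W' x)) → ∀ x, 0 ≤ x → P (W' x) := by
    intro P hP h x hx
    rcases hx.eq_or_lt with rfl | hx
    · have h1 : Tendsto v (𝓝[>] 0) (𝓝 (v 0)) := (hvc.tendsto 0).mono_left nhdsWithin_le_nhds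
      have := hP.mem_of_tendsto h1 (by
        filter_upwards [self_mem_nhdsWithin] with y hy
        have hy' : (0:ℝ) < y := hy
        simp only [hvx y hy'.le]
        exact h y hy)
      rw [hvx 0 le_rfl] at this
      exact this
    · exact h x hx
  have hpos' := closed_ext (fun y => 0 ≤ y) isClosed_Ici hpos
  have hv0 : ∀ x, 0 ≤ v x := fun x => hpos' _ (le_max_right _ _)
  set V : Measure ℝ := volume.restrict (Set.Ioi (0:ℝ)) with hV
  set ω : Measure ℝ := V.withDensity (fun x => ENNReal.ofReal (v x)) with hω
  set ω' : Measure ℝ := ENNReal.ofReal (W 0) • Measure.dirac 0 + ω with hω'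
  set h : ℝ → ENNReal := fun z => ∫⁻ y in Set.Ioi (0:ℝ), ENNReal.ofReal (y - z) ∂ν with hh
  have hhm : Measurable h := by
    have : Measurable (fun p : ℝ × ℝ => ENNReal.ofReal (p.2 - p.1)) := by fun_prop
    exact this.lintegral_prod_right'
  set ρ : Measure ℝ := V.withDensity (fun z => ENNReal.ofReal b + h z) with hρ
  set κ : Measure ℝ := ENNReal.ofReal c • Measure.dirac 0 + ρ with hκ
  have hLV : ∀ l, 0 < l → LapT V l = ENNReal.ofReal (1 / l) := by
    intro l hl
    have := LT_Ioi 0 l hl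
    simpa [LapT, hV] using this
  -- Laplace transform of κ
  have hLκ : ∀ l, 0 < l → LapT κ l = ENNReal.ofReal (phi b c ν l / l ^ 2) := by
    intro l hl
    have h1 : LapT ρ l = ENNReal.ofReal b * ENNReal.ofReal (1 / l) 
        + ∫⁻ y in Set.Ioi (0:ℝ), ENNReal.ofReal ((Real.exp (-l * y) - 1 + l * y) / l ^ 2) ∂ν := by
      unfold LapT
      rw [hρ, lintegral_withDensity_eq_lintegral_mul _ (by fun_prop) (by fun_prop)]
      simp only [Pi.mul_apply, add_mul]
      rw [lintegral_add_left (by fun_prop), lintegral_const_mul _ (by fun_prop)]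
      congr 1
      · congr 1; exact hLV l hl
      · simp only [hh]
        have : ∀ x, (∫⁻ y in Set.Ioi (0:ℝ), ENNReal.ofReal (y - x) ∂ν) * ENNReal.ofReal (rexp (-l * x))
          = ∫⁻ y in Set.Ioi (0:ℝ), ENNReal.ofReal (y - x) * ENNReal.ofReal (rexp (-l * x)) ∂ν := by
          intro x
          rw [lintegral_mul_const _ (by fun_prop)]
        simp only [this]
        rw [lintegral_lintegral_swap (by fun_prop)]
        refine setLIntegral_congr_fun measurableSet_Ioi ?_
        intro y hy
        exact LT_tail y l hl hy
    rw [(phi_eq b c hb hc ν hνint l hl).2, add_assoc, ← h1]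
    unfold LapT
    rw [hκ, lintegral_add_measure, lintegral_smul_measure, lintegral_dirac]
    simp
  have hWeq : ∀ x, 0 < x → ENNReal.ofReal (W x) = ENNReal.ofReal (W 0) + ∫⁻ y in Set.Ioo 0 x, ENNReal.ofReal (v y) := by
    intro x hx
    rw [setLIntegral_congr Ioo_ae_eq_Ioc, ← ofReal_integral_eq_lintegral_ofReal
      (hvc.integrableOn_Icc.mono_set Set.Ioc_subset_Icc_self) (ae_of_all _ hv0), ← ENNReal.ofReal_add (hWnonneg 0) (integral_nonneg hv0),
      ← intervalIntegral.integral_of_le hx.le,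
      intervalIntegral.integral_eq_sub_of_hasDerivAt_of_le hx.le (hWcont.mono Set.Icc_subset_Ici_self)
        (fun y hy => by rw [hvx y hy.1.le]; exact hW'deriv y hy.1) (hvc.intervalIntegrable _ _)]
    congr 1; ring
  have hLω : ∀ l, 0 < l → LapT ω' l = ENNReal.ofReal (l / phi b c ν l) := by
    intro l hl
    have hphi := (phi_eq b c hb hc ν hνint l hl).1
    have h1 : ∫⁻ x in Set.Ioi (0:ℝ), ENNReal.ofReal (Real.exp (-l * x) * W x) = ENNReal.ofReal (1 / phi b c ν l) := by
      rw [← hWlap l hl, ofReal_integral_eq_lintegral_ofReal]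
      · by_contra hcon
        have h2 := hWlap l hl
        rw [integral_undef hcon] at h2
        have : 0 < 1 / phi b c ν l := by positivity
        linarith
      · exact ae_of_all _ fun x => mul_nonneg (Real.exp_pos _).le (hWnonneg x)
    have h2 : ∫⁻ x in Set.Ioi (0:ℝ), ENNReal.ofReal (Real.exp (-l * x) * W x) 
       = LapT ω' l * ENNReal.ofReal (1 / l) := by
      have h3 : ∀ x ∈ Set.Ioi (0:ℝ), ENNReal.ofReal (Real.exp (-l * x) * W x) =
          ENNReal.ofReal (W 0) * ENNReal.ofReal (Real.exp (-l * x)) + ∫⁻ y in Set.Ioi (0:ℝ), 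
            (Set.Ioi y).indicator (fun x => ENNReal.ofReal (Real.exp (-l * x))) x * ENNReal.ofReal (v y) := by
        intro x hx
        rw [mul_comm, ENNReal.ofReal_mul (hWnonneg x), hWeq x hx, add_mul]
        congr 1
        rw [← lintegral_mul_const _ (by fun_prop), ← lintegral_indicator measurableSet_Ioo,
          ← lintegral_indicator measurableSet_Ioi]
        congr 1
        ext y
        by_cases hy : 0 < y <;> by_cases hyx : y < x <;> simp [Set.indicator, hy, hyx, mul_comm]
      rw [setLIntegral_congr_fun measurableSet_Ioi h3, lintegral_add_left (by fun_prop), 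
        lintegral_const_mul _ (by fun_prop)]
      have hLVl := hLV l hl
      unfold LapT at hLVl ⊢
      rw [hLVl]
      rw [hω', lintegral_add_measure, lintegral_smul_measure, lintegral_dirac, add_mul]
      congr 1
      · simp
      · rw [lintegral_lintegral_swap]
        · rw [hω, lintegral_withDensity_eq_lintegral_mul _ (by fun_prop) (by fun_prop),
            ← lintegral_mul_const _ (by fun_prop)]
          refine setLIntegral_congr_fun measurableSet_Ioi ?_
          intro y hy
          simp only [Pi.mul_apply]
          have hy' : (0:ℝ) < y := hy
          rw [lintegral_mul_const _ ((Measurable.indicator (by fun_prop) measurableSet_Ioi)), 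
            lintegral_indicator measurableSet_Ioi, Measure.restrict_restrict measurableSet_Ioi, 
            Set.inter_eq_left.2 (Set.Ioi_subset_Ioi hy'.le), LT_Ioi y l hl, div_eq_mul_one_div, 
            ENNReal.ofReal_mul (by positivity)]
          ring
        · have : Measurable (fun p : ℝ × ℝ => Set.indicator {p : ℝ × ℝ | p.2 < p.1} 
              (fun p => ENNReal.ofReal (Real.exp (-l * p.1))) p * ENNReal.ofReal (v p.2)) := by
            refine Measurable.mul ?_ (by fun_prop)
            exact Measurable.indicator (by fun_prop) (measurableSet_lt measurable_snd measurable_fst)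
          exact this.aemeasurable
    rw [h1] at h2
    have h4 : LapT ω' l = LapT ω' l * ENNReal.ofReal (1 / l) * ENNReal.ofReal l := by
      rw [mul_assoc, ← ENNReal.ofReal_mul (by positivity)]
      have : 1 / l * l = 1 := by field_simp
      rw [this]; simp
    rw [h4, ← h2, ← ENNReal.ofReal_mul (by positivity)]
    congr 1; ring
  have hLconv : ∀ l, 0 < l → LapT (κ.conv ω') l = LapT V l := by
    intro l hl
    have hphi := (phi_eq b c hb hc ν hνint l hl).1
    rw [LT_conv, hLκ l hl, hLω l hl, hLV l hl, ← ENNReal.ofReal_mul (by positivity)]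
    congr 1
    field_simp
  have hVneg : V (Set.Iio 0) = 0 := by
    rw [hV, Measure.restrict_apply measurableSet_Iio]
    have : Set.Iio (0:ℝ) ∩ Set.Ioi 0 = ∅ := by ext x; simp; intro h; linarith
    simp [this]
  have hκneg : κ (Set.Iio 0) = 0 := by
    rw [hκ, Measure.add_apply, hρ, withDensity_absolutelyContinuous _ _ hVneg]
    simp
  have hωneg : ω' (Set.Iio 0) = 0 := by
    rw [hω', Measure.add_apply, hω, withDensity_absolutelyContinuous _ _ hVneg]
    simp
  have hcneg : (κ.conv ω') (Set.Iio 0) = 0 := by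
    rw [Measure.conv, Measure.map_apply (by fun_prop) measurableSet_Iio]
    refine measure_mono_null (t := (Set.Iio 0 ×ˢ Set.univ) ∪ (Set.univ ×ˢ Set.Iio 0)) ?_ ?_
    · rintro ⟨x, y⟩ hxy
      simp at hxy ⊢
      by_contra hcon
      push Not at hcon
      linarith
    · rw [measure_union_null_iff]
      constructor
      · rw [Measure.prod_prod, hκneg, zero_mul]
      · rw [Measure.prod_prod, hωneg, mul_zero]
  have heq : κ.conv ω' = V := by
    apply laplace_ext hcneg hVneg
    · intro l hl
      have := hLconv l hl
      rw [hLV l hl] at this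
      unfold LapT at this
      rw [this]; simp
    · exact hLconv
  have hle : ENNReal.ofReal c • ω ≤ V := by
    calc ENNReal.ofReal c • ω ≤ ENNReal.ofReal c • ω' := by
          gcongr
          rw [hω']
          exact Measure.le_add_left le_rfl
      _ ≤ κ.conv ω' := by
          rw [hκ, Measure.add_conv, Measure.conv_smul_left, Measure.dirac_zero_conv]
          exact Measure.le_add_right le_rfl
      _ = V := heq
  have hae : ∀ᵐ x ∂V, ENNReal.ofReal (c * v x) ≤ 1 := by
    refine ae_le_of_forall_setLIntegral_le_of_sigmaFinite (by fun_prop) ?_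
    intro s hs _
    have := hle s
    rw [Measure.smul_apply, hω, withDensity_apply _ hs, smul_eq_mul, ← lintegral_const_mul _ (by fun_prop)] at this
    simp only [ENNReal.ofReal_mul hc.le]
    simpa using this
  intro x hx
  refine ⟨hpos' x hx, ?_⟩
  refine closed_ext (fun y => y ≤ 1 / c) isClosed_Iic ?_ x hx
  intro x hx
  by_contra hcon
  push Not at hcon
  have hopen : IsOpen ({y | 1 / c < v y} ∩ Set.Ioi 0) :=
    (isOpen_lt continuous_const hvc).inter isOpen_Ioi
  have hne : ({y | 1 / c < v y} ∩ Set.Ioi 0).Nonempty := ⟨x, by simpa [hvx x hx.le] using hcon, hx⟩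
  have hm := hopen.measure_pos volume hne
  rw [hV, ae_restrict_iff' measurableSet_Ioi, ae_iff] at hae
  refine hm.ne' (measure_mono_null ?_ hae)
  rintro y ⟨hy1, hy2⟩
  simp only [Set.mem_ofPred_eq] at hy1 ⊢
  intro hcon
  have := hcon hy2
  rw [ENNReal.ofReal_le_one] at this
  rw [div_lt_iff₀ hc] at hy1
  linarith

lemma E_lip {a b K : ℝ} (ha : |a| ≤ K) (hb : |b| ≤ K) :
    |(Real.exp (-a) - 1 + a) - (Real.exp (-b) - 1 + b)| ≤ (min 1 K * Real.exp K) * |a - b| := by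
  have hK : 0 ≤ K := (abs_nonneg a).trans ha
  have h := (convex_Icc (-K) K).norm_image_sub_le_of_norm_hasDerivWithin_le
    (f := fun x => Real.exp (-x) - 1 + x) (f' := fun x => Real.exp (-x) * (-1) + 1)
    (C := min 1 K * Real.exp K) (x := b) (y := a) ?_ ?_ (abs_le.1 hb) (abs_le.1 ha)
  · simpa [Real.norm_eq_abs] using h
  · intro x _
    exact ((((hasDerivAt_id x).neg.exp).sub_const 1).add (hasDerivAt_id x)).hasDerivWithinAt
  · intro x hx
    obtain ⟨h1, h2⟩ := hx
    have hup : Real.exp (-x) ≤ Real.exp K := Real.exp_le_exp.2 (by linarith)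
    have hlo : Real.exp (-K) ≤ Real.exp (-x) := Real.exp_le_exp.2 (by linarith)
    have hKK : Real.exp (-K) * Real.exp K = 1 := by rw [← Real.exp_add]; simp
    have e1 := Real.add_one_le_exp K
    have e2 := Real.add_one_le_exp (-K)
    have e3 := Real.exp_pos K
    have e4 := Real.exp_pos (-x)
    have h5 : Real.exp K - 1 ≤ K * Real.exp K := by nlinarith
    have h6 : 1 - Real.exp (-K) ≤ K * Real.exp K := by nlinarith
    rw [Real.norm_eq_abs, abs_le]
    rcases min_choice 1 K with h | h <;> rw [h] <;> constructor <;> nlinarith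

lemma P_cont (f : ℝ → ℝ) (hf : ∀ a b, IntervalIntegrable f volume a b) :
    Continuous (fun p : ℝ × ℝ => ∫ r in (max (p.1 - p.2) 0)..p.1, f r) := by
  have h1 : Continuous (fun x => ∫ r in (0:ℝ)..x, f r) := intervalIntegral.continuous_primitive hf 0
  have : (fun p : ℝ × ℝ => ∫ r in (max (p.1 - p.2) 0)..p.1, f r) =
     fun p => (∫ r in (0:ℝ)..p.1, f r) - ∫ r in (0:ℝ)..(max (p.1 - p.2) 0), f r := by
    ext p
    rw [intervalIntegral.integral_interval_sub_left (hf _ _) (hf _ _)]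
  rw [this]
  fun_prop

lemma bdd_ii (f : ℝ → ℝ) (hf : Measurable f) (M : ℝ) (hM : ∀ s, |f s| ≤ M) (a b : ℝ) :
    IntervalIntegrable f volume a b := by
  refine (intervalIntegrable_const (c := M)).mono_fun hf.aestronglyMeasurable (ae_of_all _ fun x => ?_)
  simp only [Real.norm_eq_abs]
  exact (hM x).trans (le_abs_self M)

lemma F_bound (f : ℝ → ℝ) (M : ℝ) (hM : ∀ s, |f s| ≤ M)
    (s t y : ℝ) (hs : 0 ≤ s) (hst : s ≤ t) (hy : 0 < y) :
    |∫ r in (max (s - y) 0)..s, f r| ≤ M * min y t := by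
  have hM0 : 0 ≤ M := (abs_nonneg _).trans (hM 0)
  have := intervalIntegral.norm_integral_le_of_norm_le_const (f := f) (C := M) (a := max (s - y) 0) (b := s) (fun x _ => hM x)
  refine (Real.norm_eq_abs _ ▸ this).trans ?_
  gcongr
  rw [abs_of_nonneg (by rw [sub_nonneg]; exact max_le (by linarith) hs)]
  apply le_min
  · linarith [le_max_left (s - y) 0]
  · linarith [le_max_right (s - y) 0]

lemma lip_coeff (M t y : ℝ) (hM : 0 ≤ M) (ht : 0 ≤ t) (hy : 0 < y) :
    min 1 (M * min y t) * Real.exp (M * min y t) ≤ min 1 y * Real.exp (M * (1 + t)) := by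
  have e1 := Real.add_one_le_exp M
  have e2 : Real.exp (M * (1 + t)) = Real.exp M * Real.exp (M * t) := by rw [← Real.exp_add]; ring_nf
  have h1 : Real.exp (M * min y t) ≤ Real.exp (M * t) :=
    Real.exp_le_exp.2 (mul_le_mul_of_nonneg_left (min_le_right _ _) hM)
  have h2 : min 1 (M * min y t) ≤ min 1 y * Real.exp M := by
    rcases min_choice 1 y with h | h <;> rw [h]
    · exact (min_le_left _ _).trans (by linarith)
    · refine (min_le_right _ _).trans ?_
      calc M * min y t ≤ M * y := mul_le_mul_of_nonneg_left (min_le_left _ _) hM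
        _ ≤ y * Real.exp M := by nlinarith
  rw [e2, ← mul_assoc]
  have h3 : 0 ≤ min y t := by positivity
  exact mul_le_mul h2 h1 (by positivity) (by positivity)

lemma E_diff (f₁ f₂ : ℝ → ℝ) (hf₁ : Measurable f₁) (hf₂ : Measurable f₂) (M : ℝ)
    (h₁ : ∀ s, |f₁ s| ≤ M) (h₂ : ∀ s, |f₂ s| ≤ M)
    (s t y : ℝ) (hs : 0 ≤ s) (hst : s ≤ t) (hy : 0 < y) :
    |(Real.exp (-(∫ r in (max (s - y) 0)..s, f₁ r)) - 1 + ∫ r in (max (s - y) 0)..s, f₁ r) -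
     (Real.exp (-(∫ r in (max (s - y) 0)..s, f₂ r)) - 1 + ∫ r in (max (s - y) 0)..s, f₂ r)|
     ≤ min 1 y * Real.exp (M * (1 + t)) * ∫ r in (max (s - y) 0)..s, |f₁ r - f₂ r| := by
  have hM : 0 ≤ M := (abs_nonneg _).trans (h₁ 0)
  have hle : max (s - y) 0 ≤ s := max_le (by linarith) hs
  refine (E_lip (F_bound f₁ M h₁ s t y hs hst hy) (F_bound f₂ M h₂ s t y hs hst hy)).trans ?_
  refine mul_le_mul (lip_coeff M t y hM (hs.trans hst) hy) ?_ (abs_nonneg _) (by positivity)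
  rw [← intervalIntegral.integral_sub (bdd_ii f₁ hf₁ M h₁ _ _) (bdd_ii f₂ hf₂ M h₂ _ _)]
  exact intervalIntegral.abs_integral_le_integral_abs hle

noncomputable def EF (f : ℝ → ℝ) (s y : ℝ) : ℝ :=
  Real.exp (-(∫ r in (max (s - y) 0)..s, f r)) - 1 + ∫ r in (max (s - y) 0)..s, f r

lemma minint (ν : Measure ℝ)
    (hνint : ∫⁻ y in Set.Ioi (0 : ℝ), ENNReal.ofReal (min y (y ^ 2)) ∂ν ≠ ⊤) :
    Integrable (fun y : ℝ => min y (y ^ 2)) (ν.restrict (Set.Ioi 0)) := by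
  refine ⟨by fun_prop, ?_⟩
  rw [hasFiniteIntegral_iff_ofReal]
  · exact lt_top_iff_ne_top.2 hνint
  · filter_upwards [ae_restrict_mem measurableSet_Ioi] with y hy
    have : (0:ℝ) < y := hy
    change 0 ≤ min y (y ^ 2)
    positivity

lemma min1_mul (y : ℝ) (hy : 0 < y) : min 1 y * y = min y (y ^ 2) := by
  rw [min_mul_of_nonneg _ _ hy.le, one_mul, sq]

lemma EF_cont (f : ℝ → ℝ) (hf : ∀ a b, IntervalIntegrable f volume a b) :
    Continuous (fun p : ℝ × ℝ => EF f p.1 p.2) := by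
  have := P_cont f hf
  unfold EF
  fun_prop

lemma EF_bound (f : ℝ → ℝ) (hf : Measurable f) (M : ℝ)
    (h : ∀ s, |f s| ≤ M) (s t y : ℝ) (hs : 0 ≤ s) (hst : s ≤ t) (hy : 0 < y) :
    |EF f s y| ≤ Real.exp (M * (1 + t)) * M * min y (y ^ 2) := by
  have hM : 0 ≤ M := (abs_nonneg _).trans (h 0)
  have h1 := E_diff f 0 hf measurable_const M h (by simpa using hM) s t y hs hst hy
  have h2 := F_bound (fun r => |f r|) M (by simpa using h) s t y hs hst hy
  simp only [Pi.zero_apply, intervalIntegral.integral_zero, sub_zero, neg_zero, Real.exp_zero, sub_self, add_zero] at h1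
  refine h1.trans ?_
  rw [← min1_mul y hy]
  calc _ ≤ min 1 y * rexp (M * (1 + t)) * (M * y) := by
        gcongr
        exact (le_abs_self _).trans (h2.trans (mul_le_mul_of_nonneg_left (min_le_left _ _) hM))
    _ = _ := by ring

lemma EF_int (ν : Measure ℝ)
    (hνint : ∫⁻ y in Set.Ioi (0 : ℝ), ENNReal.ofReal (min y (y ^ 2)) ∂ν ≠ ⊤)
    (f : ℝ → ℝ) (hf : Measurable f) (M : ℝ)
    (h : ∀ s, |f s| ≤ M) (s : ℝ) (hs : 0 ≤ s) :
    Integrable (EF f s) (ν.restrict (Set.Ioi 0)) := by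
  refine ((minint ν hνint).const_mul (Real.exp (M * (1 + s)) * M)).mono' ?_ ?_
  · have := (EF_cont f (bdd_ii f hf M h)).comp (Continuous.prodMk_right s)
    exact this.aestronglyMeasurable
  · filter_upwards [ae_restrict_mem measurableSet_Ioi] with y hy
    exact EF_bound f hf M h s s y hs le_rfl hy

lemma Rop_meas (c : ℝ) (ν : Measure ℝ) [SFinite (ν.restrict (Set.Ioi (0:ℝ)))]
    (f : ℝ → ℝ) (hf : Measurable f) (M : ℝ) (h : ∀ s, |f s| ≤ M) : Measurable (Rop c ν f) := by
  have h1 : StronglyMeasurable (fun s => ∫ y in Set.Ioi (0:ℝ), EF f s y ∂ν) :=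
    (EF_cont f (bdd_ii f hf M h)).stronglyMeasurable.integral_prod_right'
  have := h1.measurable
  change Measurable (fun s => c * f s ^ 2 + ∫ y in Set.Ioi (0:ℝ), EF f s y ∂ν)
  fun_prop

lemma Rop_bound (c : ℝ) (hc : 0 < c) (ν : Measure ℝ)
    (hνint : ∫⁻ y in Set.Ioi (0 : ℝ), ENNReal.ofReal (min y (y ^ 2)) ∂ν ≠ ⊤)
    (f : ℝ → ℝ) (hf : Measurable f) (M : ℝ) (h : ∀ s, |f s| ≤ M) (s t : ℝ) (hs : 0 ≤ s) (hst : s ≤ t) :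
    |Rop c ν f s| ≤ c * M ^ 2 + Real.exp (M * (1 + t)) * M * ∫ y in Set.Ioi (0:ℝ), min y (y^2) ∂ν := by
  change |c * f s ^ 2 + ∫ y in Set.Ioi (0:ℝ), EF f s y ∂ν| ≤ _
  refine (abs_add_le _ _).trans (add_le_add ?_ ?_)
  · rw [abs_mul, abs_pow, abs_of_pos hc]
    gcongr
    exact h s
  · rw [← integral_const_mul, ← Real.norm_eq_abs]
    refine norm_integral_le_of_norm_le ((minint ν hνint).const_mul _) ?_
    filter_upwards [ae_restrict_mem measurableSet_Ioi] with y hy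
    exact EF_bound f hf M h s t y hs hst hy

lemma D_bound (g : ℝ → ℝ) (hg : Measurable g) (M : ℝ) (hM : ∀ s, |g s| ≤ M) (hg0 : ∀ s, 0 ≤ g s)
    (t y : ℝ) (ht : 0 ≤ t) (hy : 0 < y) :
    ∫⁻ s in Set.Ioc 0 t, ENNReal.ofReal (∫ r in (max (s - y) 0)..s, g r)
      ≤ ENNReal.ofReal y * ENNReal.ofReal (∫ r in (0:ℝ)..t, g r) := by
  have h1 : ∀ s ∈ Set.Ioc 0 t, ENNReal.ofReal (∫ r in (max (s - y) 0)..s, g r)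
      ≤ ∫⁻ r in Set.Ioc 0 t, (Set.Ico r (r + y)).indicator 1 s * ENNReal.ofReal (g r) := by
    intro s hs
    have hle : max (s - y) 0 ≤ s := max_le (by linarith) hs.1.le
    rw [intervalIntegral.integral_of_le hle, ofReal_integral_eq_lintegral_ofReal
      ((intervalIntegrable_iff_integrableOn_Ioc_of_le hle).1 (bdd_ii g hg M hM _ _)) (ae_of_all _ hg0)]
    rw [← lintegral_indicator measurableSet_Ioc, ← lintegral_indicator measurableSet_Ioc]
    refine lintegral_mono fun r => ?_
    by_cases hr : r ∈ Set.Ioc (max (s - y) 0) s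
    · have h3 := hr.1
      rw [max_lt_iff] at h3
      have h4 : r ∈ Set.Ioc 0 t := ⟨h3.2, hr.2.trans hs.2⟩
      have h5 : s ∈ Set.Ico r (r + y) := ⟨hr.2, by linarith⟩
      simp only [Set.indicator_of_mem hr, Set.indicator_of_mem h4, Set.indicator_of_mem h5]
      simp
    · simp [Set.indicator_of_notMem hr]
  refine (setLIntegral_mono' measurableSet_Ioc h1).trans ?_
  rw [lintegral_lintegral_swap]
  · rw [intervalIntegral.integral_of_le ht, ofReal_integral_eq_lintegral_ofReal
      ((intervalIntegrable_iff_integrableOn_Ioc_of_le ht).1 (bdd_ii g hg M hM _ _)) (ae_of_all _ hg0),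
      ← lintegral_const_mul _ (by fun_prop)]
    refine lintegral_mono fun r => ?_
    rw [lintegral_mul_const _ (measurable_one.indicator measurableSet_Ico)]
    gcongr
    rw [lintegral_indicator_one measurableSet_Ico]
    refine (Measure.restrict_apply_le _ _).trans ?_
    simp
  · have : Measurable (fun p : ℝ × ℝ => Set.indicator {p : ℝ × ℝ | p.2 ≤ p.1 ∧ p.1 < p.2 + y}
              (fun p => (1:ENNReal)) p * ENNReal.ofReal (g p.2)) := by
      refine Measurable.mul ?_ (by fun_prop)
      exact Measurable.indicator (by fun_prop) ((measurableSet_le measurable_snd measurable_fst).inter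
        (measurableSet_lt measurable_fst (by fun_prop)))
    exact this.aemeasurable

lemma conv_ii (c : ℝ) (hc : 0 < c) (ν : Measure ℝ)
    (hνint : ∫⁻ y in Set.Ioi (0 : ℝ), ENNReal.ofReal (min y (y ^ 2)) ∂ν ≠ ⊤)
    (W' : ℝ → ℝ) (hW'cont : ContinuousOn W' (Set.Ici 0))
    (hW : ∀ x, 0 ≤ x → 0 ≤ W' x ∧ W' x ≤ 1 / c)
    (f : ℝ → ℝ) (hf : Measurable f) (M : ℝ) (h : ∀ s, |f s| ≤ M) (t : ℝ) (ht : 0 ≤ t) :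
    IntervalIntegrable (fun s => Rop c ν f s * W' (t - s)) volume 0 t := by
  have hsf := sfinite_nu ν hνint
  have hM : 0 ≤ M := (abs_nonneg _).trans (h 0)
  have hvc : Continuous (fun s => W' (max (t - s) 0)) :=
    hW'cont.comp_continuous (by fun_prop) (fun x => Set.mem_Ici.2 (le_max_right _ _))
  have hR := Rop_meas c ν f hf M h
  have h1 : IntervalIntegrable (fun s => Rop c ν f s * W' (max (t - s) 0)) volume 0 t := by
    refine (intervalIntegrable_const (c := (c * M ^ 2 + Real.exp (M * (1 + t)) * M * ∫ y in Set.Ioi (0:ℝ), min y (y^2) ∂ν) * (1 / c))).mono_fun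
      (hR.mul hvc.measurable).aestronglyMeasurable ?_
    rw [Set.uIoc_of_le ht]
    filter_upwards [ae_restrict_mem measurableSet_Ioc] with s hs
    refine le_trans ?_ (le_abs_self _)
    rw [norm_mul, Real.norm_eq_abs, Real.norm_eq_abs]
    have hb := Rop_bound c hc ν hνint f hf M h s t hs.1.le hs.2
    have hw := hW (max (t - s) 0) (le_max_right _ _)
    refine mul_le_mul hb ?_ (abs_nonneg _) ((abs_nonneg _).trans hb)
    rw [abs_of_nonneg hw.1]; exact hw.2
  refine h1.congr ?_
  rw [Set.uIoc_of_le ht]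
  intro s hs
  have : max (t - s) 0 = t - s := max_eq_left (by linarith [hs.2])
  simp [this]

lemma main_aux (c : ℝ) (hc : 0 < c) (ν : Measure ℝ)
    (hνint : ∫⁻ y in Set.Ioi (0 : ℝ), ENNReal.ofReal (min y (y ^ 2)) ∂ν ≠ ⊤)
    (W' : ℝ → ℝ) (hW'cont : ContinuousOn W' (Set.Ici 0))
    (hW : ∀ x, 0 ≤ x → 0 ≤ W' x ∧ W' x ≤ 1 / c)
    (f₁ f₂ : ℝ → ℝ) (hf₁ : Measurable f₁) (hf₂ : Measurable f₂) (M₁ M₂ : ℝ)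
    (h₁ : ∀ s, |f₁ s| ≤ M₁) (h₂ : ∀ s, |f₂ s| ≤ M₂) (t : ℝ) (ht : 0 ≤ t) :
    |(∫ s in (0 : ℝ)..t, Rop c ν f₁ s * W' (t - s)) -
            ∫ s in (0 : ℝ)..t, Rop c ν f₂ s * W' (t - s)| ≤
      (1 + (∫ y in Set.Ioi (0:ℝ), min y (y^2) ∂ν) / c) * Real.exp ((M₁ + M₂) * (1 + t)) *
        ∫ s in (0 : ℝ)..t, |f₁ s - f₂ s| := by
  have hsf := sfinite_nu ν hνint
  have hM₁ : 0 ≤ M₁ := (abs_nonneg _).trans (h₁ 0)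
  have hM₂ : 0 ≤ M₂ := (abs_nonneg _).trans (h₂ 0)
  set M := M₁ + M₂ with hMdef
  set g : ℝ → ℝ := fun s => |f₁ s - f₂ s| with hg
  have hgm : Measurable g := by fun_prop
  have hg0 : ∀ s, 0 ≤ g s := fun s => abs_nonneg _
  have hgM : ∀ s, |g s| ≤ M := fun s => by
    rw [abs_of_nonneg (hg0 s)]
    exact (abs_sub _ _).trans (add_le_add (h₁ s) (h₂ s))
  have h₁' : ∀ s, |f₁ s| ≤ M := fun s => (h₁ s).trans (by linarith)
  have h₂' : ∀ s, |f₂ s| ≤ M := fun s => (h₂ s).trans (by linarith)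
  set J := ∫ y in Set.Ioi (0:ℝ), min y (y^2) ∂ν with hJ
  have hmin0 : ∀ᵐ y ∂(ν.restrict (Set.Ioi (0:ℝ))), 0 ≤ min y (y ^ 2) := by
    filter_upwards [ae_restrict_mem measurableSet_Ioi] with y hy
    have : (0:ℝ) < y := hy
    positivity
  have hJ0 : 0 ≤ J := integral_nonneg_of_ae hmin0
  set e := Real.exp (M * (1 + t)) with he
  have heM : M ≤ e := by
    have := Real.add_one_le_exp (M * (1 + t))
    nlinarith
  have he0 : 0 < e := Real.exp_pos _
  set I := ∫ s in (0 : ℝ)..t, g s with hI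
  have hI0 : 0 ≤ I := intervalIntegral.integral_nonneg ht fun s _ => hg0 s
  rw [← intervalIntegral.integral_sub (conv_ii c hc ν hνint W' hW'cont hW f₁ hf₁ M h₁' t ht)
    (conv_ii c hc ν hνint W' hW'cont hW f₂ hf₂ M h₂' t ht), intervalIntegral.integral_of_le ht,
    ← Real.norm_eq_abs, ← ENNReal.ofReal_le_ofReal_iff (by positivity), ofReal_norm]
  refine (enorm_integral_le_lintegral_enorm _).trans ?_
  have hDm : Measurable (fun p : ℝ × ℝ => ENNReal.ofReal (∫ r in (max (p.1 - p.2) 0)..p.1, g r)) :=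
    (P_cont g (bdd_ii g hgm M hgM)).measurable.ennreal_ofReal
  have hpt : ∀ s ∈ Set.Ioc 0 t, ‖Rop c ν f₁ s * W' (t - s) - Rop c ν f₂ s * W' (t - s)‖ₑ ≤
      ENNReal.ofReal e * ENNReal.ofReal (g s) + ENNReal.ofReal (e / c) * 
        ∫⁻ y in Set.Ioi (0:ℝ), ENNReal.ofReal (min 1 y) * ENNReal.ofReal (∫ r in (max (s - y) 0)..s, g r) ∂ν := by
    intro s hs
    have hdiff : Rop c ν f₁ s * W' (t - s) - Rop c ν f₂ s * W' (t - s) =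
        c * W' (t - s) * (f₁ s + f₂ s) * (f₁ s - f₂ s) + W' (t - s) * ∫ y in Set.Ioi (0:ℝ), (EF f₁ s y - EF f₂ s y) ∂ν := by
      rw [integral_sub (EF_int ν hνint f₁ hf₁ M h₁' s hs.1.le) (EF_int ν hνint f₂ hf₂ M h₂' s hs.1.le)]
      change (c * f₁ s ^ 2 + ∫ y in Set.Ioi (0:ℝ), EF f₁ s y ∂ν) * _ - (c * f₂ s ^ 2 + ∫ y in Set.Ioi (0:ℝ), EF f₂ s y ∂ν) * _ = _
      ring
    obtain ⟨hw0, hw1⟩ := hW (t - s) (by linarith [hs.2])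
    rw [hdiff]
    refine (enorm_add_le _ _).trans (add_le_add ?_ ?_)
    · rw [← ENNReal.ofReal_mul he0.le, ← ofReal_norm]
      apply ENNReal.ofReal_le_ofReal
      rw [norm_mul, norm_mul, Real.norm_eq_abs, Real.norm_eq_abs, Real.norm_eq_abs]
      refine mul_le_mul_of_nonneg_right ?_ (hg0 s)
      have h3 : |c * W' (t - s)| ≤ 1 := by
        rw [abs_of_nonneg (by positivity)]
        calc c * W' (t - s) ≤ c * (1 / c) := by gcongr
          _ = 1 := by field_simp
      have h4 : |f₁ s + f₂ s| ≤ M := (abs_add_le _ _).trans (add_le_add (h₁ s) (h₂ s))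
      calc _ ≤ 1 * M := mul_le_mul h3 h4 (abs_nonneg _) zero_le_one
        _ ≤ e := by linarith
    · rw [enorm_mul]
      have h3 : ‖W' (t - s)‖ₑ ≤ ENNReal.ofReal (1 / c) := by
        rw [← ofReal_norm, Real.norm_of_nonneg hw0]
        exact ENNReal.ofReal_le_ofReal hw1
      have h4 : ‖∫ y in Set.Ioi (0:ℝ), (EF f₁ s y - EF f₂ s y) ∂ν‖ₑ ≤ ENNReal.ofReal e * 
        ∫⁻ y in Set.Ioi (0:ℝ), ENNReal.ofReal (min 1 y) * ENNReal.ofReal (∫ r in (max (s - y) 0)..s, g r) ∂ν := by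
        refine (enorm_integral_le_lintegral_enorm _).trans ?_
        rw [← lintegral_const_mul' _ _ ENNReal.ofReal_ne_top]
        refine setLIntegral_mono' measurableSet_Ioi ?_
        intro y hy
        have hy' : (0:ℝ) < y := hy
        rw [← ENNReal.ofReal_mul (by positivity), ← ENNReal.ofReal_mul he0.le, ← ofReal_norm]
        apply ENNReal.ofReal_le_ofReal
        refine (E_diff f₁ f₂ hf₁ hf₂ M h₁' h₂' s t y hs.1.le hs.2 hy').trans_eq ?_
        ring
      refine (mul_le_mul' h3 h4).trans_eq ?_
      rw [← mul_assoc, ← ENNReal.ofReal_mul (by positivity)]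
      congr 2; ring
  refine (setLIntegral_mono' measurableSet_Ioc hpt).trans ?_
  rw [lintegral_add_left (by fun_prop), lintegral_const_mul _ (by fun_prop), lintegral_const_mul' _ _ ENNReal.ofReal_ne_top]
  have hgI : ∫⁻ s in Set.Ioc 0 t, ENNReal.ofReal (g s) = ENNReal.ofReal I := by
    rw [hI, intervalIntegral.integral_of_le ht, ofReal_integral_eq_lintegral_ofReal
      ((intervalIntegrable_iff_integrableOn_Ioc_of_le ht).1 (bdd_ii g hgm M hgM _ _)) (ae_of_all _ hg0)]
  have hD : ∫⁻ s in Set.Ioc 0 t, ∫⁻ y in Set.Ioi (0:ℝ), ENNReal.ofReal (min 1 y) * 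
      ENNReal.ofReal (∫ r in (max (s - y) 0)..s, g r) ∂ν ≤ ENNReal.ofReal J * ENNReal.ofReal I := by
    rw [lintegral_lintegral_swap]
    · rw [hJ, ofReal_integral_eq_lintegral_ofReal (minint ν hνint) hmin0, ← lintegral_mul_const _ (by fun_prop)]
      refine setLIntegral_mono' measurableSet_Ioi ?_
      intro y hy
      have hy' : (0:ℝ) < y := hy
      rw [lintegral_const_mul' _ _ ENNReal.ofReal_ne_top, ← min1_mul y hy', ENNReal.ofReal_mul (by positivity), mul_assoc]
      gcongr
      exact D_bound g hgm M hgM hg0 t y ht hy'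
    · refine Measurable.aemeasurable ?_
      exact Measurable.mul (by fun_prop) hDm
  calc _ ≤ ENNReal.ofReal e * ENNReal.ofReal I + ENNReal.ofReal (e / c) * (ENNReal.ofReal J * ENNReal.ofReal I) := by
        rw [hgI]; gcongr
    _ = _ := by
        rw [← ENNReal.ofReal_mul hJ0, ← ENNReal.ofReal_mul he0.le, ← ENNReal.ofReal_mul (by positivity),
          ← ENNReal.ofReal_add (by positivity) (by positivity)]
        congr 1
        field_simp

lemma trunc_facts (c : ℝ) (ν : Measure ℝ) (f : ℝ → ℝ) (hf : Measurable f) (t : ℝ) (ht : 0 ≤ t)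
    (hb : ∀ T : ℝ, 0 ≤ T → ∃ M : ℝ, ∀ s ∈ Set.Icc (0 : ℝ) T, |f s| ≤ M) :
    (∀ s, |(Set.Icc 0 t).indicator f s| ≤ ⨆ s : Set.Icc (0 : ℝ) t, |f s|) ∧
    ∀ s ∈ Set.Icc 0 t, Rop c ν ((Set.Icc 0 t).indicator f) s = Rop c ν f s := by
  obtain ⟨M, hM⟩ := hb t ht
  have hbdd : BddAbove (Set.range fun s : Set.Icc (0:ℝ) t => |f s|) := by
    refine ⟨M, ?_⟩
    rintro _ ⟨s, rfl⟩
    exact hM s s.2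
  constructor
  · intro s
    by_cases hs : s ∈ Set.Icc 0 t
    · rw [Set.indicator_of_mem hs]
      exact le_ciSup hbdd (⟨s, hs⟩ : Set.Icc (0:ℝ) t)
    · rw [Set.indicator_of_notMem hs, abs_zero]
      exact Real.iSup_nonneg fun _ => abs_nonneg _
  · intro s hs
    unfold Rop
    rw [Set.indicator_of_mem hs]
    congr 1
    refine setIntegral_congr_fun measurableSet_Ioi ?_
    intro y hy
    have hy' : (0:ℝ) < y := hy
    have : ∫ r in (max (s - y) 0)..s, (Set.Icc 0 t).indicator f r = ∫ r in (max (s - y) 0)..s, f r := by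
      apply intervalIntegral.integral_congr
      intro r hr
      rw [Set.uIcc_of_le (max_le (by linarith) hs.1)] at hr
      have hr' : r ∈ Set.Icc 0 t := ⟨(le_max_right _ _).trans hr.1, hr.2.trans hs.2⟩
      simp only [Set.indicator_of_mem hr']
    simp only [this]


/-- Proposition 7.2: Lipschitz-type bound for `f ↦ (𝓡∘f) * W′`. -/
theorem stmt17
    (b c : ℝ) (hb : 0 ≤ b) (hc : 0 < c)
    (ν : Measure ℝ) (hν0 : ν (Set.Iic 0) = 0)
    (hνint : ∫⁻ y in Set.Ioi (0 : ℝ), ENNReal.ofReal (min y (y ^ 2)) ∂ν ≠ ⊤)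
    (W W' : ℝ → ℝ)
    (hWneg : ∀ x : ℝ, x < 0 → W x = 0)
    (hWnonneg : ∀ x : ℝ, 0 ≤ W x)
    (hWcont : ContinuousOn W (Set.Ici 0))
    (hWmono : StrictMonoOn W (Set.Ici 0))
    (hWlap : ∀ l : ℝ, 0 < l →
      (∫ x in Set.Ioi (0 : ℝ), Real.exp (-l * x) * W x) = 1 / phi b c ν l)
    (hW'neg : ∀ x : ℝ, x < 0 → W' x = 0)
    (hW'zero : W' 0 = 1 / c)
    (hW'deriv : ∀ x : ℝ, 0 < x → HasDerivAt W (W' x) x)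
    (hW'cont : ContinuousOn W' (Set.Ici 0))
    :
    ∃ C : ℝ, 0 < C ∧ ∀ f₁ f₂ : ℝ → ℝ, Measurable f₁ → Measurable f₂ →
      (∀ T : ℝ, 0 ≤ T → ∃ M : ℝ, ∀ s ∈ Set.Icc (0 : ℝ) T, |f₁ s| ≤ M) →
      (∀ T : ℝ, 0 ≤ T → ∃ M : ℝ, ∀ s ∈ Set.Icc (0 : ℝ) T, |f₂ s| ≤ M) →
      ∀ t : ℝ, 0 ≤ t →
        |(∫ s in (0 : ℝ)..t, Rop c ν f₁ s * W' (t - s)) -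
            ∫ s in (0 : ℝ)..t, Rop c ν f₂ s * W' (t - s)| ≤
          C * Real.exp (((⨆ s : Set.Icc (0 : ℝ) t, |f₁ s|) +
              (⨆ s : Set.Icc (0 : ℝ) t, |f₂ s|)) * (1 + t)) * (1 + t) ^ 2 *
            ∫ s in (0 : ℝ)..t, |f₁ s - f₂ s| := by
  have hW := Wprime_bound b c hb hc ν hνint W W' hWnonneg hWcont hWmono hWlap hW'deriv hW'cont
  have hJ0 : 0 ≤ ∫ y in Set.Ioi (0:ℝ), min y (y^2) ∂ν := by
    refine integral_nonneg_of_ae ?_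
    filter_upwards [ae_restrict_mem measurableSet_Ioi] with y hy
    have : (0:ℝ) < y := hy
    change 0 ≤ min y (y ^ 2)
    positivity
  refine ⟨1 + (∫ y in Set.Ioi (0:ℝ), min y (y^2) ∂ν) / c, by positivity, ?_⟩
  intro f₁ f₂ hf₁ hf₂ hb₁ hb₂ t ht
  obtain ⟨hs₁, hR₁⟩ := trunc_facts c ν f₁ hf₁ t ht hb₁
  obtain ⟨hs₂, hR₂⟩ := trunc_facts c ν f₂ hf₂ t ht hb₂
  have key := main_aux c hc ν hνint W' hW'cont hW _ _ (hf₁.indicator (measurableSet_Icc (a := 0) (b := t)))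
    (hf₂.indicator (measurableSet_Icc (a := 0) (b := t))) _ _ hs₁ hs₂ t ht
  have e1 : ∫ s in (0 : ℝ)..t, Rop c ν ((Set.Icc 0 t).indicator f₁) s * W' (t - s) = 
      ∫ s in (0 : ℝ)..t, Rop c ν f₁ s * W' (t - s) := by
    apply intervalIntegral.integral_congr
    intro s hs
    rw [Set.uIcc_of_le ht] at hs
    simp only [hR₁ s hs]
  have e2 : ∫ s in (0 : ℝ)..t, Rop c ν ((Set.Icc 0 t).indicator f₂) s * W' (t - s) = 
      ∫ s in (0 : ℝ)..t, Rop c ν f₂ s * W' (t - s) := by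
    apply intervalIntegral.integral_congr
    intro s hs
    rw [Set.uIcc_of_le ht] at hs
    simp only [hR₂ s hs]
  have e3 : ∫ s in (0 : ℝ)..t, |(Set.Icc 0 t).indicator f₁ s - (Set.Icc 0 t).indicator f₂ s| = 
      ∫ s in (0 : ℝ)..t, |f₁ s - f₂ s| := by
    apply intervalIntegral.integral_congr
    intro s hs
    rw [Set.uIcc_of_le ht] at hs
    simp only [Set.indicator_of_mem hs]
  rw [e1, e2, e3] at key
  refine key.trans ?_
  have hI0 : 0 ≤ ∫ s in (0 : ℝ)..t, |f₁ s - f₂ s| :=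
    intervalIntegral.integral_nonneg ht fun s _ => abs_nonneg _
  refine mul_le_mul_of_nonneg_right ?_ hI0
  refine le_mul_of_one_le_right (by positivity) ?_
  nlinarith
end
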